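/- For every positive integer n, the 2n-th prime satisfies p_{2n} > ⌊2 n log n + 2⌋; equivalently, the number of primes up to ⌊2 n log n + 2⌋ is strictly less than 2n. -/

import Mathlib

section
open Complex Metric

/-- Extraction of `N` zeros in the disc of radius `r`. -/
def ZExtract (f : ℂ → ℂ) (r : ℝ) (Z : List ℂ) (g : ℂ → ℂ) : Prop :=
  Differentiable ℂ g ∧ (∀ z, f z = (Z.map (fun ρ => 1 - z / ρ)).prod * g z) ∧
    ∀ ρ ∈ Z, ‖ρ‖ ≤ r ∧ f ρ = 0

lemma zprod_lower (Z : List ℂ) (r : ℝ) (h0 : ∀ ρ ∈ Z, ρ ≠ 0) (h : ∀ ρ ∈ Z, ‖ρ‖ ≤ r) (z : ℂ)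
    (hz : ‖z‖ = 3 * r) : (2:ℝ) ^ Z.length ≤ ‖(Z.map (fun ρ => 1 - z / ρ)).prod‖ := by
  induction Z with
  | nil => simp
  | cons a t ih =>
    have ih' := ih (fun ρ hρ => h0 ρ (List.mem_cons_of_mem _ hρ)) (fun ρ hρ => h ρ (List.mem_cons_of_mem _ hρ))
    have ha0 : 0 < ‖a‖ := norm_pos_iff.2 (h0 a (by simp))
    have ha : ‖a‖ ≤ r := h a (by simp)
    have h2 : 2 ≤ ‖1 - z / a‖ := by
      have h3 : 3 ≤ ‖z / a‖ := by
        rw [norm_div, hz, le_div_iff₀ ha0]; linarith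
      have := norm_sub_norm_le (z / a) 1
      rw [norm_sub_rev] at this
      rw [norm_one] at this
      linarith
    simp only [List.length_cons, List.map_cons, List.prod_cons, norm_mul, pow_succ]
    nlinarith [norm_nonneg (List.map (fun ρ => 1 - z / ρ) t).prod, pow_pos (two_pos : (0:ℝ) < 2) t.length]

lemma zext_zero (f : ℂ → ℂ) (r : ℝ) (Z : List ℂ) (g : ℂ → ℂ) (h : ZExtract f r Z g) : g 0 = f 0 := by
  have := h.2.1 0
  simp at this
  exact this.symm

lemma zext_ne (f : ℂ → ℂ) (h0 : f 0 ≠ 0) (r : ℝ) (Z : List ℂ) (g : ℂ → ℂ) (h : ZExtract f r Z g) :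
    ∀ ρ ∈ Z, ρ ≠ 0 := by
  rintro ρ hρ rfl
  exact h0 (h.2.2 _ hρ).2

lemma zext_bound (f : ℂ → ℂ) (h0 : f 0 ≠ 0) (r : ℝ) (hr : 0 < r) (Z : List ℂ) (g : ℂ → ℂ)
    (h : ZExtract f r Z g) (B : ℝ) (hB : ∀ z, ‖z‖ = 3 * r → ‖f z‖ ≤ B) (z : ℂ) (hz : ‖z‖ ≤ 3 * r) :
    ‖g z‖ ≤ B / 2 ^ Z.length := by
  have h3 : (0:ℝ) < 3 * r := by positivity
  refine norm_le_of_forall_mem_frontier_norm_le (U := ball (0:ℂ) (3 * r)) isBounded_ball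
    h.1.diffContOnCl ?_ ?_
  · intro w hw
    rw [frontier_ball _ h3.ne', mem_sphere_zero_iff_norm] at hw
    have h1 := zprod_lower Z r (zext_ne f h0 r Z g h) (fun ρ hρ => (h.2.2 ρ hρ).1) w hw
    have h2 := hB w hw
    rw [h.2.1 w, norm_mul] at h2
    rw [le_div_iff₀ (by positivity)]
    nlinarith [norm_nonneg (g w)]
  · rw [closure_ball _ h3.ne']
    simpa using hz

lemma zext_exists (f : ℂ → ℂ) (hf : Differentiable ℂ f) (h0 : f 0 ≠ 0) (r : ℝ) (hr : 0 < r) (B : ℝ)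
    (hB : ∀ z, ‖z‖ = 3 * r → ‖f z‖ ≤ B) :
    ∃ Z g, ZExtract f r Z g ∧ ∀ z, ‖z‖ ≤ r → g z ≠ 0 := by
  by_contra hcon
  push Not at hcon
  have key : ∀ N : ℕ, ∃ Z g, ZExtract f r Z g ∧ Z.length = N := by
    intro N
    induction N with
    | zero => exact ⟨[], f, ⟨hf, by simp, by simp⟩, rfl⟩
    | succ N ih =>
      obtain ⟨Z, g, hZ, hl⟩ := ih
      obtain ⟨a, ha, hga⟩ := hcon Z g hZ
      have hfa : f a = 0 := by rw [hZ.2.1 a, hga, mul_zero]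
      have ha0 : a ≠ 0 := by rintro rfl; exact h0 hfa
      refine ⟨a :: Z, fun z => -a * dslope g a z, ⟨?_, ?_, ?_⟩, by simp [hl]⟩
      · have : Differentiable ℂ (dslope g a) := by
          rw [← differentiableOn_univ]
          exact (differentiableOn_dslope Filter.univ_mem).2 hZ.1.differentiableOn
        exact this.const_mul _
      · intro z
        have h1 := sub_smul_dslope g a z
        rw [hga, sub_zero, smul_eq_mul] at h1
        rw [hZ.2.1 z, ← h1]
        simp only [List.map_cons, List.prod_cons]
        field_simp
        ring
      · intro ρ hρ
        rcases List.mem_cons.1 hρ with rfl | h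
        · exact ⟨ha, hfa⟩
        · exact hZ.2.2 ρ h
  have hpos : 0 < ‖f 0‖ := norm_pos_iff.2 h0
  obtain ⟨N, hN⟩ := pow_unbounded_of_one_lt (B / ‖f 0‖) (one_lt_two (α := ℝ))
  obtain ⟨Z, g, hZ, hl⟩ := key N
  have := zext_bound f h0 r hr Z g hZ B hB 0 (by simp; positivity)
  rw [zext_zero f r Z g hZ, hl, le_div_iff₀ (by positivity)] at this
  rw [div_lt_iff₀ hpos] at hN
  linarith

/-- second derivative type bound for the zero free part -/
lemma zfree_bound (g : ℂ → ℂ) (hg : Differentiable ℂ g) (r : ℝ) (hr : 0 < r) (M : ℝ) (hM : 0 < M)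
    (hz : ∀ z, ‖z‖ ≤ r → g z ≠ 0) (hB : ∀ z, ‖z‖ ≤ r → ‖g z‖ ≤ Real.exp M * ‖g 0‖)
    (z : ℂ) (hzr : ‖z‖ < r / 4) :
    ‖logDeriv g z - logDeriv g (-z)‖ ≤ 128 * M / r ^ 2 * ‖z‖ := by
  have hdl : DifferentiableOn ℂ (logDeriv g) (ball 0 r) := by
    intro w hw
    have hw' : g w ≠ 0 := hz w (mem_ball_zero_iff.1 hw).le
    have h1 : DifferentiableAt ℂ (deriv g) w :=
      ((hg.differentiableOn (s := Set.univ)).deriv isOpen_univ).differentiableAt Filter.univ_mem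
    exact (h1.div hg.differentiableAt hw').differentiableWithinAt
  obtain ⟨h, hh0, hh⟩ := (hdl.isExactOn_ball).with_val_at 0 0
  have h0r : (0:ℂ) ∈ ball (0:ℂ) r := by simpa using hr
  have hg0 : g 0 ≠ 0 := hz 0 (by simpa using hr.le)
  have hhd : DifferentiableOn ℂ h (ball 0 r) := fun w hw => (hh w hw).differentiableAt.differentiableWithinAt
  have hexp : ∀ w ∈ ball (0:ℂ) r, g w = g 0 * exp (h w) := by
    have := (logDeriv_eqOn_iff (f := g) (g := fun w => exp (h w)) (s := ball (0:ℂ) r)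
      hg.differentiableOn hhd.cexp isOpen_ball (convex_ball _ _).isPreconnected
      (fun w _ => exp_ne_zero _) (fun w hw => hz w (by simpa using (mem_ball_zero_iff.1 hw).le))).1 ?_
    · obtain ⟨c, hc, he⟩ := this
      have e0 := he h0r
      simp [hh0] at e0
      intro w hw
      rw [he hw, e0]; simp
    · intro w hw
      have h1 : HasDerivAt (fun w => exp (h w)) (exp (h w) * logDeriv g w) w := (hh w hw).cexp
      rw [logDeriv_apply (fun w => exp (h w)), h1.deriv]
      field_simp
  have hre : Set.MapsTo h (ball 0 r) {z | z.re ≤ M} := by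
    intro w hw
    have h1 := hB w (by simpa using (mem_ball_zero_iff.1 hw).le)
    rw [hexp w hw, norm_mul, norm_exp, mul_comm] at h1
    have := le_of_mul_le_mul_right h1 (norm_pos_iff.2 hg0)
    simpa using this
  have hb : ∀ w, ‖w‖ ≤ r / 2 → ‖h w‖ ≤ 2 * M := by
    intro w hw
    have h1 := borelCaratheodory_zero hM hhd hre hr (z := w) (by simp; linarith) hh0
    refine h1.trans ?_
    rw [div_le_iff₀ (by linarith)]
    nlinarith
  have h2 : ∀ w ∈ ball (0:ℂ) (r/4), ‖deriv (logDeriv g) w‖ ≤ 64 * M / r ^ 2 := by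
    intro w hw
    have hw' : ‖w‖ < r / 4 := by simpa using hw
    have hsub : closedBall w (r/4) ⊆ ball 0 r := by
      intro v hv
      have : ‖v - w‖ ≤ r / 4 := by simpa [dist_eq_norm] using hv
      have h3 := norm_add_le (v - w) w
      simp at h3 ⊢
      linarith
    have hd : DiffContOnCl ℂ h (ball w (r/4)) :=
      DifferentiableOn.diffContOnCl (by
        rw [closure_ball _ (by positivity)]
        exact hhd.mono hsub)
    have h3 := norm_iteratedDeriv_le_of_forall_mem_sphere_norm_le 2 (by positivity : 0 < r/4) hd
      (C := 2 * M) (by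
        intro v hv
        apply hb
        have : ‖v - w‖ = r / 4 := by simpa [dist_eq_norm] using hv
        have h3 := norm_add_le (v - w) w
        simp at h3
        linarith)
    have h4 : iteratedDeriv 2 h w = deriv (logDeriv g) w := by
      rw [iteratedDeriv_succ, iteratedDeriv_one]
      apply Filter.EventuallyEq.deriv_eq
      filter_upwards [isOpen_ball.mem_nhds (ball_subset_ball (by linarith : r/4 ≤ r) hw)] with v hv
      exact (hh v hv).deriv
    rw [h4] at h3
    refine h3.trans (le_of_eq ?_)
    simp
    field_simp
    norm_num
  have h5 := (convex_ball (0:ℂ) (r/4)).norm_image_sub_le_of_norm_deriv_le (f := logDeriv g) (C := 64 * M / r ^ 2)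
    (x := -z) (y := z) (by
      intro w hw
      exact hdl.differentiableAt (isOpen_ball.mem_nhds (ball_subset_ball (by linarith : r/4 ≤ r) hw))) h2
    (by simpa using hzr) (by simpa using hzr)
  refine h5.trans (le_of_eq ?_)
  have : z - -z = 2 * z := by ring
  rw [this, norm_mul]
  simp
  ring

lemma logDeriv_zprod (Z : List ℂ) (z : ℂ) (h0 : ∀ ρ ∈ Z, ρ ≠ 0) (h : ∀ ρ ∈ Z, z ≠ ρ) :
    DifferentiableAt ℂ (fun z => (Z.map (fun ρ => 1 - z / ρ)).prod) z ∧
    (Z.map (fun ρ => 1 - z / ρ)).prod ≠ 0 ∧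
    logDeriv (fun z => (Z.map (fun ρ => 1 - z / ρ)).prod) z = (Z.map (fun ρ => 1 / (z - ρ))).sum := by
  induction Z with
  | nil => simp [logDeriv_const]
  | cons a t ih =>
    obtain ⟨i1, i2, i3⟩ := ih (fun ρ hρ => h0 ρ (List.mem_cons_of_mem _ hρ)) (fun ρ hρ => h ρ (List.mem_cons_of_mem _ hρ))
    have ha0 : a ≠ 0 := h0 a (by simp)
    have ha : z - a ≠ 0 := sub_ne_zero.2 (h a (by simp))
    have hne : 1 - z / a ≠ 0 := by
      intro h'; apply ha; field_simp at h'; linear_combination -h'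
    have hd : DifferentiableAt ℂ (fun z : ℂ => 1 - z / a) z := by fun_prop
    simp only [List.map_cons, List.prod_cons, List.sum_cons]
    refine ⟨hd.mul i1, mul_ne_zero hne i2, ?_⟩
    rw [logDeriv_mul z hne i2 hd i1, i3]
    congr 1
    rw [logDeriv_apply]
    have : deriv (fun z : ℂ => 1 - z / a) z = - (1 / a) := by
      simp
    rw [this, div_eq_div_iff hne ha]
    field_simp
    ring

theorem hadamard_step (f : ℂ → ℂ) (hf : Differentiable ℂ f) (h0 : f 0 ≠ 0) (heven : ∀ z, f (-z) = f z)
    (r : ℝ) (hr : 0 < r) (M : ℝ) (hM : 0 < M) (hB : ∀ z, ‖z‖ = 3 * r → ‖f z‖ ≤ Real.exp M * ‖f 0‖) :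
    ∃ Z : List ℂ, (∀ ρ ∈ Z, ‖ρ‖ ≤ r ∧ f ρ = 0) ∧ (∀ ρ, ‖ρ‖ ≤ r → f ρ = 0 → ρ ∈ Z) ∧
      ∀ z, ‖z‖ < r / 4 → f z ≠ 0 →
        ‖logDeriv f z - (Z.map (fun ρ => (1 / (z - ρ) + 1 / (z + ρ)) / 2)).sum‖ ≤ 64 * M / r ^ 2 * ‖z‖ := by
  obtain ⟨Z, g, hZ, hg⟩ := zext_exists f hf h0 r hr _ hB
  have hne := zext_ne f h0 r Z g hZ
  have hg0 := zext_zero f r Z g hZ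
  refine ⟨Z, hZ.2.2, ?_, ?_⟩
  · intro ρ hρ h
    by_contra hc
    rw [hZ.2.1 ρ] at h
    rcases mul_eq_zero.1 h with h | h
    · exact (logDeriv_zprod Z ρ hne (fun a ha hh => hc (hh ▸ ha))).2.1 h
    · exact hg ρ hρ h
  · intro z hz hfz
    have hfz' : f (-z) ≠ 0 := by rwa [heven]
    have hform : ∀ w, f w ≠ 0 → logDeriv f w = (Z.map (fun ρ => 1 / (w - ρ))).sum + logDeriv g w := by
      intro w hw
      have hw1 : ∀ ρ ∈ Z, w ≠ ρ := by
        rintro ρ hρ rfl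
        exact hw (hZ.2.2 _ hρ).2
      obtain ⟨i1, i2, i3⟩ := logDeriv_zprod Z w hne hw1
      have hgw : g w ≠ 0 := by
        intro h'; apply hw; rw [hZ.2.1 w, h', mul_zero]
      have : f = fun z => (Z.map (fun ρ => 1 - z / ρ)).prod * g z := funext hZ.2.1
      rw [this, logDeriv_mul w i2 hgw i1 hZ.1.differentiableAt, i3]
    have hodd : logDeriv f (-z) = - logDeriv f z := by
      have h1 : f = fun w => f (-w) := funext fun w => (heven w).symm
      have h2 : deriv f z = - deriv f (-z) := by
        conv_lhs => rw [h1]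
        rw [deriv_comp_neg]
      rw [logDeriv_apply, logDeriv_apply, heven, h2]
      ring
    have hb := zfree_bound g hZ.1 r hr M hM hg (by
      intro w hw
      have := zext_bound f h0 r hr Z g hZ _ hB w (by linarith)
      rw [hg0]
      refine this.trans (div_le_self (by positivity) (one_le_pow₀ (by norm_num)))) z hz
    have e1 := hform z hfz
    have e2 := hform (-z) hfz'
    have e3 : (Z.map (fun ρ => (1 / (z - ρ) + 1 / (z + ρ)) / 2)).sum
        = ((Z.map (fun ρ => 1 / (z - ρ))).sum - (Z.map (fun ρ => 1 / (-z - ρ))).sum) / 2 := by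
      clear e1 e2 hform hZ hne
      induction Z with
      | nil => simp
      | cons a t ih =>
        simp only [List.map_cons, List.sum_cons]
        rw [ih]
        have : 1 / (-z - a) = - (1 / (z + a)) := by
          rw [← neg_add', one_div, one_div, inv_neg]
        rw [this]
        ring
    have e4 : logDeriv f z - (Z.map (fun ρ => (1 / (z - ρ) + 1 / (z + ρ)) / 2)).sum
        = (logDeriv g z - logDeriv g (-z)) / 2 := by
      rw [e3]
      rw [hodd] at e2
      linear_combination (1/2 : ℂ) * e1 - (1/2:ℂ) * e2
    rw [e4, norm_div]
    simp
    have e5 : 64 * M / r ^ 2 * ‖z‖ = (128 * M / r ^ 2 * ‖z‖) / 2 := by ring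
    rw [e5]
    gcongr
end

section
open Complex Metric MeasureTheory Set

lemma exp_neg_le_fact (k : ℕ) (u : ℝ) (hu : 0 < u) : Real.exp (-u) ≤ k.factorial / u ^ k := by
  have := Real.pow_div_factorial_le_exp u hu.le k
  rw [Real.exp_neg, ← one_div, div_le_div_iff₀ (Real.exp_pos u) (by positivity)]
  rw [div_le_iff₀ (by positivity)] at this
  linarith

lemma theta_tail (k : ℕ) (hk : 2 ≤ k) (t : ℝ) (ht : 0 < t) :
    |HurwitzZeta.cosKernel 0 t - 1| ≤ k.factorial / 3 * t⁻¹ ^ k := by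
  have h := HurwitzZeta.hasSum_nat_cosKernel₀ 0 ht
  have hz : HasSum (fun n : ℕ => (1:ℝ) / ((n:ℝ) + 1) ^ 2) (Real.pi ^ 2 / 6) := by
    have := hasSum_zeta_two
    rw [← hasSum_nat_add_iff' 1] at this
    simpa using this
  have hz2 := hz.mul_left (2 * k.factorial / Real.pi ^ 2 * t⁻¹ ^ k)
  have e : 2 * k.factorial / Real.pi ^ 2 * t⁻¹ ^ k * (Real.pi ^ 2 / 6) = k.factorial / 3 * t⁻¹ ^ k := by
    have := Real.pi_ne_zero
    field_simp; ring
  rw [e] at hz2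
  have hle : ∀ n : ℕ, ‖2 * Real.cos (2 * Real.pi * 0 * (n + 1)) * Real.exp (-Real.pi * (n + 1) ^ 2 * t)‖ ≤
      2 * k.factorial / Real.pi ^ 2 * t⁻¹ ^ k * (1 / ((n:ℝ) + 1) ^ 2) := by
    intro n
    have hn : (1:ℝ) ≤ (n:ℝ) + 1 := by linarith [Nat.cast_nonneg (α := ℝ) n]
    have hpi : (1:ℝ) ≤ Real.pi := by linarith [Real.pi_gt_three]
    have h1 := exp_neg_le_fact k (Real.pi * ((n:ℝ) + 1) ^ 2 * t) (by positivity)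
    have h2 : Real.pi ^ 2 * ((n:ℝ) + 1) ^ 2 * t ^ k ≤ (Real.pi * ((n:ℝ) + 1) ^ 2 * t) ^ k := by
      rw [mul_pow, mul_pow]
      have hp2 : Real.pi ^ 2 ≤ Real.pi ^ k := pow_le_pow_right₀ hpi hk
      have hn2 : ((n:ℝ)+1)^2 ≤ (((n:ℝ)+1)^2)^k := by
        calc ((n:ℝ)+1)^2 ≤ (((n:ℝ)+1)^2)^1 := by rw [pow_one]
          _ ≤ _ := pow_le_pow_right₀ (one_le_pow₀ hn) (by omega)
      gcongr
    simp only [mul_zero, zero_mul, Real.cos_zero, mul_one, norm_mul, Real.norm_eq_abs, Real.abs_exp]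
    rw [abs_of_pos (by norm_num : (0:ℝ) < 2)]
    have h3 : Real.exp (-Real.pi * ((n:ℝ) + 1) ^ 2 * t) ≤ k.factorial / (Real.pi ^ 2 * ((n:ℝ) + 1) ^ 2 * t ^ k) := by
      calc _ = Real.exp (-(Real.pi * ((n:ℝ) + 1) ^ 2 * t)) := by ring_nf
        _ ≤ _ := h1
        _ ≤ _ := by gcongr
    calc _ ≤ 2 * (k.factorial / (Real.pi ^ 2 * ((n:ℝ) + 1) ^ 2 * t ^ k)) := by gcongr
      _ = _ := by rw [inv_pow]; field_simp
  have := hz2.tsum_eq ▸ tsum_of_norm_bounded hz2 hle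
  have h4 := h.tsum_eq
  have h0 : ((0:ℝ) : UnitAddCircle) = 0 := by simp
  rw [h0] at h4
  rw [h4, Real.norm_eq_abs, hz2.tsum_eq] at this
  exact this

lemma fmodif_bound (k : ℕ) (hk : 2 ≤ k) (x : ℝ) (hx : 0 < x) :
    ‖(HurwitzZeta.hurwitzEvenFEPair 0).f_modif x‖ ≤ if x ≤ 1 then k.factorial / 3 * x ^ ((k:ℝ) - 1/2)
      else k.factorial / 3 * x ^ (-(k:ℝ)) := by
  have main : ∀ y : ℝ, 1 < y → ‖(HurwitzZeta.hurwitzEvenFEPair 0).f_modif y‖ ≤ k.factorial / 3 * y ^ (-(k:ℝ)) := by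
    intro y hy
    have h1 := theta_tail k hk y (by linarith)
    have : (HurwitzZeta.hurwitzEvenFEPair 0).f_modif y = ((HurwitzZeta.cosKernel 0 y - 1 : ℝ) : ℂ) := by
      rw [WeakFEPair.f_modif, Pi.add_apply, indicator_of_mem (mem_Ioi.mpr hy), indicator_of_notMem (notMem_Ioo_of_ge hy.le)]
      simp [HurwitzZeta.hurwitzEvenFEPair, HurwitzZeta.evenKernel_eq_cosKernel_of_zero]
    rw [this, norm_real, Real.norm_eq_abs]
    refine h1.trans (le_of_eq ?_)
    rw [Real.rpow_neg (by linarith), Real.rpow_natCast, inv_pow]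
  split_ifs with h
  · rcases eq_or_lt_of_le h with rfl | h
    · have : (HurwitzZeta.hurwitzEvenFEPair 0).f_modif 1 = 0 := by
        simp [WeakFEPair.f_modif]
      rw [this]; simp; positivity
    · have hy : 1 < 1 / x := by rwa [lt_one_div one_pos hx, div_one]
      have h2 := (HurwitzZeta.hurwitzEvenFEPair 0).hf_modif_FE (1/x) (by positivity)
      have h3 : (HurwitzZeta.hurwitzEvenFEPair 0).g_modif = (HurwitzZeta.hurwitzEvenFEPair 0).f_modif := by
        unfold WeakFEPair.g_modif WeakFEPair.f_modif
        simp [HurwitzZeta.hurwitzEvenFEPair, HurwitzZeta.evenKernel_eq_cosKernel_of_zero]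
      rw [one_div_one_div, h3] at h2
      rw [h2]
      have hk2 : (HurwitzZeta.hurwitzEvenFEPair 0).k = 1/2 := rfl
      have he : (HurwitzZeta.hurwitzEvenFEPair 0).ε = 1 := rfl
      rw [hk2, he, one_mul, smul_eq_mul, norm_mul, norm_real, Real.norm_eq_abs, abs_of_pos (by positivity)]
      calc _ ≤ (1/x) ^ (1/2:ℝ) * (k.factorial / 3 * (1/x) ^ (-(k:ℝ))) := by gcongr; exact main _ hy
        _ = k.factorial / 3 * x ^ ((k:ℝ) - 1/2) := by
          rw [one_div x, Real.inv_rpow hx.le, Real.inv_rpow hx.le, ← Real.rpow_neg hx.le, ← Real.rpow_neg hx.le, neg_neg,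
            Real.rpow_sub hx, Real.rpow_neg hx.le]
          field_simp
  · exact main x (by linarith)

lemma Lam0_bound (k : ℕ) (hk : 2 ≤ k) (s : ℂ) (h1 : s.re ≤ 2 * k - 2) (h2 : 3 - 2 * (k:ℝ) ≤ s.re) :
    ‖completedRiemannZeta₀ s‖ ≤ k.factorial / 3 := by
  set b : ℝ → ℝ := fun x => if x ≤ 1 then (k.factorial / 3 : ℝ) else k.factorial / 3 * x ^ (-2:ℝ) with hb
  have hI1 : IntegrableOn b (Ioc 0 1) := by
    refine IntegrableOn.congr_fun (f := fun _ => (k.factorial / 3 : ℝ)) ?_ ?_ measurableSet_Ioc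
    · simp
    · intro x hx; simp [hb, hx.2]
  have hI2 : IntegrableOn b (Ioi 1) := by
    refine IntegrableOn.congr_fun (f := fun x => (k.factorial / 3 * x ^ (-2:ℝ) : ℝ)) ?_ ?_ measurableSet_Ioi
    · exact (integrableOn_Ioi_rpow_of_lt (by norm_num) one_pos).const_mul _
    · intro x hx; simp [hb, not_le.2 (mem_Ioi.1 hx)]
  have hU : Ioc (0:ℝ) 1 ∪ Ioi 1 = Ioi 0 := Ioc_union_Ioi_eq_Ioi zero_le_one
  have hval : ∫ x in Ioi 0, b x = k.factorial / 3 * 2 := by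
    rw [← hU, setIntegral_union (Ioc_disjoint_Ioi le_rfl) measurableSet_Ioi hI1 hI2]
    have e1 : ∫ x in Ioc (0:ℝ) 1, b x = k.factorial / 3 := by
      rw [setIntegral_congr_fun measurableSet_Ioc (g := fun _ => (k.factorial / 3 : ℝ)) (fun x hx => by simp [hb, hx.2])]
      simp
    have e2 : ∫ x in Ioi (1:ℝ), b x = k.factorial / 3 := by
      rw [setIntegral_congr_fun measurableSet_Ioi (g := fun x => (k.factorial / 3 * x ^ (-2:ℝ) : ℝ)) (fun x hx => by simp [hb, not_le.2 (mem_Ioi.1 hx)])]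
      rw [integral_const_mul, integral_Ioi_rpow_of_lt (by norm_num) one_pos]
      norm_num
    rw [e1, e2]; ring
  have hbi : IntegrableOn b (Ioi 0) := by rw [← hU]; exact hI1.union hI2
  have key : ‖mellin (HurwitzZeta.hurwitzEvenFEPair 0).f_modif (s/2)‖ ≤ k.factorial / 3 * 2 := by
    rw [← hval]
    unfold mellin
    refine norm_integral_le_of_norm_le hbi ?_
    filter_upwards [ae_restrict_mem measurableSet_Ioi] with x hx
    have hx : 0 < x := hx
    rw [norm_smul, norm_cpow_eq_rpow_re_of_pos hx]
    have h3 := fmodif_bound k hk x hx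
    have hre : (s / 2 - 1).re = s.re / 2 - 1 := by simp
    rw [hre]
    simp only [hb]
    split_ifs at h3 ⊢ with hx1
    · calc _ ≤ x ^ (s.re/2 - 1) * (k.factorial / 3 * x ^ ((k:ℝ) - 1/2)) := by gcongr
        _ = k.factorial / 3 * x ^ (s.re/2 - 1 + ((k:ℝ) - 1/2)) := by rw [Real.rpow_add hx]; ring
        _ ≤ k.factorial / 3 * 1 := by
          gcongr
          exact Real.rpow_le_one hx.le hx1 (by linarith)
        _ = _ := by ring
    · calc _ ≤ x ^ (s.re/2 - 1) * (k.factorial / 3 * x ^ (-(k:ℝ))) := by gcongr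
        _ = k.factorial / 3 * x ^ (s.re/2 - 1 + (-(k:ℝ))) := by rw [Real.rpow_add hx]; ring
        _ ≤ _ := by
          gcongr
          · linarith
          · linarith
  have : completedRiemannZeta₀ s = mellin (HurwitzZeta.hurwitzEvenFEPair 0).f_modif (s/2) / 2 := rfl
  rw [this, norm_div]
  simp
  linarith

/-- Riemann Xi function (times 2), centred at the critical line. -/
noncomputable def XiF (z : ℂ) : ℂ := (z ^ 2 - 1/4) * completedRiemannZeta₀ (1/2 + z) + 1

lemma XiF_diff : Differentiable ℂ XiF := by
  unfold XiF
  have := differentiable_completedZeta₀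
  fun_prop

lemma XiF_even (z : ℂ) : XiF (-z) = XiF z := by
  unfold XiF
  rw [← completedRiemannZeta₀_one_sub (1/2 + z)]
  ring_nf

lemma XiF_growth (n : ℕ) (hn : 1 ≤ n) (z : ℂ) (hz : ‖z‖ = 3 * n) :
    ‖XiF z‖ ≤ ((3 * n + 3 : ℕ):ℝ) ^ (3 * n + 5) := by
  have hre := abs_le.1 ((abs_re_le_norm z).trans_eq hz)
  have hn' : (1:ℝ) ≤ n := by exact_mod_cast hn
  have h1 := Lam0_bound (3 * n + 3) (by omega) (1/2 + z) (by simp; linarith [hre.2]) (by simp; linarith [hre.1])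
  have h2 : ((3 * n + 3).factorial : ℝ) ≤ ((3 * n + 3 : ℕ):ℝ) ^ (3 * n + 3) := by
    exact_mod_cast Nat.factorial_le_pow _
  set A := ((3 * n + 3 : ℕ):ℝ) with hA
  have hAn : A = 3 * n + 3 := by simp [hA]
  have hP : 1 ≤ A ^ (3 * n + 3) := one_le_pow₀ (by linarith)
  have h3 : ‖z ^ 2 - 1/4‖ ≤ A ^ 2 := by
    calc _ ≤ ‖z ^ 2‖ + ‖(1/4:ℂ)‖ := norm_sub_le _ _
      _ = (3 * n) ^ 2 + 1/4 := by rw [norm_pow, hz]; norm_num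
      _ ≤ A ^ 2 := by rw [hAn]; nlinarith
  calc ‖XiF z‖ ≤ ‖(z ^ 2 - 1/4) * completedRiemannZeta₀ (1/2 + z)‖ + ‖(1:ℂ)‖ := norm_add_le _ _
    _ ≤ A ^ 2 * (A ^ (3 * n + 3) / 3) + 1 := by
      rw [norm_mul, norm_one]
      gcongr
      exact h1.trans (by gcongr)
    _ ≤ A ^ (3 * n + 5) := by
      have : A ^ (3 * n + 5) = A ^ 2 * A ^ (3 * n + 3) := by rw [← pow_add]; congr 1; omega
      rw [this]
      have hA2 : 1 ≤ A := by linarith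
      nlinarith [mul_le_mul hA2 hA2 (by norm_num) (by linarith)]

lemma XiF_eq (z : ℂ) (h1 : (1/2 + z) ≠ 0) (h2 : (1/2 + z) ≠ 1) :
    XiF z = (z ^ 2 - 1/4) * completedRiemannZeta (1/2 + z) := by
  rw [XiF, completedRiemannZeta_eq]
  have h3 : 1 - (1/2 + z) ≠ 0 := sub_ne_zero.2 h2.symm
  have e : z ^ 2 - 1/4 = - ((1/2 + z) * (1 - (1/2 + z))) := by ring
  rw [e]
  generalize (1/2 + z) = s at *
  field_simp
  ring

lemma XiF_zero_re (z : ℂ) (hz : XiF z = 0) : |z.re| < 1/2 := by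
  have key : ∀ w, XiF w = 0 → w.re < 1/2 := by
    intro w hw
    by_contra hc
    push Not at hc
    by_cases h1 : (1/2 + w) = 1
    · have : w = 1/2 := by linear_combination h1
      rw [XiF, this] at hw
      norm_num at hw
    have h0 : (1/2 + w) ≠ 0 := by
      intro h; have := congrArg re h; simp at this; linarith
    rw [XiF_eq w h0 h1] at hw
    have hre : 1 ≤ (1/2 + w).re := by simp; linarith
    have hz := riemannZeta_ne_zero_of_one_le_re hre
    rw [riemannZeta_def_of_ne_zero h0] at hz
    rcases mul_eq_zero.1 hw with h | h
    · have : (w + 1/2) * ((1/2 + w) - 1) = 0 := by linear_combination h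
      rcases mul_eq_zero.1 this with h | h
      · exact h0 (by linear_combination h)
      · exact h1 (by linear_combination h)
    · rw [h] at hz; simp at hz
  rw [abs_lt]
  constructor
  · have := key (-z) (by rw [XiF_even, hz])
    simp at this; linarith
  · exact key z hz

lemma XiF_zero_im (z : ℂ) (hz : XiF z = 0) : 1 ≤ |z.im| := by
  by_contra hc
  push Not at hc
  have hre := abs_lt.1 (XiF_zero_re z hz)
  have h1 := Lam0_bound 2 le_rfl (1/2 + z) (by simp; linarith [hre.2]) (by simp; linarith [hre.1])
  have h2 : ‖z ^ 2 - 1/4‖ < 3/2 := by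
    have him := abs_lt.1 hc
    have : ‖z ^ 2 - 1/4‖ ≤ ‖z‖ ^ 2 + 1/4 := by
      calc _ ≤ ‖z ^ 2‖ + ‖(1/4:ℂ)‖ := norm_sub_le _ _
        _ = _ := by rw [norm_pow]; norm_num
    have h4 : ‖z‖ ^ 2 = z.re ^ 2 + z.im ^ 2 := by rw [← normSq_eq_norm_sq, normSq_apply]; ring
    nlinarith
  have h3 : ‖(z ^ 2 - 1/4) * completedRiemannZeta₀ (1/2 + z)‖ < 1 := by
    rw [norm_mul]
    have : ((Nat.factorial 2 : ℕ) : ℝ) / 3 = 2/3 := by norm_num [Nat.factorial]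
    rw [this] at h1
    nlinarith [norm_nonneg (z ^ 2 - 1/4), norm_nonneg (completedRiemannZeta₀ (1/2 + z))]
  rw [XiF] at hz
  have : (z ^ 2 - 1/4) * completedRiemannZeta₀ (1/2 + z) = -1 := by linear_combination hz
  rw [this] at h3
  simp at h3

lemma XiF_zero_ne : XiF 0 ≠ 0 := by
  intro h
  have := XiF_zero_im 0 h
  simp at this
  linarith
end

section
open Complex Metric MeasureTheory Set Filter Topology

/-- the zero sum attached to a finite list of zeros -/
noncomputable def zsum (Z : List ℂ) (z : ℂ) : ℂ := (Z.map (fun ρ => (1 / (z - ρ) + 1 / (z + ρ)) / 2)).sum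

lemma MM_tendsto (c : ℝ) : Tendsto (fun n : ℕ => 64 * (((3 * n + 5 : ℕ) : ℝ) * Real.log ((3 * n + 3 : ℕ):ℝ) + c) / (n:ℝ) ^ 2)
    atTop (𝓝 0) := by
  have hlog : ∀ n : ℕ, 1 ≤ n → Real.log ((3 * n + 3 : ℕ):ℝ) ≤ 6 * (n:ℝ) ^ (1/2:ℝ) := by
    intro n hn
    have hn' : (1:ℝ) ≤ n := by exact_mod_cast hn
    have h1 := Real.log_le_rpow_div (x := ((3 * n + 3 : ℕ):ℝ)) (ε := 1/2) (by positivity) (by norm_num)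
    have h2 : ((3 * n + 3 : ℕ):ℝ) ≤ 9 * n := by push_cast; linarith
    have h3 : ((3 * n + 3 : ℕ):ℝ) ^ (1/2:ℝ) ≤ (9 * (n:ℝ)) ^ (1/2:ℝ) := by gcongr
    rw [Real.mul_rpow (by norm_num) (by positivity)] at h3
    have h4 : (9:ℝ) ^ (1/2:ℝ) = 3 := by
      rw [show (9:ℝ) = 3 ^ (2:ℝ) by norm_num, ← Real.rpow_mul (by norm_num)]; norm_num
    rw [h4] at h3
    linarith
  have hup : Tendsto (fun n : ℕ => 3072 * (n:ℝ) ^ (-(1/2):ℝ) + 64 * |c| * (n:ℝ) ^ (-2:ℝ)) atTop (𝓝 0) := by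
    have t1 := (tendsto_rpow_neg_atTop (y := 1/2) (by norm_num)).comp (tendsto_natCast_atTop_atTop (R := ℝ))
    have t2 := (tendsto_rpow_neg_atTop (y := 2) (by norm_num)).comp (tendsto_natCast_atTop_atTop (R := ℝ))
    simpa using (t1.const_mul 3072).add (t2.const_mul (64 * |c|))
  refine squeeze_zero_norm' ?_ hup
  filter_upwards [eventually_ge_atTop 1] with n hn
  have hn' : (1:ℝ) ≤ n := by exact_mod_cast hn
  have hn0 : (0:ℝ) < n := by linarith
  have hl := hlog n hn
  have hl0 : 0 ≤ Real.log ((3 * n + 3 : ℕ):ℝ) := Real.log_natCast_nonneg _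
  rw [Real.norm_eq_abs, abs_div, abs_of_pos (by positivity : 0 < (n:ℝ) ^ 2), abs_mul, abs_of_pos (by norm_num : (0:ℝ) < 64)]
  have e1 : (n:ℝ) ^ (-2:ℝ) = 1 / (n:ℝ) ^ 2 := by rw [Real.rpow_neg hn0.le]; norm_num
  have e2 : (n:ℝ) ^ (-(1/2):ℝ) = n * (n:ℝ) ^ (1/2:ℝ) / (n:ℝ) ^ 2 := by
    rw [Real.rpow_neg hn0.le]
    have : (n:ℝ) ^ (1/2:ℝ) * (n:ℝ) ^ (1/2:ℝ) = n := by rw [← Real.rpow_add hn0]; norm_num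
    field_simp
    nlinarith
  rw [e1, e2]
  have e3 : 3072 * (n * (n:ℝ) ^ (1/2:ℝ) / (n:ℝ) ^ 2) + 64 * |c| * (1 / (n:ℝ)^2)
      = 64 * (48 * (n * (n:ℝ) ^ (1/2:ℝ)) + |c|) / (n:ℝ)^2 := by ring
  rw [e3]
  gcongr
  refine (abs_add_le _ _).trans ?_
  gcongr
  rw [abs_of_nonneg (by positivity)]
  push_cast at *
  have h0 : 0 ≤ (n:ℝ) ^ (1/2:ℝ) := by positivity
  calc (3 * (n:ℝ) + 5) * Real.log (3 * n + 3) ≤ (8 * n) * (6 * (n:ℝ) ^ (1/2:ℝ)) := by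
        gcongr; linarith
    _ = _ := by ring

theorem xi_zeros : ∃ Z : ℕ → List ℂ, (∀ n, ∀ ρ ∈ Z n, XiF ρ = 0) ∧
    (∀ ρ, XiF ρ = 0 → ∀ᶠ n in atTop, ρ ∈ Z n) ∧
    ∀ z, XiF z ≠ 0 → Tendsto (fun n => zsum (Z n) z) atTop (𝓝 (logDeriv XiF z)) := by
  set c := |Real.log ‖XiF 0‖| + 1
  have hpos : 0 < ‖XiF 0‖ := norm_pos_iff.2 XiF_zero_ne
  have hstep : ∀ n : ℕ, ∃ Z : List ℂ, 1 ≤ n → ((∀ ρ ∈ Z, ‖ρ‖ ≤ n ∧ XiF ρ = 0) ∧ (∀ ρ, ‖ρ‖ ≤ n → XiF ρ = 0 → ρ ∈ Z) ∧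
      ∀ z, ‖z‖ < n / 4 → XiF z ≠ 0 →
        ‖logDeriv XiF z - zsum Z z‖ ≤ 64 * (((3 * n + 5 : ℕ) : ℝ) * Real.log ((3 * n + 3 : ℕ):ℝ) + c) / (n:ℝ) ^ 2 * ‖z‖) := by
    intro n
    by_cases hn : 1 ≤ n
    swap
    · exact ⟨[], fun h => absurd h hn⟩
    have hn' : (1:ℝ) ≤ n := by exact_mod_cast hn
    have hl0 : 0 ≤ Real.log ((3 * n + 3 : ℕ):ℝ) := Real.log_natCast_nonneg _
    obtain ⟨Z, h1, h2, h3⟩ := hadamard_step XiF XiF_diff XiF_zero_ne XiF_even n (by linarith)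
      (((3 * n + 5 : ℕ) : ℝ) * Real.log ((3 * n + 3 : ℕ):ℝ) + c) (by positivity) (by
        intro z hz
        refine (XiF_growth n hn z hz).trans ?_
        rw [Real.exp_add, mul_assoc]
        have e1 : Real.exp (((3 * n + 5 : ℕ) : ℝ) * Real.log ((3 * n + 3 : ℕ):ℝ)) = ((3 * n + 3 : ℕ):ℝ) ^ (3 * n + 5) := by
          rw [Real.exp_nat_mul, Real.exp_log (by positivity)]
        rw [e1]
        have e2 : 1 ≤ Real.exp c * ‖XiF 0‖ := by
          conv_rhs => rw [← Real.exp_log hpos]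
          rw [← Real.exp_add]
          apply Real.one_le_exp
          have := neg_abs_le (Real.log ‖XiF 0‖)
          simp only [c]; linarith
        nlinarith [pow_pos (by positivity : (0:ℝ) < ((3 * n + 3 : ℕ):ℝ)) (3 * n + 5)])
    exact ⟨Z, fun _ => ⟨h1, h2, h3⟩⟩
  choose Z hZ using hstep
  refine ⟨fun n => Z (n + 1), ?_, ?_, ?_⟩
  · intro n ρ hρ
    exact ((hZ (n+1) (by omega)).1 ρ hρ).2
  · intro ρ hρ
    obtain ⟨N, hN⟩ := exists_nat_ge ‖ρ‖
    filter_upwards [eventually_ge_atTop N] with n hn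
    refine (hZ (n+1) (by omega)).2.1 ρ (hN.trans ?_) hρ
    exact_mod_cast (by omega)
  · intro z hz
    rw [tendsto_iff_norm_sub_tendsto_zero]
    have t := ((MM_tendsto c).comp (tendsto_add_atTop_nat 1)).mul_const ‖z‖
    rw [zero_mul] at t
    refine squeeze_zero' (Eventually.of_forall fun n => norm_nonneg _) ?_ t
    obtain ⟨N, hN⟩ := exists_nat_gt (4 * ‖z‖)
    filter_upwards [eventually_ge_atTop N] with n hn
    rw [norm_sub_rev]
    refine (hZ (n+1) (by omega)).2.2 z ?_ hz
    have : (N:ℝ) ≤ ((n+1 : ℕ):ℝ) := by exact_mod_cast (by omega)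
    linarith

lemma XiF_logDeriv (s : ℂ) (hs : 1 < s.re) :
    - logDeriv riemannZeta s = 1 / (s - 1) - Real.log Real.pi / 2 + digamma (s / 2 + 1) / 2 - logDeriv XiF (s - 1/2) := by
  have hs0 : s ≠ 0 := by rintro rfl; simp at hs; linarith
  have hs1 : s ≠ 1 := by rintro rfl; simp at hs
  have hz := riemannZeta_ne_zero_of_one_le_re hs.le
  have hG := Gammaℝ_ne_zero_of_re_pos (s := s) (by linarith)
  have hGd : DifferentiableAt ℂ Gammaℝ s := by
    have := (differentiable_Gammaℝ_inv s).inv (inv_ne_zero hG)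
    simpa [Pi.inv_def] using this
  have hG2 : Gamma (s/2) ≠ 0 := Gamma_ne_zero_of_re_pos (by simp; linarith)
  have hnat : ∀ m : ℕ, s/2 ≠ -m := by
    intro m h
    have := congrArg re h
    simp at this
    have := Nat.cast_nonneg (α := ℝ) m
    linarith
  have hxi : (fun w => XiF (w - 1/2)) =ᶠ[𝓝 s] fun w => (w * (w - 1)) * (Gammaℝ w * riemannZeta w) := by
    have hev : ∀ᶠ w in 𝓝 s, 1 < w.re := (continuous_re.tendsto s).eventually (lt_mem_nhds hs)
    filter_upwards [hev] with w hw
    have hw0 : w ≠ 0 := by rintro rfl; simp at hw; linarith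
    have hw1 : w ≠ 1 := by rintro rfl; simp at hw
    have hGw := Gammaℝ_ne_zero_of_re_pos (s := w) (by linarith)
    have e : (1/2 : ℂ) + (w - 1/2) = w := by ring
    rw [XiF_eq _ (by rwa [e]) (by rwa [e]), e, riemannZeta_def_of_ne_zero hw0]
    field_simp
    ring
  have h1 : logDeriv XiF (s - 1/2) = logDeriv (fun w => XiF (w - 1/2)) s := by
    rw [logDeriv_apply, logDeriv_apply, deriv_comp_sub_const]
  have h2 : logDeriv Gammaℝ s = - Real.log Real.pi / 2 + digamma (s/2) / 2 := by
    have : Gammaℝ = fun w => (Real.pi:ℂ) ^ (-w/2) * Gamma (w/2) := funext fun w => Gammaℝ_def w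
    have hpi : (Real.pi:ℂ) ≠ 0 := by exact_mod_cast Real.pi_ne_zero
    have d1 : HasDerivAt (fun w : ℂ => (Real.pi:ℂ) ^ (-w/2)) ((Real.pi:ℂ) ^ (-s/2) * log Real.pi * (-1/2)) s :=
      ((hasDerivAt_id s).neg.div_const 2).const_cpow (Or.inl hpi)
    have hGam : DifferentiableAt ℂ Gamma (s/2) := differentiableAt_Gamma _ hnat
    have d2 : HasDerivAt (fun w : ℂ => Gamma (w/2)) (deriv Gamma (s/2) * (1/2)) s :=
      HasDerivAt.comp s hGam.hasDerivAt ((hasDerivAt_id s).div_const 2)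
    rw [this, logDeriv_mul s (by simp [cpow_eq_zero_iff, hpi]) hG2 d1.differentiableAt d2.differentiableAt,
      logDeriv_apply, logDeriv_apply, d1.deriv, d2.deriv, digamma_def, logDeriv_apply]
    have hp : (Real.pi:ℂ) ^ (-s/2) ≠ 0 := by simp [cpow_eq_zero_iff, hpi]
    rw [ofReal_log Real.pi_pos.le]
    field_simp
  have m1 := logDeriv_mul (f := fun w : ℂ => w * (w - 1)) (g := fun w => Gammaℝ w * riemannZeta w) s
    (mul_ne_zero hs0 (sub_ne_zero.2 hs1)) (mul_ne_zero hG hz)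
    (by fun_prop) (hGd.mul (differentiableAt_riemannZeta hs1))
  have m2 := logDeriv_mul (f := fun w : ℂ => w) (g := fun w => w - 1) s hs0 (sub_ne_zero.2 hs1) (by fun_prop) (by fun_prop)
  have m3 := logDeriv_mul (f := Gammaℝ) (g := riemannZeta) s hG hz hGd (differentiableAt_riemannZeta hs1)
  have h3 : logDeriv (fun w : ℂ => w - 1) s = 1 / (s - 1) := by
    rw [logDeriv_apply]; simp
  rw [h1, (logDeriv_congr_nhds hxi).eq_of_nhds, m1, m2, m3, h2, h3, digamma_apply_add_one _ hnat, logDeriv_id']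
  field_simp
  ring
end

section
open Complex Metric MeasureTheory Set Filter Topology

lemma GammaSeq_norm_le (s : ℂ) (hs : 0 < s.re) (n : ℕ) (hn : n ≠ 0) : ‖GammaSeq s n‖ ≤ Real.Gamma s.re := by
  rw [GammaSeq_eq_approx_Gamma_integral hs hn, Real.Gamma_eq_integral hs,
    intervalIntegral.integral_of_le (by positivity : (0:ℝ) ≤ n)]
  have hGint := Real.GammaIntegral_convergent hs
  refine (norm_integral_le_of_norm_le (hGint.mono_set Ioc_subset_Ioi_self) ?_).trans ?_
  · rw [ae_restrict_iff' measurableSet_Ioc]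
    filter_upwards with x hx
    rw [norm_mul, Complex.norm_of_nonneg
          (pow_nonneg (sub_nonneg.mpr <| div_le_one_of_le₀ hx.2 <| by positivity) _),
          norm_cpow_eq_rpow_re_of_pos hx.1, sub_re, one_re]
    have := hx.1
    gcongr
    exact Real.one_sub_div_pow_le_exp_neg hx.2
  · refine setIntegral_mono_set hGint ?_ (Eventually.of_forall Ioc_subset_Ioi_self)
    rw [EventuallyLE, ae_restrict_iff' measurableSet_Ioi]
    filter_upwards with x hx
    have : 0 < x := hx
    simp only [Pi.zero_apply]
    positivity

lemma GammaSeq_hasDerivAt (w : ℂ) (hw : 0 < w.re) (n : ℕ) (hn : n ≠ 0) :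
    HasDerivAt (fun s => GammaSeq s n) (GammaSeq w n * (Real.log n - ∑ k ∈ Finset.range (n+1), 1 / (w + k))) w := by
  have hn' : (n:ℂ) ≠ 0 := by exact_mod_cast hn
  have hk : ∀ k : ℕ, w + k ≠ 0 := by
    intro k h
    have := congrArg re h
    simp at this
    have := Nat.cast_nonneg (α := ℝ) k
    linarith
  have hP : ∏ j ∈ Finset.range (n+1), (w + j) ≠ 0 := Finset.prod_ne_zero_iff.2 fun j _ => hk j
  have d1 : HasDerivAt (fun s : ℂ => (n:ℂ) ^ s) ((n:ℂ) ^ w * log n * 1) w :=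
    (hasDerivAt_id w).const_cpow (Or.inl hn')
  have dk : ∀ j ∈ Finset.range (n+1), HasDerivAt (fun s : ℂ => s + (j:ℂ)) 1 w := fun j _ =>
    (hasDerivAt_id w).add_const _
  have d2 := HasDerivAt.fun_finsetProd dk
  have d3 := (d1.mul_const (n.factorial : ℂ)).div d2 hP
  refine d3.congr_deriv ?_
  have : ∑ i ∈ Finset.range (n+1), (∏ j ∈ (Finset.range (n+1)).erase i, (w + (j:ℂ))) • (1:ℂ)
      = (∏ j ∈ Finset.range (n+1), (w + j)) * ∑ k ∈ Finset.range (n+1), 1 / (w + k) := by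
    rw [Finset.mul_sum]
    refine Finset.sum_congr rfl fun i hi => ?_
    rw [← Finset.mul_prod_erase _ _ hi]
    have := hk i
    simp only [smul_eq_mul]
    field_simp
  rw [this, GammaSeq, ← ofReal_natCast n, ofReal_log (by positivity)]
  field_simp

theorem digamma_tendsto (w : ℂ) (hw : 0 < w.re) :
    Tendsto (fun n : ℕ => (Real.log n : ℂ) - ∑ k ∈ Finset.range (n+1), 1 / (w + k)) atTop (𝓝 (digamma w)) := by
  set r := w.re / 2 with hr
  have hr0 : 0 < r := by positivity
  have hre : ∀ z ∈ closedBall w r, r ≤ z.re ∧ z.re ≤ 3 * r := by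
    intro z hz
    rw [mem_closedBall, dist_eq_norm] at hz
    have h1 := (abs_re_le_norm (z - w)).trans hz
    rw [sub_re, abs_le] at h1
    constructor <;> linarith
  have hcont : ContinuousOn Real.Gamma (Icc r (3*r)) := by
    intro x hx
    refine (Real.differentiableAt_Gamma fun m => ?_).continuousAt.continuousWithinAt
    have := Nat.cast_nonneg (α := ℝ) m
    intro h; linarith [hx.1]
  obtain ⟨C, hC⟩ := isCompact_Icc.exists_bound_of_continuousOn hcont
  have hbd : ∀ n : ℕ, n ≠ 0 → ∀ z ∈ closedBall w r, ‖GammaSeq z n‖ ≤ C := by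
    intro n hn z hz
    have h := hre z hz
    refine (GammaSeq_norm_le z (by linarith [h.1]) n hn).trans ?_
    exact (le_abs_self _).trans (hC z.re h)
  have hdG : DifferentiableOn ℂ Gamma (closedBall w r) := by
    intro z hz
    refine (differentiableAt_Gamma z fun m h => ?_).differentiableWithinAt
    have h1 := congrArg re h
    have := Nat.cast_nonneg (α := ℝ) m
    simp at h1
    linarith [(hre z hz).1]
  have hdS : ∀ n : ℕ, n ≠ 0 → DifferentiableOn ℂ (fun s => GammaSeq s n) (closedBall w r) := by
    intro n hn z hz
    exact (GammaSeq_hasDerivAt z (by linarith [(hre z hz).1]) n hn).differentiableAt.differentiableWithinAt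
  have hderiv : Tendsto (fun n : ℕ => deriv (fun s => GammaSeq s n) w) atTop (𝓝 (deriv Gamma w)) := by
    have hI : (2 * Real.pi * I : ℂ) ≠ 0 := by simp [Real.pi_ne_zero]
    have key : Tendsto (fun n : ℕ => ∮ z in C(w, r), (1 / (z - w) ^ 2) • GammaSeq z n) atTop
        (𝓝 (∮ z in C(w, r), (1 / (z - w) ^ 2) • Gamma z)) := by
      unfold circleIntegral
      have hmem : ∀ θ, circleMap w r θ ∈ closedBall w r := fun θ => circleMap_mem_closedBall w hr0.le θ
      refine intervalIntegral.tendsto_integral_filter_of_dominated_convergence (fun _ => r * (1 / r ^ 2 * C)) ?_ ?_ ?_ ?_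
      · filter_upwards [eventually_ne_atTop 0] with n hn
        refine (Continuous.aestronglyMeasurable ?_)
        have c1 : Continuous fun θ => GammaSeq (circleMap w r θ) n :=
          (hdS n hn).continuousOn.comp_continuous (continuous_circleMap w r) hmem
        have c2 : Continuous fun θ => (1 / (circleMap w r θ - w) ^ 2) := by
          refine continuous_const.div ((((continuous_circleMap w r).sub continuous_const)).pow 2) fun θ => ?_
          simp [circleMap, hr0.ne']
        simp only [deriv_circleMap]
        exact ((continuous_circleMap 0 r).mul continuous_const).smul (c2.smul c1)
      · filter_upwards [eventually_ne_atTop 0] with n hn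
        filter_upwards with θ _
        have := hbd n hn _ (hmem θ)
        simp only [deriv_circleMap, norm_smul, norm_mul, norm_I, mul_one, norm_div, norm_pow, norm_one]
        simp only [circleMap, add_sub_cancel_left, zero_add, norm_mul, norm_exp_ofReal_mul_I, mul_one, norm_real,
          Real.norm_eq_abs, abs_of_pos hr0]
        simp only [circleMap] at this
        gcongr
      · exact intervalIntegrable_const
      · filter_upwards with θ _
        exact ((GammaSeq_tendsto_Gamma _).const_smul _).const_smul _
    rw [hdG.deriv_eq_smul_circleIntegral hr0] at key
    have key2 := key.const_smul ((2 * Real.pi * I : ℂ)⁻¹)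
    rw [inv_smul_smul₀ hI] at key2
    refine key2.congr' ?_
    filter_upwards [eventually_ne_atTop 0] with n hn
    rw [(hdS n hn).deriv_eq_smul_circleIntegral hr0, inv_smul_smul₀ hI]
  have hG : Gamma w ≠ 0 := Gamma_ne_zero_of_re_pos hw
  have t := hderiv.div (GammaSeq_tendsto_Gamma w) hG
  rw [digamma_def, logDeriv_apply]
  refine t.congr' ?_
  have hne := (GammaSeq_tendsto_Gamma w).eventually_ne hG
  filter_upwards [eventually_ne_atTop 0, hne] with n hn h0
  rw [Pi.div_apply, (GammaSeq_hasDerivAt w hw n hn).deriv]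
  field_simp

lemma arctan_step (a v : ℝ) (ha : 0 ≤ a) (hv : 0 < v) :
    1 / ((a + 1) ^ 2 + v ^ 2) ≤ (Real.arctan ((a + 1) / v) - Real.arctan (a / v)) / v := by
  have hd : ∀ x, HasDerivAt (fun x => Real.arctan (x / v) / v) (1 / (x ^ 2 + v ^ 2)) x := by
    intro x
    have := ((Real.hasDerivAt_arctan (x / v)).comp x ((hasDerivAt_id x).div_const v)).div_const v
    refine this.congr_deriv ?_
    field_simp
    ring
  obtain ⟨c, hc, h⟩ := exists_hasDerivAt_eq_slope (fun x => Real.arctan (x / v) / v) _ (by linarith : a < a + 1)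
    (fun x _ => (hd x).continuousAt.continuousWithinAt) (fun x _ => hd x)
  have e : (Real.arctan ((a + 1) / v) - Real.arctan (a / v)) / v = 1 / (c ^ 2 + v ^ 2) := by
    rw [h]; ring
  rw [e]
  have h1 := hc.1
  have h2 := hc.2
  have : 0 ≤ c := by linarith
  gcongr

lemma sum_arctan (u v : ℝ) (hu : 1 ≤ u) (hv : 0 < v) (n : ℕ) :
    ∑ k ∈ Finset.range n, 1 / ((u + k) ^ 2 + v ^ 2) ≤ Real.pi / (2 * v) := by
  have h : ∀ k ∈ Finset.range n, 1 / ((u + k) ^ 2 + v ^ 2) ≤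
      (fun k : ℕ => Real.arctan ((u - 1 + k) / v) / v) (k + 1) - (fun k : ℕ => Real.arctan ((u - 1 + k) / v) / v) k := by
    intro k _
    have := arctan_step (u - 1 + k) v (by have := Nat.cast_nonneg (α := ℝ) k; linarith) hv
    have e : u + k = u - 1 + k + 1 := by ring
    simp only
    rw [← sub_div, e]
    push_cast
    rw [← add_assoc]
    exact this
  refine (Finset.sum_le_sum h).trans ?_
  rw [Finset.sum_range_sub (fun k : ℕ => Real.arctan ((u - 1 + k) / v) / v)]
  have h1 := Real.arctan_lt_pi_div_two ((u - 1 + n) / v)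
  have h2 : 0 ≤ Real.arctan ((u - 1 + (0:ℕ)) / v) := Real.arctan_nonneg.2 (by
    have : 0 ≤ u - 1 := by linarith
    simp; positivity)
  rw [← sub_div, div_le_div_iff₀ hv (by positivity)]
  nlinarith

lemma log_step (q : ℂ) (hq : 0 ≤ q.re) : Real.log ‖1 + q‖ ≤ q.re + ‖q‖ ^ 2 / 2 := by
  have h1 : ‖1 + q‖ ^ 2 = 1 + 2 * q.re + ‖q‖ ^ 2 := by
    rw [← normSq_eq_norm_sq, ← normSq_eq_norm_sq, normSq_apply, normSq_apply]; simp; ring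
  have h2 : 2 * Real.log ‖1 + q‖ = Real.log (‖1 + q‖ ^ 2) := by rw [Real.log_pow]; norm_num
  have h3 := Real.log_le_sub_one_of_pos (x := ‖1 + q‖ ^ 2) (by rw [h1]; positivity)
  rw [h1] at h3 h2
  linarith

theorem digamma_re_le (w : ℂ) (hu : 1 ≤ w.re) (hv : w.im ≠ 0) :
    (digamma w).re ≤ Real.log ‖w‖ + Real.pi / (4 * |w.im|) := by
  have t := (continuous_re.tendsto _).comp (digamma_tendsto w (by linarith))
  refine le_of_tendsto t ?_
  filter_upwards [eventually_ge_atTop 1] with n hn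
  have hn0 : (0:ℝ) < n := by exact_mod_cast hn
  have hw0 : ∀ k : ℕ, w + k ≠ 0 := by
    intro k h
    have := congrArg re h
    simp at this
    have := Nat.cast_nonneg (α := ℝ) k
    linarith
  have hstep : ∀ k ∈ Finset.range (n+1), (Real.log ‖w + (k+1:ℕ)‖ - Real.log ‖w + (k:ℕ)‖) - 1 / ((w.re + k) ^ 2 + w.im ^ 2) / 2
      ≤ (1 / (w + k)).re := by
    intro k _
    have hk := Nat.cast_nonneg (α := ℝ) k
    have h0 : 0 ≤ (1 / (w + k)).re := by
      rw [one_div, inv_re]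
      apply div_nonneg _ (normSq_nonneg _)
      simp; linarith
    have h1 := log_step (1 / (w + k)) h0
    have h2 : 1 + 1 / (w + k) = (w + (k+1:ℕ)) / (w + k) := by
      have := hw0 k
      field_simp
      push_cast; ring
    rw [h2, norm_div, Real.log_div (norm_ne_zero_iff.2 (hw0 _)) (norm_ne_zero_iff.2 (hw0 _))] at h1
    have h3 : ‖1 / (w + k)‖ ^ 2 = 1 / ((w.re + k) ^ 2 + w.im ^ 2) := by
      rw [norm_div, norm_one, div_pow, one_pow, ← normSq_eq_norm_sq, normSq_apply]; simp; ring
    rw [h3] at h1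
    linarith
  have hs := Finset.sum_le_sum hstep
  rw [Finset.sum_sub_distrib, Finset.sum_range_sub (fun k : ℕ => Real.log ‖w + (k:ℕ)‖), ← Finset.sum_div] at hs
  have ha := sum_arctan w.re |w.im| hu (abs_pos.2 hv) (n+1)
  simp only [sq_abs] at ha
  have hb : Real.log n ≤ Real.log ‖w + (n+1:ℕ)‖ := by
    apply Real.log_le_log hn0
    refine le_trans ?_ (re_le_norm _)
    simp; linarith
  have hc : Real.pi / (4 * |w.im|) = Real.pi / (2 * |w.im|) / 2 := by ring
  simp only [Function.comp_apply, sub_re, ofReal_re, re_sum]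
  rw [hc]
  simp only [Nat.cast_zero, add_zero] at hs
  linarith

lemma log_trap (x : ℝ) (hx : 0 ≤ x) : Real.log (1 + x) ≤ (x + x / (1 + x)) / 2 := by
  have hd : ∀ y ∈ Ici (0:ℝ), HasDerivAt (fun y : ℝ => (y + (1 - 1 / (1 + y))) / 2 - Real.log (1 + y)) ((1 + 1 / (1 + y) ^ 2) / 2 - 1 / (1 + y)) y := by
    intro y hy
    have hy0 : (0:ℝ) ≤ y := hy
    have h1 : HasDerivAt (fun y : ℝ => 1 + y) 1 y := (hasDerivAt_id y).const_add 1
    have h2 := (h1.inv (by linarith : 1 + y ≠ 0)).const_sub 1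
    have h3 := h1.log (by linarith : 1 + y ≠ 0)
    have := (((hasDerivAt_id y).add h2).div_const 2).sub h3
    simp only [one_div]
    refine this.congr_deriv ?_
    field_simp
  have hm : MonotoneOn (fun y : ℝ => (y + (1 - 1 / (1 + y))) / 2 - Real.log (1 + y)) (Ici 0) := by
    refine monotoneOn_of_deriv_nonneg (convex_Ici 0) (fun y hy => (hd y hy).continuousAt.continuousWithinAt)
      (fun y hy => (hd y (interior_subset hy)).differentiableAt.differentiableWithinAt) ?_
    intro y hy
    have hy0 : (0:ℝ) ≤ y := interior_subset hy
    rw [(hd y (interior_subset hy)).deriv]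
    have : (1 + 1 / (1 + y) ^ 2) / 2 - 1 / (1 + y) = (1 - 1 / (1 + y)) ^ 2 / 2 := by field_simp; ring
    rw [this]; positivity
  have := hm (mem_Ici.2 le_rfl) hx hx
  simp only [add_zero, Real.log_one] at this
  have e : 1 - 1 / (1 + x) = x / (1 + x) := by field_simp; ring
  rw [e] at this
  norm_num at this
  linarith

theorem digamma_real_le (w : ℝ) (hu : 0 < w) : (digamma w).re ≤ Real.log w - 1 / (2 * w) := by
  have t := (continuous_re.tendsto _).comp (digamma_tendsto (w:ℂ) (by simpa using hu))
  have t2 : Tendsto (fun n : ℕ => Real.log w - 1 / (2 * w) + 1 / (n:ℝ)) atTop (𝓝 (Real.log w - 1 / (2 * w) + 0)) :=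
    tendsto_const_nhds.add tendsto_one_div_atTop_nhds_zero_nat
  rw [add_zero] at t2
  refine le_of_tendsto_of_tendsto t t2 ?_
  filter_upwards [eventually_ge_atTop 1] with n hn
  have hn0 : (0:ℝ) < n := by exact_mod_cast hn
  have hstep : ∀ k ∈ Finset.range (n+1), (Real.log (w + (k+1:ℕ)) - Real.log (w + (k:ℕ))) + (1 / (w + (k:ℕ)) - 1 / (w + (k+1:ℕ))) / 2
      ≤ 1 / (w + k) := by
    intro k _
    have hk := Nat.cast_nonneg (α := ℝ) k
    have hp : 0 < w + k := by linarith
    have h1 := log_trap (1 / (w + k)) (by positivity)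
    have h2 : 1 + 1 / (w + k) = (w + (k+1:ℕ)) / (w + k) := by
      field_simp
      push_cast; ring
    have h3 : 1 / (w + k) / (1 + 1 / (w + k)) = 1 / (w + (k+1:ℕ)) := by
      push_cast
      field_simp
      ring
    rw [h3, h2, Real.log_div (by push_cast; linarith) hp.ne'] at h1
    linarith
  have hs := Finset.sum_le_sum hstep
  rw [Finset.sum_add_distrib, Finset.sum_range_sub (fun k : ℕ => Real.log (w + (k:ℕ))), ← Finset.sum_div,
    Finset.sum_range_sub' (fun k : ℕ => 1 / (w + (k:ℕ)))] at hs
  have hb : Real.log n ≤ Real.log (w + (n+1:ℕ)) := by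
    apply Real.log_le_log hn0
    push_cast; linarith
  have hc : 1 / (w + (n+1:ℕ)) ≤ 1 / (n:ℝ) := by
    apply one_div_le_one_div_of_le hn0
    push_cast; linarith
  have hre : ∀ k : ℕ, (1 / ((w:ℂ) + k)).re = 1 / (w + k) := by
    intro k
    have : (1 / ((w:ℂ) + k)) = ((1 / (w + k) : ℝ) : ℂ) := by push_cast; rfl
    rw [this, ofReal_re]
  simp only [Function.comp_apply, sub_re, ofReal_re, re_sum, hre]
  simp only [Nat.cast_zero, add_zero] at hs
  have e : 1 / (2 * w) = 1 / w / 2 := by ring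
  rw [e]
  have : 0 < 1 / (n:ℝ) := by positivity
  linarith
end

section
open Complex Metric MeasureTheory Set Filter Topology

noncomputable def ZZ : ℕ → List ℂ := xi_zeros.choose
lemma ZZ_zero (n : ℕ) (ρ : ℂ) (h : ρ ∈ ZZ n) : XiF ρ = 0 := xi_zeros.choose_spec.1 n ρ h
lemma ZZ_mem (ρ : ℂ) (h : XiF ρ = 0) : ∀ᶠ n in atTop, ρ ∈ ZZ n := xi_zeros.choose_spec.2.1 ρ h
lemma ZZ_tendsto (z : ℂ) (h : XiF z ≠ 0) : Tendsto (fun n => zsum (ZZ n) z) atTop (𝓝 (logDeriv XiF z)) :=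
  xi_zeros.choose_spec.2.2 z h

lemma list_two_le (Z : List ℂ) (f : ℂ → ℝ) (hf : ∀ ρ ∈ Z, 0 ≤ f ρ) (a b : ℂ) (ha : a ∈ Z) (hb : b ∈ Z) (hab : a ≠ b) :
    f a + f b ≤ (Z.map f).sum := by
  have h1 : b ∈ Z.erase a := (List.mem_erase_of_ne hab.symm).2 hb
  have p1 := (List.perm_cons_erase ha).map f
  have p2 := (List.perm_cons_erase h1).map f
  rw [p1.sum_eq, List.map_cons, List.sum_cons, p2.sum_eq, List.map_cons, List.sum_cons]
  have : 0 ≤ (((Z.erase a).erase b).map f).sum := by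
    apply List.sum_nonneg
    intro x hx
    obtain ⟨y, hy, rfl⟩ := List.mem_map.1 hx
    exact hf y (List.mem_of_mem_erase (List.mem_of_mem_erase hy))
  linarith

lemma list_sum_re (Z : List ℂ) (f : ℂ → ℂ) : ((Z.map f).sum).re = (Z.map (fun ρ => (f ρ).re)).sum := by
  induction Z with
  | nil => simp
  | cons a Z ih => simp [ih]

lemma list_sum_le (Z : List ℂ) (f g : ℂ → ℝ) (h : ∀ ρ ∈ Z, f ρ ≤ g ρ) : (Z.map f).sum ≤ (Z.map g).sum := by
  exact List.sum_le_sum h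

lemma re_inv_nonneg (z : ℂ) (h : 0 ≤ z.re) : 0 ≤ (1 / z).re := by
  rw [one_div, inv_re]
  exact div_nonneg h (normSq_nonneg _)

lemma zterm_nonneg (z ρ : ℂ) (hz : 1/2 ≤ z.re) (hρ : XiF ρ = 0) : 0 ≤ ((1 / (z - ρ) + 1 / (z + ρ)) / 2).re := by
  have h := abs_lt.1 (XiF_zero_re ρ hρ)
  have h1 := re_inv_nonneg (z - ρ) (by simp; linarith)
  have h2 := re_inv_nonneg (z + ρ) (by simp; linarith)
  have : ((1 / (z - ρ) + 1 / (z + ρ)) / 2).re = ((1 / (z - ρ)).re + (1 / (z + ρ)).re) / 2 := by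
    rw [← add_re, show (2:ℂ) = ((2:ℝ):ℂ) by norm_num, div_ofReal_re]
  rw [this]; linarith

lemma XiF_ne_of_re (z : ℂ) (hz : 1/2 ≤ z.re) : XiF z ≠ 0 := fun h => by
  have := abs_lt.1 (XiF_zero_re z h); linarith

lemma xi_logDeriv_nonneg (z : ℂ) (hz : 1/2 ≤ z.re) : 0 ≤ (logDeriv XiF z).re := by
  refine ge_of_tendsto ((continuous_re.tendsto _).comp (ZZ_tendsto z (XiF_ne_of_re z hz))) (Eventually.of_forall fun n => ?_)
  rw [Function.comp_apply, zsum, list_sum_re]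
  apply List.sum_nonneg
  intro x hx
  obtain ⟨y, hy, rfl⟩ := List.mem_map.1 hx
  exact zterm_nonneg z y hz (ZZ_zero n y hy)

lemma xi_two_term (z ρ : ℂ) (hz : 1/2 ≤ z.re) (hρ : XiF ρ = 0) :
    (1 / (z - ρ)).re + (1 / (z + ρ)).re ≤ (logDeriv XiF z).re := by
  have hne : ρ ≠ -ρ := by
    intro h
    have : ρ = 0 := by
      have h2 : 2 * ρ = 0 := by linear_combination h
      simpa using h2
    rw [this] at hρ
    exact XiF_zero_ne hρ
  have hρ' : XiF (-ρ) = 0 := by rw [XiF_even]; exact hρ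
  refine ge_of_tendsto ((continuous_re.tendsto _).comp (ZZ_tendsto z (XiF_ne_of_re z hz))) ?_
  filter_upwards [ZZ_mem ρ hρ, ZZ_mem _ hρ'] with n h1 h2
  rw [Function.comp_apply, zsum, list_sum_re]
  refine le_trans (le_of_eq ?_) (list_two_le (ZZ n) _ (fun y hy => zterm_nonneg z y hz (ZZ_zero n y hy)) ρ (-ρ) h1 h2 hne)
  rw [← add_re, ← add_re]
  congr 1
  rw [sub_neg_eq_add, ← sub_eq_add_neg]
  ring

lemma vm_hasSum (s : ℂ) (hs : 1 < s.re) :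
    HasSum (fun n : ℕ => (ArithmeticFunction.vonMangoldt n : ℂ) * (n:ℂ) ^ (-s)) (- logDeriv riemannZeta s) := by
  have h := (ArithmeticFunction.LSeriesSummable_vonMangoldt hs).hasSum
  have e := ArithmeticFunction.LSeries_vonMangoldt_eq_deriv_riemannZeta_div hs
  rw [LSeries] at e
  rw [e] at h
  rw [logDeriv_apply, ← neg_div]
  convert! h using 1
  funext n
  rw [LSeries.term_def]
  split_ifs with h0
  · simp [h0]
  · rw [cpow_neg, div_eq_mul_inv]

lemma log_lb (p a b : ℕ) (_hp : 0 < p) (h : 2 ^ a ≤ p ^ b) : (a:ℝ) * Real.log 2 ≤ b * Real.log p := by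
  rw [← Real.log_pow, ← Real.log_pow]
  apply Real.log_le_log (by positivity)
  exact_mod_cast h

lemma log_pi_gt : 1.1436 < Real.log Real.pi := by
  have h1 : Real.log 3.14 < Real.log Real.pi := Real.log_lt_log (by norm_num) Real.pi_gt_d2
  have h2 : (33:ℝ) * Real.log 2 ≤ 20 * Real.log 3.14 := by
    have : Real.log (2 ^ 33) ≤ Real.log (3.14 ^ 20) := Real.log_le_log (by norm_num) (by norm_num)
    rw [Real.log_pow, Real.log_pow] at this
    exact_mod_cast this
  have := Real.log_two_gt_d9
  linarith

open ArithmeticFunction in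
lemma vm_two : 0.503 ≤ (- logDeriv riemannZeta 2).re := by
  have h := hasSum_re (vm_hasSum 2 (by norm_num))
  have hterm : ∀ n : ℕ, ((vonMangoldt n : ℂ) * (n:ℂ) ^ (-(2:ℂ))).re = vonMangoldt n / (n:ℝ) ^ 2 := by
    intro n
    have : (n:ℂ) ^ (-(2:ℂ)) = (((n:ℝ) ^ 2)⁻¹ : ℝ) := by
      rw [cpow_neg]; push_cast; norm_cast
    rw [this, re_ofReal_mul, ofReal_re]; rfl
  simp only [hterm] at h
  have hs := sum_le_hasSum (Finset.range 17) (fun n _ => by have := vonMangoldt_nonneg (n := n); positivity) h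
  have hnn : ∀ n : ℕ, 0 ≤ vonMangoldt n := fun n => vonMangoldt_nonneg
  have l2 : vonMangoldt 2 = Real.log 2 := by exact_mod_cast vonMangoldt_apply_prime Nat.prime_two
  have l3 : vonMangoldt 3 = Real.log 3 := by exact_mod_cast vonMangoldt_apply_prime Nat.prime_three
  have l5 : vonMangoldt 5 = Real.log 5 := by exact_mod_cast vonMangoldt_apply_prime Nat.prime_five
  have l7 : vonMangoldt 7 = Real.log 7 := by exact_mod_cast vonMangoldt_apply_prime (by norm_num : Nat.Prime 7)
  have l11 : vonMangoldt 11 = Real.log 11 := by exact_mod_cast vonMangoldt_apply_prime (by norm_num : Nat.Prime 11)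
  have l13 : vonMangoldt 13 = Real.log 13 := by exact_mod_cast vonMangoldt_apply_prime (by norm_num : Nat.Prime 13)
  have l4 : vonMangoldt 4 = Real.log 2 := by rw [show 4 = 2 ^ 2 by norm_num, vonMangoldt_apply_pow (by norm_num), l2]
  have l8 : vonMangoldt 8 = Real.log 2 := by rw [show 8 = 2 ^ 3 by norm_num, vonMangoldt_apply_pow (by norm_num), l2]
  have l16 : vonMangoldt 16 = Real.log 2 := by rw [show 16 = 2 ^ 4 by norm_num, vonMangoldt_apply_pow (by norm_num), l2]
  have l9 : vonMangoldt 9 = Real.log 3 := by rw [show 9 = 3 ^ 2 by norm_num, vonMangoldt_apply_pow (by norm_num), l3]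
  simp only [Finset.sum_range_succ, Finset.sum_range_zero, l2, l3, l4, l5, l7, l8, l9, l11, l13, l16] at hs
  have g2 := Real.log_two_gt_d9
  have g3 := log_lb 3 19 12 (by norm_num) (by norm_num)
  have g5 := log_lb 5 65 28 (by norm_num) (by norm_num)
  have g7 := log_lb 7 14 5 (by norm_num) (by norm_num)
  have g11 := log_lb 11 83 24 (by norm_num) (by norm_num)
  have g13 := log_lb 13 37 10 (by norm_num) (by norm_num)
  push_cast at g3 g5 g7 g11 g13 hs
  have := hnn 0; have := hnn 1; have := hnn 6; have := hnn 10; have := hnn 12; have := hnn 14; have := hnn 15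
  norm_num at hs
  rw [neg_re]
  linarith

lemma xi_at : (logDeriv XiF (3/2)).re ≤ 0.148 := by
  have h := congrArg re (XiF_logDeriv 2 (by norm_num))
  have h1 := vm_two
  rw [h] at h1
  have h2 := digamma_real_le 2 (by norm_num)
  have e1 : (2:ℂ)/2 + 1 = ((2:ℝ):ℂ) := by norm_num
  have e2 : (2:ℂ) - 1/2 = 3/2 := by norm_num
  rw [e1, e2] at h1
  simp only [sub_re, add_re] at h1
  have e3 : (digamma ((2:ℝ):ℂ) / 2).re = (digamma ((2:ℝ):ℂ)).re / 2 := by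
    rw [show (2:ℂ) = ((2:ℝ):ℂ) by norm_num, div_ofReal_re]
  have e4 : ((Real.log Real.pi : ℂ) / 2).re = Real.log Real.pi / 2 := by
    rw [show (2:ℂ) = ((2:ℝ):ℂ) by norm_num, div_ofReal_re, ofReal_re]
  have e5 : ((1:ℂ) / (2 - 1)).re = 1 := by norm_num
  rw [e3, e4, e5] at h1
  have := Real.log_two_lt_d9
  have := log_pi_gt
  linarith

lemma pair_re (ρ : ℂ) : (1 / ((3/2:ℂ) - ρ)).re + (1 / ((3/2:ℂ) + ρ)).re =
    (3/2 - ρ.re) / ((3/2 - ρ.re) ^ 2 + ρ.im ^ 2) + (3/2 + ρ.re) / ((3/2 + ρ.re) ^ 2 + ρ.im ^ 2) := by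
  rw [one_div, one_div, inv_re, inv_re, normSq_apply, normSq_apply]
  have : ((3:ℂ)/2).re = 3/2 := by norm_num
  have h2 : ((3:ℂ)/2).im = 0 := by norm_num
  simp only [sub_re, add_re, sub_im, add_im, this, h2]
  congr 2 <;> ring

theorem zero_im_ge (ρ : ℂ) (hρ : XiF ρ = 0) : 4 ≤ |ρ.im| := by
  by_contra hc
  push Not at hc
  have h := (xi_two_term (3/2) ρ (by norm_num) hρ).trans xi_at
  rw [pair_re] at h
  have hb := abs_lt.1 (XiF_zero_re ρ hρ)
  have hg : ρ.im ^ 2 < 16 := by rw [← sq_abs]; nlinarith [abs_nonneg ρ.im]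
  set b := ρ.re
  set g := ρ.im ^ 2
  have hg0 : 0 ≤ g := sq_nonneg _
  have p1 : 0 < (3/2 - b) ^ 2 + g := by nlinarith
  have p2 : 0 < (3/2 + b) ^ 2 + g := by nlinarith
  rw [div_add_div _ _ p1.ne' p2.ne', div_le_iff₀ (by positivity)] at h
  have hb2 : b ^ 2 ≤ 1/4 := by nlinarith
  nlinarith [mul_nonneg hg0 (by linarith : 0 ≤ 16 - g), sq_nonneg b, mul_nonneg (sq_nonneg b) hg0, mul_nonneg (sq_nonneg b) (by linarith : 0 ≤ 1/4 - b^2), mul_nonneg (by linarith : 0 ≤ 1/4 - b^2) hg0]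

/-- eventual bound of the sum of `1/γ^2` -/
theorem zz_sum_le : ∀ᶠ n in atTop, ((ZZ n).map (fun ρ => 1 / ρ.im ^ 2)).sum ≤ 0.12 := by
  have t := (continuous_re.tendsto _).comp (ZZ_tendsto (3/2) (XiF_ne_of_re (3/2) (by norm_num)))
  have : ∀ᶠ n in atTop, (zsum (ZZ n) (3/2)).re < 0.15 := t.eventually (gt_mem_nhds (by have := xi_at; linarith))
  filter_upwards [this] with n hn
  rw [zsum, list_sum_re] at hn
  have h : ((ZZ n).map (fun ρ => 1.25 * (1 / ρ.im ^ 2))).sum ≤ _ := (list_sum_le (ZZ n) _ _ (fun ρ hρ => ?_)).trans hn.le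
  · rw [List.sum_map_mul_left] at h
    linarith
  · have h0 := ZZ_zero n ρ hρ
    have e : ((1 / ((3/2:ℂ) - ρ) + 1 / ((3/2:ℂ) + ρ)) / 2).re = ((1 / ((3/2:ℂ) - ρ)).re + (1 / ((3/2:ℂ) + ρ)).re) / 2 := by
      rw [← add_re, show (2:ℂ) = ((2:ℝ):ℂ) by norm_num, div_ofReal_re]
    rw [e, pair_re]
    have hb := abs_lt.1 (XiF_zero_re ρ h0)
    have hg : 16 ≤ ρ.im ^ 2 := by rw [← sq_abs]; nlinarith [zero_im_ge ρ h0]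
    set b := ρ.re
    set g := ρ.im ^ 2
    have p1 : 0 < (3/2 - b) ^ 2 + g := by nlinarith
    have p2 : 0 < (3/2 + b) ^ 2 + g := by nlinarith
    rw [div_add_div _ _ p1.ne' p2.ne', mul_one_div, div_div, div_le_div_iff₀ (by linarith) (by positivity)]
    have hb2 : b ^ 2 ≤ 1/4 := by nlinarith
    nlinarith [mul_nonneg (by linarith : 0 ≤ g - 16) (by linarith : 0 ≤ g - 16), sq_nonneg b, mul_nonneg (sq_nonneg b) (by linarith : 0 ≤ g - 16), mul_nonneg (sq_nonneg b) (by linarith : 0 ≤ 1/4 - b^2), mul_nonneg (by linarith : 0 ≤ 1/4 - b^2) (by linarith : 0 ≤ g - 16)]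
end

section
open Complex Metric MeasureTheory Set Filter Topology

lemma trig_nonneg (θ : ℝ) : 0 ≤ 11.1644 + 19.04 * Real.cos θ + 11.6644 * Real.cos (2 * θ) + 4.76 * Real.cos (3 * θ)
    + Real.cos (4 * θ) := by
  have h4 : Real.cos (4 * θ) = 2 * (2 * Real.cos θ ^ 2 - 1) ^ 2 - 1 := by
    rw [show 4 * θ = 2 * (2 * θ) by ring, Real.cos_two_mul, Real.cos_two_mul]
  rw [h4, Real.cos_two_mul, Real.cos_three_mul]
  nlinarith [sq_nonneg (Real.cos θ ^ 2 + 1.19 * Real.cos θ + 0.25)]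

lemma cpow_re (n : ℕ) (hn : n ≠ 0) (σ t : ℝ) : ((n:ℂ) ^ (-((σ:ℂ) + t * I))).re = (n:ℝ) ^ (-σ) * Real.cos (t * Real.log n) := by
  have hn' : (n:ℂ) ≠ 0 := by exact_mod_cast hn
  have hp : (0:ℝ) < n := by positivity
  have hl : log (n:ℂ) = ((Real.log n : ℝ) : ℂ) := by rw [ofReal_log hp.le, ofReal_natCast]
  have hre : (log (n:ℂ)).re = Real.log n := by rw [hl, ofReal_re]
  have him : (log (n:ℂ)).im = 0 := by rw [hl, ofReal_im]
  rw [cpow_def_of_ne_zero hn', Real.rpow_def_of_pos hp, exp_re]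
  simp [hre, him, mul_comm]

lemma zeta_comb (σ t : ℝ) (hσ : 1 < σ) :
    0 ≤ 11.1644 * (- logDeriv riemannZeta (σ + (0:ℝ) * I)).re + 19.04 * (- logDeriv riemannZeta (σ + t * I)).re
    + 11.6644 * (- logDeriv riemannZeta (σ + (2 * t : ℝ) * I)).re + 4.76 * (- logDeriv riemannZeta (σ + (3 * t : ℝ) * I)).re
    + (- logDeriv riemannZeta (σ + (4 * t : ℝ) * I)).re := by
  have h : ∀ u : ℝ, HasSum (fun n : ℕ => ArithmeticFunction.vonMangoldt n * ((n:ℝ) ^ (-σ) * Real.cos (u * Real.log n)))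
      (- logDeriv riemannZeta (σ + u * I)).re := by
    intro u
    have := hasSum_re (vm_hasSum (σ + u * I) (by simpa using hσ))
    refine this.congr_fun ?_ |> fun x => x
    intro n
    by_cases hn : n = 0
    · simp [hn]
    · rw [re_ofReal_mul, cpow_re n hn]
  have hs := ((((h 0).mul_left 11.1644).add ((h t).mul_left 19.04)).add ((h (2*t)).mul_left 11.6644)).add ((h (3*t)).mul_left 4.76) |>.add (h (4*t))
  refine hs.nonneg fun n => ?_
  have h1 := trig_nonneg (t * Real.log n)
  have h2 : 0 ≤ ArithmeticFunction.vonMangoldt n * (n:ℝ) ^ (-σ) := mul_nonneg ArithmeticFunction.vonMangoldt_nonneg (by positivity)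
  have := mul_nonneg h2 h1
  rw [zero_mul, Real.cos_zero, mul_assoc 2, mul_assoc 3, mul_assoc 4]
  linarith

lemma zeta_re_eq (s : ℂ) (hs : 1 < s.re) : (- logDeriv riemannZeta s).re =
    (1 / (s - 1)).re - Real.log Real.pi / 2 + (digamma (s / 2 + 1)).re / 2 - (logDeriv XiF (s - 1/2)).re := by
  rw [XiF_logDeriv s hs, sub_re, add_re, sub_re]
  have e3 : (digamma (s / 2 + 1) / 2).re = (digamma (s / 2 + 1)).re / 2 := by
    rw [show digamma (s/2+1) / 2 = digamma (s/2+1) / ((2:ℝ):ℂ) by norm_num, div_ofReal_re]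
  have e4 : ((Real.log Real.pi : ℂ) / 2).re = Real.log Real.pi / 2 := by
    rw [show (2:ℂ) = ((2:ℝ):ℂ) by norm_num, div_ofReal_re, ofReal_re]
  rw [e3, e4]

/-- bound of the archimedean part at height `k t` -/
lemma arch_bound (k : ℕ) (hk : 1 ≤ k) (l t τ : ℝ) (hl : 0 < l) (hl2 : l ≤ 0.17) (ht : 4 ≤ |t|) (htτ : |t| ≤ τ) (hτ : 14 ≤ τ) :
    (1 / ((1 + l : ℝ) + (k * t : ℝ) * I - 1 : ℂ)).re - Real.log Real.pi / 2 +
      (digamma ((((1 + l : ℝ) : ℂ) + (k * t : ℝ) * I) / 2 + 1)).re / 2 ≤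
    Real.log τ / 2 + Real.log (k / 2) / 2 - 0.5718 + 0.19636 / k + 0.0236 / k ^ 2 := by
  have hk0 : (1:ℝ) ≤ k := by exact_mod_cast hk
  have hkp : (0:ℝ) < k := by linarith
  set w : ℂ := (((1 + l : ℝ) : ℂ) + (k * t : ℝ) * I) / 2 + 1 with hw
  have hwre : w.re = 1.5 + l / 2 := by
    rw [hw, add_re, show (2:ℂ) = ((2:ℝ):ℂ) by norm_num, div_ofReal_re]; simp; ring
  have hwim : w.im = k * t / 2 := by
    rw [hw, add_im, show (2:ℂ) = ((2:ℝ):ℂ) by norm_num, div_ofReal_im]; simp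
  have ht0 : t ≠ 0 := by intro h; rw [h] at ht; norm_num at ht
  have hd := digamma_re_le w (by rw [hwre]; linarith) (by rw [hwim]; positivity)
  have habs : |w.im| = k * |t| / 2 := by rw [hwim, abs_div, abs_mul, abs_of_pos hkp]; norm_num
  have h1 : Real.pi / (4 * |w.im|) ≤ 0.39272 / k := by
    rw [habs, div_le_div_iff₀ (by positivity) hkp]
    have := Real.pi_lt_d6
    nlinarith [mul_le_mul_of_nonneg_left ht hkp.le]
  have h2 : (1 / (((1 + l : ℝ) : ℂ) + (k * t : ℝ) * I - 1)).re ≤ 0.0107 / k ^ 2 := by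
    have e : (((1 + l : ℝ) : ℂ) + (k * t : ℝ) * I - 1) = (l : ℂ) + (k * t : ℝ) * I := by push_cast; ring
    rw [e, one_div, inv_re, normSq_apply]
    simp only [add_re, ofReal_re, mul_re, I_re, mul_zero, ofReal_im, I_im, mul_one, sub_self, add_zero, add_im, mul_im, zero_add]
    have h16 : 16 ≤ t ^ 2 := by rw [← sq_abs]; nlinarith
    rw [div_le_div_iff₀ (by nlinarith [mul_self_nonneg ((k:ℝ) * t), mul_pos hl hl]) (by positivity)]
    have : 0 ≤ (k:ℝ)^2 * (t^2 - 16) := by have : 0 ≤ t^2 - 16 := by linarith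
                                          positivity
    nlinarith [sq_nonneg l, sq_nonneg (k:ℝ)]
  have hτ0 : 0 < τ := by linarith
  have h3 : Real.log ‖w‖ ≤ Real.log τ + Real.log (k / 2) + 0.0258 / k ^ 2 := by
    have hn : ‖w‖ ^ 2 = (1.5 + l/2) ^ 2 + k ^ 2 * t ^ 2 / 4 := by
      rw [← normSq_eq_norm_sq, normSq_apply, hwre, hwim]; ring
    have ht2 : t ^ 2 ≤ τ ^ 2 := by rw [← sq_abs]; nlinarith [abs_nonneg t]
    have hn2 : ‖w‖ ^ 2 ≤ (τ * (k / 2)) ^ 2 * (1 + 0.0516 / k ^ 2) := by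
      rw [hn]
      have e : (τ * (k / 2)) ^ 2 * (1 + 0.0516 / k ^ 2) = τ ^ 2 * k ^ 2 / 4 + 0.0129 * τ ^ 2 := by field_simp; ring
      rw [e]
      have : (k:ℝ)^2 * t^2 ≤ k^2 * τ^2 := by gcongr
      nlinarith
    have hwpos : 0 < ‖w‖ := norm_pos_iff.2 (by intro h; rw [h] at hwre; simp at hwre; linarith)
    have hlog := Real.log_le_log (by positivity) hn2
    rw [Real.log_mul (by positivity) (by positivity), Real.log_pow, Real.log_pow, Real.log_mul (by positivity) (by positivity)] at hlog
    have hl3 := Real.log_le_sub_one_of_pos (x := 1 + 0.0516 / (k:ℝ) ^ 2) (by positivity)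
    have e2 : 0.0258 / (k:ℝ)^2 = 0.0516 / (k:ℝ)^2 / 2 := by ring
    rw [e2]
    push_cast at hlog
    linarith
  have hp := log_pi_gt
  have e1 : 0.19636 / (k:ℝ) = 0.39272 / k / 2 := by ring
  have e2 : 0.0236 / (k:ℝ)^2 = 0.0107 / k^2 + 0.0258 / k^2 / 2 := by ring
  rw [e1, e2]
  linarith

lemma zf_fin (L l δ T : ℝ) (hL0 : 0 < L) (hL : L = 18.2322 * (T - 1.42)) (hl : l = 3.415 / L) (hl0 : 0 < l) (hδ0 : 0 < δ)
    (main : 0 ≤ 11.1644 * (1 / l) - 19.04 * (1 / (l + δ)) + L) : 1 / (17.46 * (T - 1.42)) ≤ δ := by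
  have hll : 1 / l = L / 3.415 := by rw [hl]; field_simp
  rw [hll] at main
  have : 19.04 * (1 / (l + δ)) ≤ 4.26923 * L := by
    generalize 1 / (l + δ) = X at main
    norm_num at main ⊢
    linarith
  rw [mul_one_div, div_le_iff₀ (by positivity)] at this
  have hlL : l * L = 3.415 := by rw [hl]; field_simp
  have hfin : 1.0444 ≤ δ * L := by
    have e : 4.26923 * L * (l + δ) = 4.26923 * (l * L) + 4.26923 * (δ * L) := by ring
    rw [e, hlL] at this
    norm_num at this ⊢
    linarith
  have hden : 0 < 17.46 * (T - 1.42) := by linarith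
  rw [div_le_iff₀ hden]
  have e2 : δ * (17.46 * (T - 1.42)) = δ * L * (17.46 / 18.2322) := by rw [hL]; ring
  rw [e2]
  norm_num at hfin ⊢
  linarith

theorem zero_free_aux (ρ : ℂ) (hρ : XiF ρ = 0) (hb : 0 ≤ ρ.re) :
    1 / (17.46 * (Real.log (max |ρ.im| 14) - 1.42)) ≤ 1/2 - ρ.re := by
  set t := ρ.im with ht
  set τ := max |t| 14
  have hτ : 14 ≤ τ := le_max_right _ _
  have htτ : |t| ≤ τ := le_max_left _ _
  have ht4 : 4 ≤ |t| := zero_im_ge ρ hρ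
  have hlogτ : 2.63 ≤ Real.log τ := by
    have h1 : Real.log 14 ≤ Real.log τ := Real.log_le_log (by norm_num) hτ
    have h2 := log_lb 14 19 5 (by norm_num) (by norm_num)
    have := Real.log_two_gt_d9
    push_cast at h2
    linarith
  set L := 18.2322 * (Real.log τ - 1.42) with hL
  have hL1 : 22 ≤ L := by rw [hL]; linarith
  have hL0 : 0 < L := by linarith
  set l := 3.415 / L with hl
  have hl0 : 0 < l := by positivity
  have hl1 : l ≤ 0.17 := by rw [hl, div_le_iff₀ hL0]; linarith
  have hbb := abs_lt.1 (XiF_zero_re ρ hρ)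
  set δ := 1/2 - ρ.re with hδ
  have hδ0 : 0 < δ := by rw [hδ]; linarith [hbb.2]
  have hcomb := zeta_comb (1 + l) t (by linarith)
  have hre : ∀ u : ℝ, 1 < (((1 + l : ℝ) : ℂ) + (u : ℝ) * I).re := by intro u; simp; exact hl0
  have hx : ∀ u : ℝ, 0 ≤ (logDeriv XiF (((1 + l : ℝ) : ℂ) + (u : ℝ) * I - 1/2)).re := by
    intro u
    apply xi_logDeriv_nonneg
    rw [sub_re]
    have : ((1:ℂ)/2).re = 1/2 := by norm_num
    have := hre u
    linarith
  have hx1 : 1 / (l + δ) ≤ (logDeriv XiF (((1 + l : ℝ) : ℂ) + (t : ℝ) * I - 1/2)).re := by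
    have h12 : ((1:ℂ)/2).re = 1/2 := by norm_num
    have h12i : ((1:ℂ)/2).im = 0 := by norm_num
    have hz : 1/2 ≤ (((1 + l : ℝ) : ℂ) + (t : ℝ) * I - 1/2).re := by
      rw [sub_re, h12]; have := hre t; linarith
    have h := xi_two_term _ ρ hz hρ
    refine le_trans ?_ h
    have h2 := re_inv_nonneg (((1 + l : ℝ) : ℂ) + (t : ℝ) * I - 1/2 + ρ) (by rw [add_re]; linarith)
    have e : ((1 + l : ℝ) : ℂ) + (t : ℝ) * I - 1/2 - ρ = ((l + δ : ℝ) : ℂ) := by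
      apply Complex.ext
      · simp only [sub_re, add_re, ofReal_re, mul_re, I_re, ofReal_im, I_im, h12, hδ]; ring
      · simp only [sub_im, add_im, ofReal_re, mul_im, I_re, ofReal_im, I_im, h12i, ht]; ring
    have e' : (1 / (((1 + l : ℝ) : ℂ) + (t : ℝ) * I - 1/2 - ρ)).re = 1 / (l + δ) := by
      rw [e, ← ofReal_one, ← ofReal_div, ofReal_re]
    rw [e']
    linarith
  have a1 := arch_bound 1 le_rfl l t τ hl0 hl1 ht4 htτ hτ
  have a2 := arch_bound 2 (by norm_num) l t τ hl0 hl1 ht4 htτ hτ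
  have a3 := arch_bound 3 (by norm_num) l t τ hl0 hl1 ht4 htτ hτ
  have a4 := arch_bound 4 (by norm_num) l t τ hl0 hl1 ht4 htτ hτ
  have z0 := zeta_re_eq _ (hre 0)
  have z1 := zeta_re_eq _ (hre t)
  have z2 := zeta_re_eq _ (hre (2*t))
  have z3 := zeta_re_eq _ (hre (3*t))
  have z4 := zeta_re_eq _ (hre (4*t))
  have x0 := hx 0
  have x2 := hx (2*t)
  have x3 := hx (3*t)
  have x4 := hx (4*t)
  have b0 : (- logDeriv riemannZeta (((1 + l : ℝ) : ℂ) + (0:ℝ) * I)).re ≤ 1 / l - 0.4988 := by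
    have e0 : ((1 + l : ℝ) : ℂ) + (0:ℝ) * I - 1 = (l : ℂ) := by push_cast; ring
    have e1 : (((1 + l : ℝ) : ℂ) + (0:ℝ) * I) / 2 + 1 = ((1.5 + l / 2 : ℝ) : ℂ) := by push_cast; ring
    have d := digamma_real_le (1.5 + l/2) (by positivity)
    rw [e0, e1, one_div, ← ofReal_inv, ofReal_re, ← one_div] at z0
    have q1 : Real.log (1.5 + l/2) ≤ 0.4614 := by
      have : Real.log (1.5 + l/2) ≤ Real.log 1.585 := Real.log_le_log (by positivity) (by linarith)
      have h2 : Real.log ((1.585:ℝ) ^ 3) ≤ Real.log 4 + (1.585 ^ 3 / 4 - 1) := by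
        have := Real.log_le_sub_one_of_pos (x := (1.585:ℝ)^3 / 4) (by norm_num)
        rw [Real.log_div (by norm_num) (by norm_num)] at this
        linarith
      rw [Real.log_pow, show (4:ℝ) = 2 ^ 2 by norm_num, Real.log_pow] at h2
      have := Real.log_two_lt_d9
      norm_num at h2
      linarith
    have q2 : 0.3154 ≤ 1 / (2 * (1.5 + l/2)) := by
      rw [le_div_iff₀ (by positivity)]; linarith
    have := log_pi_gt
    linarith
  push_cast at a1 a2 a3 a4 z1 z2 z3 z4 x2 x3 x4 hx1 hcomb b0
  simp only [one_mul] at a1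
  rw [Real.log_div (by norm_num) (by norm_num)] at a1 a2 a3 a4
  rw [Real.log_one] at a1
  have l4 : Real.log 4 = 2 * Real.log 2 := by rw [show (4:ℝ) = 2^2 by norm_num, Real.log_pow]; norm_num
  have l3 : 17 * Real.log 3 ≤ 27 * Real.log 2 := by
    have : Real.log (3 ^ 17) ≤ Real.log (2 ^ 27) := Real.log_le_log (by norm_num) (by norm_num)
    rw [Real.log_pow, Real.log_pow] at this
    exact_mod_cast this
  have g1 := Real.log_two_gt_d9
  have g2 := Real.log_two_lt_d9
  rw [l4] at a4
  have main : 0 ≤ 11.1644 * (1 / l) - 19.04 * (1 / (l + δ)) + L := by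
    rw [hL]
    linarith
  exact zf_fin L l δ (Real.log τ) hL0 hL hl hl0 hδ0 main

theorem zero_free (ρ : ℂ) (hρ : XiF ρ = 0) :
    1 / (17.46 * (Real.log (max |ρ.im| 14) - 1.42)) ≤ 1/2 - |ρ.re| := by
  rcases le_total 0 ρ.re with h | h
  · rw [abs_of_nonneg h]; exact zero_free_aux ρ hρ h
  · have := zero_free_aux (-ρ) (by rw [XiF_even]; exact hρ) (by simpa using h)
    rw [abs_of_nonpos h]
    simpa using this
end

section
open Complex Metric MeasureTheory Set Filter Topology

theorem lap_int (k : ℕ) (b : ℝ) (hb : 0 < b) :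
    IntegrableOn (fun u : ℝ => u ^ k * Real.exp (-b * u)) (Ioi 0) := by
  have := integrableOn_rpow_mul_exp_neg_mul_rpow (s := k) (p := 1) (b := b)
    (by have : (0:ℝ) ≤ k := by positivity
        linarith) (by norm_num) hb
  simpa using this

theorem lap_intC (k : ℕ) (a : ℂ) (ha : 0 < a.re) :
    IntegrableOn (fun u : ℝ => (u:ℂ) ^ k * cexp (-a * u)) (Ioi 0) := by
  have h := lap_int k a.re ha
  refine Integrable.mono' h (Continuous.aestronglyMeasurable (by fun_prop)) ?_
  refine (ae_restrict_iff' measurableSet_Ioi).2 (ae_of_all _ fun u hu => ?_)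
  rw [norm_mul, norm_pow, Complex.norm_exp, Complex.norm_real, Real.norm_of_nonneg (le_of_lt hu)]
  simp

theorem lap_pow (k : ℕ) (a : ℂ) (ha : 0 < a.re) :
    ∫ u : ℝ in Ioi 0, (u:ℂ) ^ k * cexp (-a * u) = (k.factorial : ℂ) / a ^ (k+1) := by
  have ha0 : a ≠ 0 := by rintro rfl; simp at ha
  induction k with
  | zero =>
    simp only [pow_zero, one_mul]
    rw [integral_exp_mul_complex_Ioi (by simpa using ha)]
    simp
  | succ k ih =>
    have hd : ∀ u : ℝ, HasDerivAt (fun u : ℝ => (u:ℂ)^(k+1) * cexp (-a * u))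
        (((k+1 : ℕ):ℂ) * ((u:ℂ)^k * cexp (-a*u)) - a * ((u:ℂ)^(k+1) * cexp (-a * u))) u := by
      intro u
      have h1 : HasDerivAt (fun z : ℂ => z^(k+1) * cexp (-a * z))
        (((k+1 : ℕ):ℂ) * ((u:ℂ)^k * cexp (-a*u)) - a * ((u:ℂ)^(k+1) * cexp (-a * u))) (u:ℂ) := by
        have := (hasDerivAt_pow (k+1) (u:ℂ)).mul (((hasDerivAt_id (u:ℂ)).const_mul (-a)).cexp)
        convert! this using 1
        simp; ring
      exact h1.comp_ofReal
    have h1 := lap_intC k a ha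
    have h2 := lap_intC (k+1) a ha
    have h3 : Tendsto (fun u : ℝ => (u:ℂ)^(k+1) * cexp (-a * u)) atTop (𝓝 0) := by
      rw [tendsto_zero_iff_norm_tendsto_zero]
      have := Real.tendsto_pow_mul_exp_neg_atTop_nhds_zero (k+1)
      have h4 := (this.comp (tendsto_id.const_mul_atTop ha)).const_mul ((a.re^(k+1))⁻¹)
      rw [mul_zero] at h4
      refine h4.congr' ?_
      filter_upwards [eventually_ge_atTop 0] with u hu
      rw [norm_mul, norm_pow, Complex.norm_exp, Complex.norm_real, Real.norm_of_nonneg hu]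
      simp only [Function.comp, id]
      rw [mul_pow]
      simp
      field_simp
    have h5 := integral_Ioi_of_hasDerivAt_of_tendsto' (a := 0) (fun u _ => hd u)
      ((h1.const_mul _).sub (h2.const_mul _)) h3
    rw [integral_sub (h1.const_mul _) (h2.const_mul _), integral_const_mul, integral_const_mul, ih] at h5
    simp at h5
    have h6 : a * ∫ u : ℝ in Ioi 0, (u:ℂ) ^ (k+1) * cexp (-a * u) = (k+1) * (k.factorial / a^(k+1)) := by
      simp only [neg_mul]
      linear_combination -h5
    rw [Nat.factorial_succ]
    field_simp at h6 ⊢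
    push_cast
    linear_combination h6

/-- Laplace inversion on the line Re s = 2 -/
theorem inv_lap (G : ℝ → ℂ) (H : ℂ → ℂ) (hc : Continuous G) (h0 : ∀ u ≤ 0, G u = 0)
    (hi : IntegrableOn (fun u : ℝ => G u * cexp (-2 * u)) (Ioi 0))
    (hH : ∀ t : ℝ, ∫ u : ℝ in Ioi 0, G u * cexp (-(2+t*I) * u) = H (2+t*I))
    (hHi : Integrable (fun t : ℝ => H (2+t*I))) (u : ℝ) :
    ∫ t : ℝ, H (2+t*I) * cexp (u*(2+t*I)) = 2 * Real.pi * G u := by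
  have hpi := Real.pi_pos
  set f : ℝ → ℂ := fun u => G u * cexp (-2 * u) with hf
  have hfi : Integrable f := by
    rw [← integrableOn_univ, ← Iic_union_Ioi (a := (0:ℝ))]
    refine IntegrableOn.union ?_ hi
    refine (integrableOn_zero (μ := volume)).congr_fun (fun u hu => ?_) measurableSet_Iic
    simp [hf, h0 u hu]
  have hF : ∀ w : ℝ, FourierTransform.fourier f w = H (2 + (2*Real.pi*w : ℝ)*I) := by
    intro w
    rw [Real.fourier_real_eq_integral_exp_smul, ← hH, ← integral_indicator measurableSet_Ioi]
    congr 1; ext v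
    by_cases hv : 0 < v
    · rw [indicator_of_mem (show v ∈ Ioi 0 from hv)]
      simp only [hf, smul_eq_mul]
      rw [mul_comm, mul_assoc, ← Complex.exp_add]
      congr 2; push_cast; ring
    · rw [indicator_of_notMem (by simpa using hv)]
      simp [hf, h0 v (not_lt.1 hv)]
  have hFi : Integrable (FourierTransform.fourier f) := by
    have : FourierTransform.fourier f = fun w : ℝ => H (2 + (2*Real.pi*w : ℝ)*I) := funext hF
    rw [this]
    exact hHi.comp_mul_left' (g := fun t : ℝ => H (2+t*I)) (R := 2*Real.pi) (by positivity)
  have hcf : Continuous f := by fun_prop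
  have key := hfi.fourierInv_fourier_eq hFi (hcf.continuousAt (x := u))
  rw [Real.fourierInv_eq'] at key
  simp only [hF] at key
  have h7 := Measure.integral_comp_mul_left (fun t : ℝ => H (2+t*I) * cexp (u*(2+t*I))) (2*Real.pi)
  have h8 : ∫ v : ℝ, H (2 + (2*Real.pi*v : ℝ)*I) * cexp (u*(2+(2*Real.pi*v : ℝ)*I)) = G u := by
    have : G u = cexp (2*u) * f u := by
      simp only [hf]; rw [mul_left_comm, ← Complex.exp_add]; simp
    rw [this, ← key, ← integral_const_mul]
    congr 1; ext v
    simp only [smul_eq_mul]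
    rw [← mul_assoc, ← Complex.exp_add, mul_comm]
    congr 2
    simp
    ring
  rw [h8] at h7
  rw [h7, abs_of_pos (by positivity)]
  simp only [Complex.real_smul]
  push_cast
  have : (Real.pi : ℂ) ≠ 0 := by exact_mod_cast hpi.ne'
  generalize (∫ t : ℝ, H (2 + t * I) * cexp (u * (2 + t * I))) = J
  field_simp
end

section
open Complex Metric MeasureTheory Set Filter Topology

/-- kernel on the line -/
noncomputable def kk (u t : ℝ) : ℂ := cexp (u*(2+t*I)) / (2+t*I)^4

def JJ (F : ℂ → ℂ) (E : ℝ → ℂ) : Prop :=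
  ∀ u : ℝ, Integrable (fun t : ℝ => F (2+t*I) * kk u t) ∧
    ∫ t : ℝ, F (2+t*I) * kk u t = 2 * Real.pi * E u

theorem line_ne (t : ℝ) : (2 + t*I : ℂ) ≠ 0 := by
  intro h
  have := congrArg Complex.re h
  simp at this

theorem norm_line (t : ℝ) : ‖(2 + t*I : ℂ)‖^2 = 4 + t^2 := by
  rw [← Complex.normSq_eq_norm_sq, Complex.normSq_apply]; simp; ring

theorem norm_kk (u t : ℝ) : ‖kk u t‖ = Real.exp (2*u) / (4+t^2)^2 := by
  rw [kk, norm_div, norm_pow, Complex.norm_exp, ← norm_line]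
  simp; ring_nf

theorem kk_cont (u : ℝ) : Continuous (kk u) := by
  unfold kk
  refine Continuous.div (by fun_prop) (by fun_prop) fun t => pow_ne_zero _ (line_ne t)

theorem ker_int (C : ℝ) : Integrable (fun t : ℝ => C * (1+t^2) / (4+t^2)^2) := by
  have h : Integrable (fun t : ℝ => (1+t^2) / (4+t^2)^2) := by
    refine Integrable.mono' integrable_inv_one_add_sq ?_ (ae_of_all _ fun t => ?_)
    · refine Continuous.aestronglyMeasurable (Continuous.div (by fun_prop) (by fun_prop) fun t => by positivity)
    · rw [Real.norm_of_nonneg (by positivity), div_le_iff₀ (by positivity), inv_mul_eq_div,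
        le_div_iff₀ (by positivity)]
      nlinarith [sq_nonneg t, sq_nonneg (t^2)]
  simpa [mul_div_assoc] using h.const_mul C

theorem kk_bound_int (F : ℝ → ℂ) (hF : AEStronglyMeasurable F volume) (C : ℝ)
    (h : ∀ t, ‖F t‖ ≤ C * (1+t^2)) (u : ℝ) : Integrable (fun t : ℝ => F t * kk u t) := by
  refine Integrable.mono' (ker_int (C * Real.exp (2*u))) (hF.mul (kk_cont u).aestronglyMeasurable)
    (ae_of_all _ fun t => ?_)
  rw [norm_mul, norm_kk]
  calc _ ≤ C * (1+t^2) * (Real.exp (2*u) / (4+t^2)^2) := by gcongr; exact h t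
    _ = _ := by ring

theorem JJ.add {F F' : ℂ → ℂ} {E E' : ℝ → ℂ} (h : JJ F E) (h' : JJ F' E') :
    JJ (fun s => F s + F' s) (fun u => E u + E' u) := by
  intro u
  have a := (h u).1; have b := (h' u).1
  constructor
  · exact (a.add b).congr (ae_of_all _ fun t => by simp [add_mul])
  · simp only [add_mul]
    rw [integral_add a b, (h u).2, (h' u).2]; ring

theorem JJ.const_mul {F : ℂ → ℂ} {E : ℝ → ℂ} (h : JJ F E) (c : ℂ) :
    JJ (fun s => c * F s) (fun u => c * E u) := by
  intro u
  have a := (h u).1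
  constructor
  · simpa [mul_assoc] using a.const_mul c
  · simp only [mul_assoc]
    rw [integral_const_mul, (h u).2]; ring

theorem JJ.zero : JJ (fun _ => 0) (fun _ => 0) := by
  intro u; simp

theorem JJ.list (Z : List ℂ) (F : ℂ → ℂ → ℂ) (E : ℂ → ℝ → ℂ) (h : ∀ ρ ∈ Z, JJ (F ρ) (E ρ)) :
    JJ (fun s => (Z.map (fun ρ => F ρ s)).sum) (fun u => (Z.map (fun ρ => E ρ u)).sum) := by
  induction Z with
  | nil => simpa using JJ.zero
  | cons a Z ih =>
    simp only [List.map_cons, List.sum_cons]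
    exact (h a (by simp)).add (ih fun ρ hρ => h ρ (by simp [hρ]))

theorem JJ.finset (Z : Finset ℕ) (F : ℕ → ℂ → ℂ) (E : ℕ → ℝ → ℂ) (h : ∀ ρ ∈ Z, JJ (F ρ) (E ρ)) :
    JJ (fun s => ∑ ρ ∈ Z, F ρ s) (fun u => ∑ ρ ∈ Z, E ρ u) := by
  classical
  induction Z using Finset.induction_on with
  | empty => simpa using JJ.zero
  | insert a Z ha ih =>
    simp only [Finset.sum_insert ha]
    exact (h a (by simp)).add (ih fun ρ hρ => h ρ (by simp [hρ]))

theorem JJ.mk' (G : ℝ → ℂ) (F : ℂ → ℂ) (hc : Continuous G)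
    (hi : IntegrableOn (fun u : ℝ => G u * cexp (-2 * u)) (Ioi 0))
    (h00 : G 0 = 0)
    (hH : ∀ t : ℝ, ∫ u : ℝ in Ioi 0, G u * cexp (-(2+t*I) * u) = F (2+t*I) / (2+t*I)^4)
    (C : ℝ) (hF : Continuous (fun t : ℝ => F (2+t*I))) (hb : ∀ t : ℝ, ‖F (2+t*I)‖ ≤ C) :
    JJ F (fun u => G (max u 0)) := by
  have hb' : ∀ t : ℝ, ‖F (2+t*I)‖ ≤ C * (1+t^2) := fun t => (hb t).trans (by
    have : 0 ≤ C := (norm_nonneg _).trans (hb 0)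
    nlinarith [sq_nonneg t, mul_nonneg this (sq_nonneg t)])
  intro u
  refine ⟨kk_bound_int _ hF.aestronglyMeasurable C hb' u, ?_⟩
  have h := inv_lap (fun u => G (max u 0)) (fun s => F s / s^4) (by fun_prop)
    (fun u hu => by simp [max_eq_right hu, h00])
    (hi.congr_fun (fun u hu => by dsimp only; rw [max_eq_left (le_of_lt hu)]) measurableSet_Ioi)
    (fun t => by
      rw [← hH t]
      exact setIntegral_congr_fun measurableSet_Ioi (fun u hu => by rw [max_eq_left (le_of_lt hu)]))
    (by
      have := kk_bound_int _ hF.aestronglyMeasurable C hb' 0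
      simpa [kk, mul_div_assoc, div_eq_mul_inv] using this) u
  rw [← h]
  congr 1; ext t; simp only [kk]; ring

theorem JJ_one : JJ (fun _ => 1) (fun u => ((max u 0 : ℝ):ℂ)^3/6) := by
  refine JJ.mk' (fun u => (u:ℂ)^3/6) (fun _ => 1) (by fun_prop) ?_ (by simp) ?_ 1 (by fun_prop) (by simp)
  · have := (lap_intC 3 2 (by norm_num)).div_const 6
    exact this.congr (ae_of_all _ fun u => by ring)
  · intro t
    have := lap_pow 3 (2+t*I) (by simp)
    calc _ = ∫ u : ℝ in Ioi 0, (1/6:ℂ) * ((u:ℂ)^3 * cexp (-(2+t*I)*u)) := by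
          congr 1; ext u; ring
      _ = _ := by
          rw [integral_const_mul, this]; norm_num [Nat.factorial]; ring

noncomputable def Gr (ρ : ℂ) (u : ℝ) : ℂ := (cexp (ρ*u) - 1 - ρ*u - ρ^2*u^2/2 - ρ^3*u^3/6)/ρ^4

theorem JJ_inv (ρ : ℂ) (h0 : ρ ≠ 0) (h2 : ρ.re < 2) :
    JJ (fun s => 1/(s-ρ)) (fun u => Gr ρ (max u 0)) := by
  have hre : ∀ t : ℝ, 2 - ρ.re ≤ ‖(2+t*I : ℂ) - ρ‖ := fun t => by
    refine le_trans ?_ (Complex.re_le_norm _); simp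
  have hne : ∀ t : ℝ, (2+t*I : ℂ) - ρ ≠ 0 := fun t => by
    rw [← norm_pos_iff]; linarith [hre t]
  have e1 : ∀ (t : ℝ) (u : ℝ), Gr ρ u * cexp (-(2+t*I) * u) =
      1/ρ^4 * ((u:ℂ)^0 * cexp (-((2+t*I)-ρ)*u)) - 1/ρ^4 * ((u:ℂ)^0 * cexp (-(2+t*I)*u))
      - 1/ρ^3 * ((u:ℂ)^1 * cexp (-(2+t*I)*u)) - 1/(2*ρ^2) * ((u:ℂ)^2 * cexp (-(2+t*I)*u))
      - 1/(6*ρ) * ((u:ℂ)^3 * cexp (-(2+t*I)*u)) := by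
    intro t u
    have : cexp (-((2+t*I)-ρ)*u) = cexp (ρ*u) * cexp (-(2+t*I)*u) := by
      rw [← Complex.exp_add]; ring_nf
    rw [this, Gr]
    field_simp
  have i0 : ∀ t : ℝ, _ := fun t => (lap_intC 0 ((2+t*I)-ρ) (by simp; linarith)).const_mul (1/ρ^4)
  have i1 : ∀ t : ℝ, _ := fun t => (lap_intC 0 (2+t*I) (by simp)).const_mul (1/ρ^4)
  have i2 : ∀ t : ℝ, _ := fun t => (lap_intC 1 (2+t*I) (by simp)).const_mul (1/ρ^3)
  have i3 : ∀ t : ℝ, _ := fun t => (lap_intC 2 (2+t*I) (by simp)).const_mul (1/(2*ρ^2))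
  have i4 : ∀ t : ℝ, _ := fun t => (lap_intC 3 (2+t*I) (by simp)).const_mul (1/(6*ρ))
  have hgc : Continuous (Gr ρ) := by unfold Gr; fun_prop
  refine JJ.mk' (Gr ρ) (fun s => 1/(s-ρ)) hgc ?_ (by simp [Gr]) ?_ (1/(2-ρ.re)) ?_ ?_
  · have := ((((i0 0).sub (i1 0)).sub (i2 0)).sub (i3 0)).sub (i4 0)
    exact this.congr (ae_of_all _ fun u => by
      have e := e1 0 u
      simp only [Pi.sub_apply]
      rw [← e]; simp)
  · intro t
    simp only [e1]
    rw [integral_sub ((((i0 t).sub' (i1 t)).sub' (i2 t)).sub' (i3 t)) (i4 t),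
      integral_sub (((i0 t).sub' (i1 t)).sub' (i2 t)) (i3 t),
      integral_sub ((i0 t).sub' (i1 t)) (i2 t),
      integral_sub (i0 t) (i1 t)]
    simp only [integral_const_mul]
    rw [lap_pow 0 _ (by simp; linarith), lap_pow 0 _ (by simp), lap_pow 1 _ (by simp),
      lap_pow 2 _ (by simp), lap_pow 3 _ (by simp)]
    have a := line_ne t
    have b := hne t
    generalize (2+t*I : ℂ) = s at *
    norm_num [Nat.factorial]
    field_simp
    ring
  · refine Continuous.div (by fun_prop) (by fun_prop) hne
  · intro t
    rw [norm_div, norm_one]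
    exact one_div_le_one_div_of_le (by linarith) (hre t)
end

section
open Complex Metric MeasureTheory Set Filter Topology
open ArithmeticFunction (vonMangoldt)

noncomputable def PP (u : ℝ) : ℝ := (max u 0)^3/6

noncomputable def FF (n : ℕ) (s : ℂ) : ℂ :=
  (1/(s-1) + (-(Real.log Real.pi : ℂ)/2 + (Real.log n : ℂ)/2) * 1)
   + ((-1) * ∑ k ∈ Finset.range (n+1), 1/(s - (-2*((k:ℂ)+1)))
   + (-1/2) * ((ZZ n).map (fun ρ => 1/(s-(1/2+ρ)) + 1/(s-(1/2-ρ)))).sum)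

noncomputable def EE (n : ℕ) (u : ℝ) : ℂ :=
  (Gr 1 (max u 0) + (-(Real.log Real.pi : ℂ)/2 + (Real.log n : ℂ)/2) * (((max u 0 : ℝ):ℂ)^3/6))
   + ((-1) * ∑ k ∈ Finset.range (n+1), Gr (-2*((k:ℂ)+1)) (max u 0)
   + (-1/2) * ((ZZ n).map (fun ρ => Gr (1/2+ρ) (max u 0) + Gr (1/2-ρ) (max u 0))).sum)

theorem half_ne (ρ : ℂ) (h : |ρ.re| < 1/2) : 1/2 + ρ ≠ 0 ∧ 1/2 - ρ ≠ 0 := by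
  have := abs_lt.1 h
  constructor
  · intro e; have := congrArg Complex.re e; simp at this; linarith
  · intro e; have := congrArg Complex.re e; simp at this; linarith

theorem JJ_FF (n : ℕ) : JJ (FF n) (EE n) := by
  refine JJ.add (JJ.add (JJ_inv 1 (by norm_num) (by norm_num)) (JJ_one.const_mul _)) (JJ.add ?_ ?_)
  · refine JJ.const_mul (JJ.finset _ (fun k s => 1/(s - (-2*((k:ℂ)+1)))) (fun k u => Gr (-2*((k:ℂ)+1)) (max u 0)) ?_) _
    intro k _
    refine JJ_inv _ ?_ ?_
    · have : ((k:ℂ)+1) ≠ 0 := by exact_mod_cast Nat.succ_ne_zero k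
      simpa using this
    · have : (0:ℝ) ≤ k := by positivity
      simp; linarith
  · refine JJ.const_mul (JJ.list _ (fun ρ s => 1/(s-(1/2+ρ)) + 1/(s-(1/2-ρ)))
      (fun ρ u => Gr (1/2+ρ) (max u 0) + Gr (1/2-ρ) (max u 0)) ?_) _
    intro ρ hρ
    have h := XiF_zero_re ρ (ZZ_zero n ρ hρ)
    have h' := abs_lt.1 h
    exact (JJ_inv _ (half_ne ρ h).1 (by simp; linarith)).add (JJ_inv _ (half_ne ρ h).2 (by simp; linarith))

theorem zsum_eq (n : ℕ) (s : ℂ) : zsum (ZZ n) (s-1/2) =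
    (1/2) * ((ZZ n).map (fun ρ => 1/(s-(1/2+ρ)) + 1/(s-(1/2-ρ)))).sum := by
  rw [zsum, ← List.sum_map_mul_left]
  congr 1
  refine List.map_congr_left fun ρ _ => ?_
  rw [show s - 1/2 - ρ = s - (1/2+ρ) by ring, show s - 1/2 + ρ = s - (1/2-ρ) by ring]
  ring

theorem FF_eq (n : ℕ) (s : ℂ) : FF n s = 1/(s-1) - (Real.log Real.pi : ℂ)/2
    + ((Real.log n : ℂ) - ∑ k ∈ Finset.range (n+1), 1/((s/2+1)+k))/2 - zsum (ZZ n) (s-1/2) := by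
  rw [zsum_eq, FF]
  have : ∑ k ∈ Finset.range (n+1), 1/((s/2+1)+k) = 2 * ∑ k ∈ Finset.range (n+1), 1/(s - (-2*((k:ℂ)+1))) := by
    rw [Finset.mul_sum]
    refine Finset.sum_congr rfl fun k _ => ?_
    rw [show s - (-2*((k:ℂ)+1)) = 2 * ((s/2+1)+k) by ring]
    rw [one_div, one_div, mul_inv]; ring
  rw [this]
  ring

theorem FF_tendsto (t : ℝ) : Tendsto (fun n => FF n (2+t*I)) atTop (𝓝 (-logDeriv riemannZeta (2+t*I))) := by
  rw [XiF_logDeriv _ (by simp)]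
  simp only [FF_eq]
  refine ((tendsto_const_nhds).add ((digamma_tendsto _ (by simp)).div_const 2)).sub
    (ZZ_tendsto _ (XiF_ne_of_re _ (by simp; norm_num)))

theorem zterm_bound (t : ℝ) (ρ : ℂ) (hρ : |ρ.re| < 1/2) (h4 : 4 ≤ |ρ.im|) :
    ‖(1 / ((2+t*I - 1/2) - ρ) + 1 / ((2+t*I-1/2) + ρ)) / 2‖ ≤ 2.2 * (1+t^2) * (1/ρ.im^2) := by
  have hr := abs_lt.1 hρ
  set z : ℂ := 2+t*I - 1/2 with hz
  have zr : z.re = 3/2 := by simp [hz]; norm_num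
  have zi : z.im = t := by simp [hz]
  set g := ρ.im with hg
  have hg2 : 0 < g^2 := by
    have : 0 < |g| := by linarith
    have := abs_pos.1 this
    positivity
  have n1 : 1 + (t-g)^2 ≤ ‖z-ρ‖^2 := by
    rw [← Complex.normSq_eq_norm_sq, Complex.normSq_apply]
    simp only [Complex.sub_re, Complex.sub_im, zr, zi]
    nlinarith
  have n2 : 1 + (t+g)^2 ≤ ‖z+ρ‖^2 := by
    rw [← Complex.normSq_eq_norm_sq, Complex.normSq_apply]
    simp only [Complex.add_re, Complex.add_im, zr, zi]
    nlinarith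
  have n3 : ‖z‖^2 ≤ 9/4 * (1+t^2) := by
    rw [← Complex.normSq_eq_norm_sq, Complex.normSq_apply, zr, zi]
    nlinarith [sq_nonneg t]
  have p1 : 0 < ‖z-ρ‖ := by
    by_contra h
    have : ‖z-ρ‖ = 0 := le_antisymm (not_lt.1 h) (norm_nonneg _)
    rw [this] at n1; nlinarith [sq_nonneg (t-g)]
  have p2 : 0 < ‖z+ρ‖ := by
    by_contra h
    have : ‖z+ρ‖ = 0 := le_antisymm (not_lt.1 h) (norm_nonneg _)
    rw [this] at n2; nlinarith [sq_nonneg (t+g)]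
  have e : (1 / (z - ρ) + 1 / (z + ρ)) / 2 = z / ((z-ρ)*(z+ρ)) := by
    have a := norm_pos_iff.1 p1; have b := norm_pos_iff.1 p2
    field_simp; ring
  rw [e, norm_div, norm_mul]
  rw [div_le_iff₀ (by positivity)]
  have key : (g^2)^2 ≤ 2 * (1+t^2) * (‖z-ρ‖*‖z+ρ‖)^2 := by
    have h1 : (1 + (t-g)^2) * (1+(t+g)^2) ≤ (‖z-ρ‖*‖z+ρ‖)^2 := by
      rw [mul_pow]; exact mul_le_mul n1 n2 (by positivity) (by positivity)
    have h2 : (g^2)^2 ≤ 2*(1+t^2) * ((1 + (t-g)^2) * (1+(t+g)^2)) := by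
      have e1 : (1 + (t-g)^2) * (1+(t+g)^2) = 1 + 2*t^2 + 2*g^2 + (t^2-g^2)^2 := by ring
      rw [e1]
      nlinarith [sq_nonneg (2*t^2-g^2), sq_nonneg t, sq_nonneg g, mul_nonneg (sq_nonneg t) (sq_nonneg g), mul_nonneg (sq_nonneg t) (sq_nonneg (t^2-g^2)), sq_nonneg (t^2)]
    refine h2.trans ?_
    gcongr
  have : (‖z‖ * g^2)^2 ≤ (2.2 * (1+t^2) * (‖z-ρ‖*‖z+ρ‖))^2 := by
    rw [mul_pow]
    calc _ ≤ (9/4*(1+t^2)) * (2 * (1+t^2) * (‖z-ρ‖*‖z+ρ‖)^2) := by gcongr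
      _ = 4.5 * ((1+t^2)*(‖z-ρ‖*‖z+ρ‖))^2 := by ring
      _ ≤ 4.84 * ((1+t^2)*(‖z-ρ‖*‖z+ρ‖))^2 := by gcongr; norm_num
      _ = _ := by ring
  have := abs_le_of_sq_le_sq this (by positivity)
  have := (abs_le.1 this).2
  rw [mul_assoc _ (1/g^2), mul_comm (1/g^2), ← mul_assoc, mul_one_div, le_div_iff₀ hg2]
  exact this

theorem list_norm_le (Z : List ℂ) (f : ℂ → ℂ) : ‖(Z.map f).sum‖ ≤ (Z.map (fun ρ => ‖f ρ‖)).sum := by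
  induction Z with
  | nil => simp
  | cons a Z ih => simp only [List.map_cons, List.sum_cons]; exact (norm_add_le _ _).trans (by gcongr)

theorem sum_tele (n : ℕ) : ∑ k ∈ Finset.range n, 1/(((k:ℝ)+1)*(k+2)) = 1 - 1/((n:ℝ)+1) := by
  induction n with
  | zero => simp
  | succ n ih => rw [Finset.sum_range_succ, ih]; push_cast; field_simp; ring

theorem FF_bound : ∃ C : ℝ, ∀ᶠ n in atTop, ∀ t : ℝ, ‖FF n (2+t*I)‖ ≤ C * (1+t^2) := by
  have h1 := (digamma_tendsto 1 (by norm_num)).norm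
  have h2 := h1.eventually (gt_mem_nhds (lt_add_one ‖digamma 1‖))
  set D := ‖digamma 1‖ + 1 with hD
  have hD0 : 0 ≤ D := by positivity
  set l := ‖(Real.log Real.pi : ℂ)/2‖ with hl
  have hl0 : 0 ≤ l := norm_nonneg _
  refine ⟨1 + l + (D+2)/2 + 2.2*0.12, ?_⟩
  filter_upwards [h2, zz_sum_le] with n hn hz t
  rw [FF_eq]
  have a1 : ‖1/((2+t*I : ℂ)-1)‖ ≤ 1 := by
    rw [norm_div, norm_one]
    have : 1 ≤ ‖(2+t*I : ℂ)-1‖ := by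
      refine le_trans ?_ (Complex.re_le_norm _); simp; norm_num
    exact div_le_one_of_le₀ this (norm_nonneg _)
  have a3 : ‖zsum (ZZ n) (2+t*I-1/2)‖ ≤ 2.2*0.12 * (1+t^2) := by
    rw [zsum]
    refine (list_norm_le _ _).trans ((list_sum_le _ _ (fun ρ => 2.2 * (1+t^2) * (1/ρ.im^2)) fun ρ hρ =>
      zterm_bound t ρ (XiF_zero_re ρ (ZZ_zero n ρ hρ)) (zero_im_ge ρ (ZZ_zero n ρ hρ))).trans ?_)
    rw [List.sum_map_mul_left]
    calc _ ≤ 2.2 * (1+t^2) * 0.12 := by gcongr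
      _ = _ := by ring
  have a2 : ‖(Real.log n : ℂ) - ∑ k ∈ Finset.range (n+1), 1/(((2+t*I)/2+1)+(k:ℂ))‖ ≤ (D+2)*(1+t^2) := by
    set w : ℂ := (2+t*I)/2+1 with hw
    have wr : w.re = 2 := by simp [hw]; norm_num
    have wn : ‖w-1‖ ≤ 2*(1+t^2) := by
      refine (Complex.norm_le_abs_re_add_abs_im _).trans ?_
      have : (w-1).im = t/2 := by simp [hw]
      rw [this, Complex.sub_re, wr, abs_div]
      norm_num
      nlinarith [sq_abs t, sq_nonneg (|t|-1)]
    have e : (Real.log n : ℂ) - ∑ k ∈ Finset.range (n+1), 1/(w+(k:ℂ)) =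
      ((Real.log n : ℂ) - ∑ k ∈ Finset.range (n+1), 1/((1:ℂ)+k)) + ∑ k ∈ Finset.range (n+1), (1/((1:ℂ)+k) - 1/(w+(k:ℂ))) := by
      rw [Finset.sum_sub_distrib]; ring
    rw [e]
    have b : ‖∑ k ∈ Finset.range (n+1), (1/((1:ℂ)+k) - 1/(w+(k:ℂ)))‖ ≤ ‖w-1‖ := by
      calc _ ≤ ∑ k ∈ Finset.range (n+1), ‖w-1‖ * (1/(((k:ℝ)+1)*(k+2))) := by
            refine norm_sum_le_of_le _ fun k _ => ?_
            have k0 : (0:ℝ) ≤ k := by positivity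
            have q1 : (1:ℂ)+k ≠ 0 := by
              intro h; have := congrArg Complex.re h; simp at this; linarith
            have q2r : (k:ℝ)+2 ≤ ‖w+k‖ := by
              refine le_trans ?_ (Complex.re_le_norm _); simp [wr]; linarith
            have q2 : w+k ≠ 0 := by rw [← norm_pos_iff]; linarith
            have q1n : ‖(1:ℂ)+k‖ = k+1 := by
              rw [show (1:ℂ)+k = ((k+1:ℝ):ℂ) by push_cast; ring, Complex.norm_real, Real.norm_of_nonneg (by linarith)]
            have : 1/((1:ℂ)+k) - 1/(w+(k:ℂ)) = (w-1)/((1+k)*(w+k)) := by field_simp; ring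
            rw [this, norm_div, norm_mul, q1n, mul_one_div]
            gcongr
        _ = ‖w-1‖ * (1 - 1/(((n+1:ℕ):ℝ)+1)) := by rw [← Finset.mul_sum, sum_tele]
        _ ≤ ‖w-1‖ * 1 := by
            gcongr
            have : 0 ≤ 1/(((n+1:ℕ):ℝ)+1) := by positivity
            linarith
        _ = _ := mul_one _
    refine (norm_add_le _ _).trans ?_
    nlinarith [sq_nonneg t]
  refine (norm_sub_le _ _).trans ?_
  have c1 := norm_add_le (1/((2+t*I : ℂ)-1) - (Real.log Real.pi : ℂ)/2) (((Real.log n : ℂ) - ∑ k ∈ Finset.range (n+1), 1/(((2+t*I)/2+1)+(k:ℂ)))/2)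
  have c2 := norm_sub_le (1/((2+t*I : ℂ)-1)) ((Real.log Real.pi : ℂ)/2)
  rw [norm_div _ (2:ℂ)] at c1
  rw [show ‖(2:ℂ)‖ = 2 by simp] at c1
  rw [← hl] at c2
  nlinarith [sq_nonneg t, mul_nonneg hl0 (sq_nonneg t)]

theorem FF_meas (n : ℕ) : AEStronglyMeasurable (fun t : ℝ => FF n (2+t*I)) volume := by
  have h := (JJ_FF n 0).1.1
  have : (fun t : ℝ => FF n (2+t*I)) = fun t : ℝ => (FF n (2+t*I) * kk 0 t) * (2+t*I)^4 := by
    ext t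
    have := line_ne t
    simp only [kk]; field_simp; simp
  rw [this]
  exact h.mul (Continuous.aestronglyMeasurable (by fun_prop))

theorem EE_tendsto (u : ℝ) : Tendsto (fun n => 2 * Real.pi * EE n u) atTop
    (𝓝 (∫ t : ℝ, (-logDeriv riemannZeta (2+t*I)) * kk u t)) := by
  obtain ⟨C, hC⟩ := FF_bound
  have := tendsto_integral_filter_of_dominated_convergence (μ := volume) (l := atTop)
    (F := fun n (t:ℝ) => FF n (2+t*I) * kk u t) (f := fun t : ℝ => (-logDeriv riemannZeta (2+t*I)) * kk u t)
    (fun t => C * Real.exp (2*u) * (1+t^2) / (4+t^2)^2)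
    (Eventually.of_forall fun n => (FF_meas n).mul (kk_cont u).aestronglyMeasurable)
    (by
      filter_upwards [hC] with n hn
      refine ae_of_all _ fun t => ?_
      rw [norm_mul, norm_kk]
      calc _ ≤ C * (1+t^2) * (Real.exp (2*u) / (4+t^2)^2) := by gcongr; exact hn t
        _ = _ := by ring)
    (ker_int _)
    (ae_of_all _ fun t => (FF_tendsto t).mul_const _)
  refine this.congr fun n => ?_
  exact (JJ_FF n u).2

theorem prime_side (u : ℝ) : HasSum (fun n : ℕ => vonMangoldt n * PP (u - Real.log n))
    ((∫ t : ℝ, (-logDeriv riemannZeta (2+t*I)) * kk u t) / (2*Real.pi)).re := by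
  have hpi : (2*Real.pi : ℂ) ≠ 0 := by exact_mod_cast (by positivity : (2*Real.pi) ≠ 0)
  have cp : ∀ (n : ℕ) (t : ℝ), (vonMangoldt n : ℂ) * (n:ℂ)^(-(2+t*I)) * kk u t =
      (vonMangoldt n : ℂ) * (1 * kk (u - Real.log n) t) := by
    intro n t
    rcases Nat.eq_zero_or_pos n with rfl | hn
    · simp
    · rw [Complex.cpow_def_of_ne_zero (by exact_mod_cast hn.ne'), kk, kk, mul_assoc, mul_div_assoc', ← Complex.exp_add,
        ← Complex.natCast_log]
      push_cast
      congr 1; rw [one_mul]; congr 2; ring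
  have cont : ∀ n : ℕ, Integrable (fun t : ℝ => (vonMangoldt n : ℂ) * (n:ℂ)^(-(2+t*I)) * kk u t) := by
    intro n; simp only [cp]
    exact ((JJ_one (u - Real.log n)).1).const_mul _
  have hsum : Summable (fun n : ℕ => ∫ t : ℝ, ‖(vonMangoldt n : ℂ) * (n:ℂ)^(-(2+t*I)) * kk u t‖) := by
    have h := (vm_hasSum 2 (by norm_num)).summable.norm.mul_right (∫ t, ‖kk u t‖)
    refine h.congr fun n => ?_
    rw [← integral_const_mul]
    congr 1; ext t
    simp only [norm_mul]
    congr 2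
    rcases Nat.eq_zero_or_pos n with rfl | hn
    · rw [Nat.cast_zero, Complex.zero_cpow (by norm_num), Complex.zero_cpow (neg_ne_zero.2 (line_ne t))]
    · rw [Complex.norm_natCast_cpow_of_pos hn, Complex.norm_natCast_cpow_of_pos hn]; simp
  have H := hasSum_integral_of_summable_integral_norm cont hsum
  have e : ∀ t : ℝ, ∑' n : ℕ, (vonMangoldt n : ℂ) * (n:ℂ)^(-(2+t*I)) * kk u t = (-logDeriv riemannZeta (2+t*I)) * kk u t :=
    fun t => ((vm_hasSum (2+t*I) (by simp)).mul_right (kk u t)).tsum_eq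
  simp only [e] at H
  have H2 := hasSum_re (H.div_const (2*Real.pi : ℂ))
  convert! H2 using 1
  ext n
  simp only [cp]
  rw [integral_const_mul, (JJ_one (u - Real.log n)).2, mul_left_comm, mul_div_cancel_left₀ _ hpi]
  have : (vonMangoldt n : ℂ) * (((max (u - Real.log n) 0 : ℝ):ℂ)^3/6) = ((vonMangoldt n * PP (u - Real.log n) : ℝ):ℂ) := by
    simp only [PP]; push_cast; ring
  simp only [this, Complex.ofReal_re]
end

section
open Complex Metric MeasureTheory Set Filter Topology
open ArithmeticFunction (vonMangoldt)

noncomputable def DR (E : ℝ → ℝ) (h y : ℝ) : ℝ := (E (y+3*h) - 3*E (y+2*h) + 3*E (y+h) - E y)/h^3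
noncomputable def DC (E : ℝ → ℂ) (h y : ℝ) : ℂ := (E (y+3*h) - 3*E (y+2*h) + 3*E (y+h) - E y)/(h:ℂ)^3

theorem DC_re (E : ℝ → ℂ) (h y : ℝ) : (DC E h y).re = DR (fun u => (E u).re) h y := by
  rw [DC, DR, ← Complex.ofReal_pow, Complex.div_ofReal_re]
  simp

theorem DC_add (E F : ℝ → ℂ) (h y : ℝ) : DC (fun u => E u + F u) h y = DC E h y + DC F h y := by
  simp only [DC]; ring
theorem DC_mul (c : ℂ) (E : ℝ → ℂ) (h y : ℝ) : DC (fun u => c * E u) h y = c * DC E h y := by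
  simp only [DC]; ring
theorem DC_list (Z : List ℂ) (E : ℂ → ℝ → ℂ) (h y : ℝ) : DC (fun u => (Z.map (fun ρ => E ρ u)).sum) h y
    = (Z.map (fun ρ => DC (E ρ) h y)).sum := by
  induction Z with
  | nil => simp [DC]
  | cons a Z ih => simp only [List.map_cons, List.sum_cons, DC_add, ih]
theorem DC_finset (Z : Finset ℕ) (E : ℕ → ℝ → ℂ) (h y : ℝ) : DC (fun u => ∑ k ∈ Z, E k u) h y
    = ∑ k ∈ Z, DC (E k) h y := by
  classical
  induction Z using Finset.induction_on with
  | empty => simp [DC]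
  | insert a Z ha ih => simp only [Finset.sum_insert ha, DC_add, ih]

noncomputable def TT (h y : ℝ) (r : ℂ) : ℂ := cexp (r*y) * (cexp (r*h) - 1)^3/((h:ℂ)^3*r^4) - 1/r

theorem DC_Gr (h y : ℝ) (hh : 0 < h) (hy : 0 < y) (r : ℂ) (hr : r ≠ 0) :
    DC (fun u => Gr r (max u 0)) h y = TT h y r := by
  have h3 : (h:ℂ) ≠ 0 := by exact_mod_cast hh.ne'
  have e : ∀ k : ℕ, cexp (r * (k*h)) = cexp (r*h)^k := by
    intro k; rw [← Complex.exp_nat_mul]; ring_nf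
  simp only [DC]
  rw [max_eq_left (by positivity), max_eq_left (by positivity), max_eq_left (by positivity), max_eq_left hy.le]
  simp only [Gr, TT]
  push_cast
  have e2 := e 2; have e3 := e 3
  push_cast at e2 e3
  rw [mul_add r (y:ℂ) (3*h), mul_add r (y:ℂ) (2*h), mul_add r (y:ℂ) h, Complex.exp_add, Complex.exp_add, Complex.exp_add, e2, e3]
  generalize cexp (r*h) = a
  generalize cexp (r*y) = b
  field_simp
  ring

theorem DC_P (h y : ℝ) (hh : 0 < h) (hy : 0 < y) : DC (fun u => ((max u 0 : ℝ):ℂ)^3/6) h y = 1 := by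
  have h3 : (h:ℂ) ≠ 0 := by exact_mod_cast hh.ne'
  simp only [DC]
  rw [max_eq_left (by positivity), max_eq_left (by positivity), max_eq_left (by positivity), max_eq_left hy.le]
  push_cast
  field_simp
  ring

theorem DR_PP_nonneg (h v : ℝ) (hh : 0 < h) : 0 ≤ DR PP h v := by
  rw [DR]
  refine div_nonneg ?_ (by positivity)
  simp only [PP]
  rcases le_or_gt 0 v with h0 | h0
  · rw [max_eq_left (by positivity), max_eq_left (by positivity), max_eq_left (by positivity), max_eq_left h0]
    nlinarith [pow_pos hh 3]
  rw [max_eq_right h0.le]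
  rcases le_or_gt 0 (v+h) with h1 | h1
  · rw [max_eq_left (by linarith), max_eq_left (by linarith), max_eq_left h1]
    have : 0 ≤ -v := by linarith
    have h5 : (-v)^3 ≤ h^3 := pow_le_pow_left₀ this (by linarith) 3
    nlinarith [pow_pos hh 3]
  rw [max_eq_right h1.le]
  rcases le_or_gt 0 (v+2*h) with h2 | h2
  · rw [max_eq_left (by linarith), max_eq_left (by linarith)]
    obtain ⟨a, rfl⟩ : ∃ a, v = a - 2*h := ⟨v+2*h, by ring⟩
    have a0 : 0 ≤ a := by linarith
    have a1 : 0 ≤ h - a := by linarith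
    nlinarith [pow_pos hh 3, mul_nonneg (mul_nonneg a0 a0) a1, mul_nonneg a0 (mul_pos hh hh).le, mul_nonneg (mul_nonneg a0 a0) hh.le]
  rw [max_eq_right h2.le]
  have : 0 ≤ max (v+3*h) 0 := le_max_right _ _
  have := pow_nonneg this 3
  linarith

theorem DR_PP_one (h v : ℝ) (hh : 0 < h) (hv : 0 ≤ v) : DR PP h v = 1 := by
  simp only [DR, PP]
  rw [max_eq_left (by positivity), max_eq_left (by positivity), max_eq_left (by positivity), max_eq_left hv]
  field_simp
  ring

theorem TT_main (h y M : ℝ) (hh : 0 < h) (hy : 0 < y) (ρ : ℂ) (hρ : XiF ρ = 0)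
    (hM : Real.exp (-y*(1/2-|ρ.re|))/ρ.im^2 ≤ M) :
    -(1/2) * (TT h y (1/2+ρ) + TT h y (1/2-ρ)).re ≤
      (1/2 + 1/2 * ((1+Real.exp h)/h)^3 * (Real.exp y * (M + Real.exp (-y/2)/16))) * (1/ρ.im^2) := by
  have hb := XiF_zero_re ρ hρ
  have hb' := abs_lt.1 hb
  have h4 := zero_im_ge ρ hρ
  have g16 : 16 ≤ ρ.im^2 := by rw [← sq_abs]; nlinarith
  set g := ρ.im with hg
  have B : ∀ r : ℂ, r.re ≤ 1 → r ≠ 0 → r.im^2 = g^2 → ‖cexp (r*y) * (cexp (r*h) - 1)^3/((h:ℂ)^3*r^4)‖ ≤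
      ((1+Real.exp h)/h)^3 * Real.exp (r.re*y) / (g^2)^2 := by
    intro r hr1 hr0 hri
    rw [norm_div, norm_mul, norm_mul, norm_pow, norm_pow, norm_pow, Complex.norm_exp, Complex.norm_real,
      Real.norm_of_nonneg hh.le]
    have e1 : ‖cexp (r*h) - 1‖ ≤ 1 + Real.exp h := by
      refine (norm_sub_le _ _).trans ?_
      rw [Complex.norm_exp, norm_one, add_comm]
      gcongr
      simp; nlinarith
    have e2 : (g^2)^2 ≤ ‖r‖^4 := by
      have : g^2 ≤ ‖r‖^2 := by
        rw [← hri, ← Complex.normSq_eq_norm_sq, Complex.normSq_apply]; nlinarith [sq_nonneg r.re]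
      calc (g^2)^2 ≤ (‖r‖^2)^2 := by gcongr
        _ = _ := by ring
    have e3 : (r*y).re = r.re*y := by simp
    rw [e3]
    calc _ ≤ Real.exp (r.re*y) * (1+Real.exp h)^3 / (h^3 * (g^2)^2) := by gcongr
      _ = _ := by field_simp
  have hn := half_ne ρ hb
  have r1 : (1/2+ρ).re = 1/2+ρ.re := by simp
  have r2 : (1/2-ρ).re = 1/2-ρ.re := by simp
  have i1 : (1/2+ρ).im = g := by simp [hg]
  have i2 : (1/2-ρ).im = -g := by simp [hg]
  have B1 := B (1/2+ρ) (by rw [r1]; linarith) hn.1 (by rw [i1])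
  have B2 := B (1/2-ρ) (by rw [r2]; linarith) hn.2 (by rw [i2]; ring)
  have re1 : (1/(1/2+ρ)).re ≤ (1/2+ρ.re)/g^2 := by
    rw [one_div, Complex.inv_re, r1, Complex.normSq_apply, r1, i1]
    have : 0 < 1/2+ρ.re := by linarith
    gcongr; nlinarith
  have re2 : (1/(1/2-ρ)).re ≤ (1/2-ρ.re)/g^2 := by
    rw [one_div, Complex.inv_re, r2, Complex.normSq_apply, r2, i2]
    have : 0 < 1/2-ρ.re := by linarith
    gcongr; nlinarith
  have N1 := (abs_le.1 (Complex.abs_re_le_norm (cexp ((1/2+ρ)*y) * (cexp ((1/2+ρ)*h) - 1)^3/((h:ℂ)^3*(1/2+ρ)^4)))).1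
  have N2 := (abs_le.1 (Complex.abs_re_le_norm (cexp ((1/2-ρ)*y) * (cexp ((1/2-ρ)*h) - 1)^3/((h:ℂ)^3*(1/2-ρ)^4)))).1
  have ex : Real.exp ((1/2+ρ.re)*y) + Real.exp ((1/2-ρ.re)*y) ≤
      Real.exp y * (Real.exp (-y*(1/2-|ρ.re|)) + Real.exp (-y/2)) := by
    rw [mul_add, ← Real.exp_add, ← Real.exp_add]
    rcases abs_cases ρ.re with ⟨ha, hc⟩ | ⟨ha, hc⟩
    · rw [ha]
      refine add_le_add (Real.exp_le_exp.2 (by nlinarith)) (Real.exp_le_exp.2 (by nlinarith))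
    · rw [ha, add_comm]
      refine add_le_add (Real.exp_le_exp.2 (by nlinarith)) (Real.exp_le_exp.2 (by nlinarith))
  rw [r1] at B1; rw [r2] at B2
  set A := ((1+Real.exp h)/h)^3 with hA
  have A0 : 0 < A := by positivity
  have sm : (Real.exp (-y*(1/2-|ρ.re|)) + Real.exp (-y/2))/g^2 ≤ M + Real.exp (-y/2)/16 := by
    rw [add_div]
    gcongr
  have tot : A * Real.exp ((1/2+ρ.re)*y) / (g^2)^2 + A * Real.exp ((1/2-ρ.re)*y) / (g^2)^2 ≤
      A * (Real.exp y * (M + Real.exp (-y/2)/16)) * (1/g^2) := by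
    calc _ = A * (Real.exp ((1/2+ρ.re)*y) + Real.exp ((1/2-ρ.re)*y)) / (g^2)^2 := by ring
      _ ≤ A * (Real.exp y * (Real.exp (-y*(1/2-|ρ.re|)) + Real.exp (-y/2))) / (g^2)^2 := by gcongr
      _ = A * (Real.exp y * ((Real.exp (-y*(1/2-|ρ.re|)) + Real.exp (-y/2))/g^2)) * (1/g^2) := by field_simp
      _ ≤ _ := by gcongr
  have res : (1/2+ρ.re)/g^2 + (1/2-ρ.re)/g^2 = 1/g^2 := by ring
  simp only [TT, Complex.add_re, Complex.sub_re]
  have fin : (1/2 + 1/2 * A * (Real.exp y * (M + Real.exp (-y/2)/16))) * (1/g^2) =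
    1/2*(1/g^2) + 1/2 * (A * (Real.exp y * (M + Real.exp (-y/2)/16)) * (1/g^2)) := by ring
  rw [fin]
  linarith

theorem TT_triv (h y : ℝ) (hh : 0 < h) (hy : 1 ≤ y) (k : ℕ) :
    -(TT h y (-2*((k:ℂ)+1))).re ≤ -(1/(2*((k:ℝ)+1))) + 1/2*(1/(((k:ℝ)+1)*(k+2))) := by
  set a : ℝ := 2*((k:ℝ)+1) with ha
  have a0 : 0 < a := by positivity
  have e : TT h y (-2*((k:ℂ)+1)) = ((Real.exp (-a*y) * (Real.exp (-a*h)-1)^3/(h^3*a^4) + 1/a : ℝ) : ℂ) := by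
    have : (-2*((k:ℂ)+1)) = ((-a : ℝ):ℂ) := by rw [ha]; push_cast; ring
    rw [this, TT]
    push_cast
    rw [show (-(a:ℂ))^4 = (a:ℂ)^4 by ring]
    have : (a:ℂ) ≠ 0 := by exact_mod_cast a0.ne'
    rw [show (1:ℂ)/(-a) = -(1/a) by field_simp]
    ring
  rw [e, Complex.ofReal_re]
  have b1 : 1 - Real.exp (-a*h) ≤ a*h := by have := Real.add_one_le_exp (-a*h); linarith
  have b0 : 0 ≤ 1 - Real.exp (-a*h) := by
    have : Real.exp (-a*h) ≤ 1 := Real.exp_le_one_iff.2 (by nlinarith [mul_pos a0 hh])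
    linarith
  have b2 : -(Real.exp (-a*h)-1)^3 ≤ (a*h)^3 := by
    calc _ = (1 - Real.exp (-a*h))^3 := by ring
      _ ≤ _ := by gcongr
  have b3 : Real.exp (-a*y) ≤ 1/(a+1) := by
    rw [le_div_iff₀ (by linarith), neg_mul, Real.exp_neg, inv_mul_le_iff₀ (Real.exp_pos _), mul_one]
    have := Real.add_one_le_exp (a*y)
    nlinarith
  have b4 : -(Real.exp (-a*y) * (Real.exp (-a*h)-1)^3/(h^3*a^4)) ≤ 1/(a+1)*(1/a) := by
    calc _ = Real.exp (-a*y) * (-(Real.exp (-a*h)-1)^3) /(h^3*a^4) := by ring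
      _ ≤ 1/(a+1) * (a*h)^3/(h^3*a^4) := by
          have : 0 ≤ -(Real.exp (-a*h)-1)^3 := by
            have := pow_nonneg b0 3
            linarith [show -(Real.exp (-a*h)-1)^3 = (1 - Real.exp (-a*h))^3 by ring]
          gcongr
      _ = _ := by field_simp
  have b5 : 1/(a+1)*(1/a) ≤ 1/2*(1/(((k:ℝ)+1)*(k+2))) := by
    rw [ha, one_div_mul_one_div, one_div_mul_one_div]
    apply one_div_le_one_div_of_le (by positivity)
    have : (0:ℝ) ≤ k := by positivity
    nlinarith
  linarith

theorem psi_explicit (y h M : ℝ) (hy : 1 ≤ y) (hh : 0 < h)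
    (hM : ∀ ρ, XiF ρ = 0 → Real.exp (-y*(1/2-|ρ.re|))/ρ.im^2 ≤ M) (hM0 : 0 ≤ M) :
    Chebyshev.psi (Real.exp y) ≤ Real.exp y * (((Real.exp h - 1)/h)^3 +
      0.06 * ((1+Real.exp h)/h)^3 * (M + Real.exp (-y/2)/16)) := by
  have hy0 : 0 < y := by linarith
  set s : ℝ → ℝ := fun u => ((∫ t : ℝ, (-logDeriv riemannZeta (2+t*I)) * kk u t) / (2*Real.pi)).re with hs
  have H : HasSum (fun n : ℕ => vonMangoldt n * DR PP h (y - Real.log n)) (DR s h y) := by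
    have a := prime_side y
    have b := prime_side (y+h)
    have c := prime_side (y+2*h)
    have d := prime_side (y+3*h)
    have := (((d.sub (c.mul_left 3)).add (b.mul_left 3)).sub a).div_const (h^3)
    convert! this using 1
    ext n
    simp only [DR]
    rw [show y - Real.log n + 3*h = y+3*h-Real.log n by ring, show y - Real.log n + 2*h = y+2*h-Real.log n by ring,
      show y - Real.log n + h = y+h-Real.log n by ring]
    ring
  have L : Chebyshev.psi (Real.exp y) ≤ DR s h y := by
    rw [Chebyshev.psi]
    refine le_trans (le_of_eq ?_) (sum_le_hasSum (Finset.Ioc 0 ⌊Real.exp y⌋₊) (fun n _ => ?_) H)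
    · refine Finset.sum_congr rfl fun n hn => ?_
      rw [Finset.mem_Ioc] at hn
      rw [DR_PP_one _ _ hh, mul_one]
      have : (n:ℝ) ≤ Real.exp y := (Nat.le_floor_iff (Real.exp_pos _).le).1 hn.2
      have := Real.log_le_log (by exact_mod_cast hn.1) this
      rw [Real.log_exp] at this; linarith
    · exact mul_nonneg ArithmeticFunction.vonMangoldt_nonneg (DR_PP_nonneg _ _ hh)
  refine L.trans ?_
  have hpi : (2*Real.pi : ℂ) ≠ 0 := by exact_mod_cast (by positivity : (2*Real.pi) ≠ 0)
  have T : ∀ u, Tendsto (fun n => (EE n u).re) atTop (𝓝 (s u)) := by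
    intro u
    have := (continuous_re.tendsto _).comp ((EE_tendsto u).div_const (2*Real.pi : ℂ))
    refine this.congr fun n => ?_
    simp only [Function.comp]
    rw [mul_div_cancel_left₀ _ hpi]
  have TD : Tendsto (fun n => (DC (EE n) h y).re) atTop (𝓝 (DR s h y)) := by
    simp only [DC_re, DR]
    exact ((((T _).sub ((T _).const_mul 3)).add ((T _).const_mul 3)).sub (T _)).div_const _
  refine le_of_tendsto TD ?_
  filter_upwards [zz_sum_le, eventually_ge_atTop 1] with n hz hn
  have eq : DC (EE n) h y = (TT h y 1 + (-(Real.log Real.pi : ℂ)/2 + (Real.log n : ℂ)/2) * 1)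
   + ((-1) * ∑ k ∈ Finset.range (n+1), TT h y (-2*((k:ℂ)+1))
   + (-1/2) * ((ZZ n).map (fun ρ => TT h y (1/2+ρ) + TT h y (1/2-ρ))).sum) := by
    unfold EE
    rw [DC_add, DC_add, DC_add, DC_mul, DC_mul, DC_mul, DC_finset, DC_list, DC_Gr h y hh hy0 1 one_ne_zero, DC_P h y hh hy0]
    congr 3
    · refine Finset.sum_congr rfl fun k _ => DC_Gr h y hh hy0 _ ?_
      have : ((k:ℂ)+1) ≠ 0 := by exact_mod_cast Nat.succ_ne_zero k
      simpa using this
    · congr 1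
      refine List.map_congr_left fun ρ hρ => ?_
      have := half_ne ρ (XiF_zero_re ρ (ZZ_zero n ρ hρ))
      rw [DC_add, DC_Gr h y hh hy0 _ this.1, DC_Gr h y hh hy0 _ this.2]
  have T1 : (TT h y 1).re = Real.exp y * ((Real.exp h - 1)/h)^3 - 1 := by
    have : TT h y 1 = ((Real.exp y * ((Real.exp h - 1)/h)^3 - 1 : ℝ):ℂ) := by
      rw [TT]; push_cast; simp; ring
    rw [this, Complex.ofReal_re]
  have T2 : (-(Real.log Real.pi : ℂ)/2 + (Real.log n : ℂ)/2).re = -Real.log Real.pi/2 + Real.log n/2 := by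
    have : (-(Real.log Real.pi : ℂ)/2 + (Real.log n : ℂ)/2) = ((-Real.log Real.pi/2 + Real.log n/2 : ℝ):ℂ) := by push_cast; ring
    rw [this, Complex.ofReal_re]
  have T3 : ((-1) * ∑ k ∈ Finset.range (n+1), TT h y (-2*((k:ℂ)+1))).re ≤ - Real.log n / 2 + 1/2 := by
    have e : ((-1) * ∑ k ∈ Finset.range (n+1), TT h y (-2*((k:ℂ)+1))).re = ∑ k ∈ Finset.range (n+1), -(TT h y (-2*((k:ℂ)+1))).re := by
      rw [neg_one_mul, Complex.neg_re, Complex.re_sum, Finset.sum_neg_distrib]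
    rw [e]
    refine (Finset.sum_le_sum fun k _ => TT_triv h y hh hy k).trans ?_
    rw [Finset.sum_add_distrib, ← Finset.mul_sum, sum_tele, Finset.sum_neg_distrib]
    have h1 := log_add_one_le_harmonic (n+1)
    have h2 : ((harmonic (n+1) : ℚ):ℝ) = 2 * ∑ k ∈ Finset.range (n+1), 1/(2*((k:ℝ)+1)) := by
      rw [harmonic, Finset.mul_sum]; push_cast
      refine Finset.sum_congr rfl fun k _ => ?_
      field_simp
    have h3 : Real.log n ≤ Real.log ((n+1+1 : ℕ):ℝ) := Real.log_le_log (by exact_mod_cast hn) (by push_cast; linarith)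
    have h4 : 0 ≤ 1/(((n+1:ℕ):ℝ)+1) := by positivity
    linarith
  have T4 : ((-1/2) * ((ZZ n).map (fun ρ => TT h y (1/2+ρ) + TT h y (1/2-ρ))).sum).re ≤
      (1/2 + 1/2 * ((1+Real.exp h)/h)^3 * (Real.exp y * (M + Real.exp (-y/2)/16))) * 0.12 := by
    have e : (-1/2 : ℂ) = ((-(1/2) : ℝ):ℂ) := by push_cast; ring
    rw [e, Complex.re_ofReal_mul, list_sum_re, ← List.sum_map_mul_left]
    refine (list_sum_le _ _ _ fun ρ hρ => TT_main h y M hh hy0 ρ (ZZ_zero n ρ hρ) (hM ρ (ZZ_zero n ρ hρ))).trans ?_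
    rw [List.sum_map_mul_left]
    gcongr
  rw [eq, Complex.add_re, Complex.add_re, Complex.add_re, mul_one, T1, T2]
  have lp := log_pi_gt
  nlinarith
end

section
open Complex Metric MeasureTheory Set Filter Topology

theorem log14_bd : 2.6 ≤ Real.log 14 ∧ Real.log 14 ≤ 2.64 := by
  constructor
  · rw [Real.le_log_iff_exp_le (by norm_num)]
    have := Real.exp_one_lt_d9
    have e2 : Real.exp 2.6 ^ 5 = Real.exp 1 ^ 13 := by
      rw [← Real.exp_nat_mul, ← Real.exp_nat_mul]; norm_num
    have : Real.exp 2.6 ^ 5 ≤ 14^5 := by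
      rw [e2]
      calc Real.exp 1 ^ 13 ≤ 2.7182818286^13 := by gcongr
        _ ≤ _ := by norm_num
    exact le_of_pow_le_pow_left₀ (by norm_num) (by norm_num) this
  · rw [Real.log_le_iff_le_exp (by norm_num)]
    have := Real.exp_one_gt_d9
    have e2 : Real.exp 2.64 ^ 25 = Real.exp 1 ^ 66 := by
      rw [← Real.exp_nat_mul, ← Real.exp_nat_mul]; norm_num
    have : (14:ℝ)^25 ≤ Real.exp 2.64 ^ 25 := by
      rw [e2]
      calc _ ≤ (2.7182818283:ℝ)^66 := by norm_num
        _ ≤ _ := by gcongr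
    exact le_of_pow_le_pow_left₀ (by norm_num) (by positivity) this

theorem M_bound (s : ℝ) (hs : 10.15 ≤ s) (ρ : ℂ) (hρ : XiF ρ = 0) :
    Real.exp (-(8.73*s^2)*(1/2-|ρ.re|))/ρ.im^2 ≤ Real.exp (-(2.84+2*s)) := by
  have hz := zero_free ρ hρ
  have h4 := zero_im_ge ρ hρ
  have hl := log14_bd
  have hp : 0 < |ρ.im| := by linarith
  rw [← sq_abs ρ.im, div_le_iff₀ (by positivity)]
  have e : |ρ.im|^2 = Real.exp (2*Real.log |ρ.im|) := by
    rw [two_mul, Real.exp_add, Real.exp_log hp]; ring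
  have key : ∀ q : ℝ, 0 < q → 1/(17.46*q) ≤ 1/2 - |ρ.re| → s^2/(2*q) ≤ 8.73*s^2*(1/2-|ρ.re|) := by
    intro q hq h
    calc s^2/(2*q) = 8.73*s^2*(1/(17.46*q)) := by field_simp; norm_num
      _ ≤ _ := by gcongr
  rcases le_total 14 |ρ.im| with h | h
  · rw [e, ← Real.exp_add]
    apply Real.exp_le_exp.2
    rw [max_eq_left h] at hz
    have hL := Real.log_le_log (by norm_num) h
    set q := Real.log |ρ.im| - 1.42 with hq
    have hq0 : 0 < q := by rw [hq]; linarith [hl.1]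
    have := key q hq0 hz
    have h2 : 2*s - 2*q ≤ s^2/(2*q) := by
      rw [le_div_iff₀ (by positivity)]; nlinarith [sq_nonneg (s-2*q)]
    have : Real.log |ρ.im| = q + 1.42 := by rw [hq]; ring
    rw [this]; linarith
  · rw [max_eq_right h] at hz
    have hz' : 1/(17.46*1.22) ≤ 1/2 - |ρ.re| := by
      refine le_trans ?_ hz
      apply one_div_le_one_div_of_le
      · have : 0 < Real.log 14 - 1.42 := by linarith
        positivity
      · have : Real.log 14 - 1.42 ≤ 1.22 := by linarith
        gcongr
    have := key 1.22 (by norm_num) hz'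
    have h2 : Real.exp (-(8.73*s^2)*(1/2-|ρ.re|)) ≤ Real.exp (-(2.84+2*s)) := by
      apply Real.exp_le_exp.2
      have : s^2/(2*1.22) ≥ 2.84+2*s := by
        rw [ge_iff_le, le_div_iff₀ (by norm_num)]; nlinarith
      linarith
    have : 1 ≤ |ρ.im|^2 := by nlinarith
    calc _ ≤ _ := h2
      _ ≤ _ := le_mul_of_one_le_right (Real.exp_pos _).le this

theorem exp_pow8 (s : ℝ) (hs : 10.15 ≤ s) : s^8 * Real.exp (-(2.84+2*s)) ≤ 0.0103 := by
  have h0 : 0 < s := by linarith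
  -- s^8 = exp(8 log s)
  have e : s^8 = Real.exp (8*Real.log s) := by
    rw [show (8:ℝ) = ((8:ℕ):ℝ) by norm_num, Real.exp_nat_mul, Real.exp_log h0]
  have h1 : Real.log s ≤ Real.log 10.15 + (s/10.15 - 1) := by
    have := Real.log_le_sub_one_of_pos (show 0 < s/10.15 by positivity)
    rw [Real.log_div h0.ne' (by norm_num)] at this; linarith
  have h2 : s^8 * Real.exp (-(2.84+2*s)) ≤ 10.15^8 * Real.exp (-23.14) := by
    have e' : (10.15:ℝ)^8 = Real.exp (8*Real.log 10.15) := by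
      rw [show (8:ℝ) = ((8:ℕ):ℝ) by norm_num, Real.exp_nat_mul, Real.exp_log (by norm_num)]
    rw [e, e', ← Real.exp_add, ← Real.exp_add]
    apply Real.exp_le_exp.2
    have : 8*(s/10.15-1) ≤ 2*s - 20.3 := by
      have : s/10.15 - 1 = (s-10.15)/10.15 := by field_simp
      rw [this]; linarith [div_mul_cancel₀ (s-10.15) (show (10.15:ℝ) ≠ 0 by norm_num), div_nonneg (show 0 ≤ s-10.15 by linarith) (show (0:ℝ) ≤ 10.15 by norm_num)]
    linarith
  refine h2.trans ?_
  have h3 : (9800000000:ℝ)*1.14 ≤ Real.exp 23.14 := by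
    have : Real.exp 23.14 = Real.exp 1 ^ 23 * Real.exp 0.14 := by
      rw [← Real.exp_nat_mul, ← Real.exp_add]; norm_num
    rw [this]
    have a : (2.71828182:ℝ)^23 ≤ Real.exp 1^23 := by
      gcongr; linarith [Real.exp_one_gt_d9]
    have b : (1.14:ℝ) ≤ Real.exp 0.14 := by linarith [Real.add_one_le_exp (0.14:ℝ)]
    have b2 : (1.149:ℝ) ≤ Real.exp 0.14 := by
      have := Real.quadratic_le_exp_of_nonneg (show (0:ℝ) ≤ 0.14 by norm_num)
      linarith
    calc (9800000000:ℝ)*1.14 ≤ 2.71828182^23*1.149 := by norm_num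
      _ ≤ _ := by gcongr
  rw [Real.exp_neg, ← div_eq_mul_inv, div_le_iff₀ (Real.exp_pos _)]
  have : (10.15:ℝ)^8 ≤ 0.0103 * ((9800000000:ℝ)*1.14) := by norm_num
  linarith

theorem psi_analytic (y : ℝ) (hy : 900 ≤ y) : Chebyshev.psi (Real.exp y) ≤ Real.exp y * (1 + 5.8/y) := by
  have hy0 : 0 < y := by linarith
  set s := Real.sqrt (y/8.73) with hs
  have hs2 : y = 8.73*s^2 := by rw [hs, Real.sq_sqrt (by positivity)]; field_simp
  have hs1 : 10.15 ≤ s := by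
    apply Real.le_sqrt_of_sq_le; rw [le_div_iff₀ (by norm_num)]; norm_num; linarith
  have hM := M_bound s hs1
  rw [← hs2] at hM
  have main := psi_explicit y (3/y) _ (by linarith) (by positivity) hM (Real.exp_pos _).le
  refine main.trans ?_
  have hE := exp_pow8 s hs1
  set M := Real.exp (-(2.84+2*s)) with hMdef
  have hM2 : y^4 * M ≤ 60 := by
    have : y^4*M = 8.73^4 * (s^8*M) := by rw [hs2]; ring
    rw [this]
    calc _ ≤ (8.73:ℝ)^4*0.0103 := by gcongr
      _ ≤ _ := by norm_num
  have hT : y^4 * (Real.exp (-y/2)/16) ≤ 1 := by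
    have : (y/2)^5/ (Nat.factorial 5) ≤ Real.exp (y/2) := Real.pow_div_factorial_le_exp _ (by positivity) 5
    have e : Real.exp (-y/2) = (Real.exp (y/2))⁻¹ := by rw [← Real.exp_neg]; ring_nf
    rw [e]
    have hp := Real.exp_pos (y/2)
    rw [← mul_div_assoc, ← div_eq_mul_inv, div_le_one (by norm_num), div_le_iff₀ hp]
    norm_num [Nat.factorial] at this
    have : y^4*900 ≤ y^5 := by nlinarith [pow_pos hy0 4]
    nlinarith
  set h := 3/y with hh
  have hh0 : 0 < h := by positivity
  have hh1 : h ≤ 1/300 := by rw [hh, div_le_iff₀ hy0]; linarith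
  have hyh : y = 3/h := by rw [hh]; field_simp
  have hexp : Real.exp h ≤ 1 + h + 0.501*h^2 := by
    have := Real.exp_bound' hh0.le (by linarith) (show 0 < 3 by norm_num)
    norm_num [Finset.sum_range_succ, Nat.factorial] at this
    nlinarith [pow_pos hh0 2]
  have t1 : ((Real.exp h - 1)/h)^3 ≤ 1 + 4.56/y := by
    have : (Real.exp h - 1)/h ≤ 1 + 0.501*h := by rw [div_le_iff₀ hh0]; nlinarith
    have h0 : 0 ≤ (Real.exp h - 1)/h := by
      apply div_nonneg _ hh0.le; linarith [Real.add_one_le_exp h]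
    calc _ ≤ (1+0.501*h)^3 := by gcongr
      _ ≤ 1 + 1.52*h := by nlinarith [pow_pos hh0 2, pow_pos hh0 3]
      _ = _ := by rw [hh]; ring
  have t2 : 0.06 * ((1+Real.exp h)/h)^3 * (M + Real.exp (-y/2)/16) ≤ 1.2/y := by
    have a : (1+Real.exp h)/h ≤ 2.004/h := by
      gcongr; nlinarith
    have hm : M + Real.exp (-y/2)/16 ≤ 61/y^4 := by
      rw [le_div_iff₀ (by positivity)]; nlinarith
    have hp := Real.exp_pos h
    calc _ ≤ 0.06*(2.004/h)^3*(61/y^4) := by gcongr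
      _ = (0.06*2.004^3*61/27)/y := by rw [hh]; field_simp; norm_num
      _ ≤ _ := by gcongr; norm_num
  have hp := Real.exp_pos y
  apply mul_le_mul_of_nonneg_left _ hp.le
  have : 4.56/y+1.2/y ≤ 5.8/y := by rw [← add_div]; gcongr; norm_num
  linarith
end

section
open Finset
open ArithmeticFunction (vonMangoldt)

namespace CH

theorem log_fact (N : ℕ) : ∀ n ≤ N, Real.log (n.factorial) = ∑ k ∈ Icc 1 N, vonMangoldt k * ((n / k : ℕ) : ℝ) := by
  intro n
  induction n with
  | zero => intro _; simp
  | succ n ih =>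
    intro h
    rw [Nat.factorial_succ, Nat.cast_mul, Real.log_mul (by positivity) (by positivity), ih (by omega),
      ← ArithmeticFunction.vonMangoldt_sum]
    have e : ∑ i ∈ (n+1).divisors, vonMangoldt i = ∑ k ∈ Icc 1 N, if k ∣ n+1 then vonMangoldt k else 0 := by
      rw [← sum_filter]
      apply sum_congr _ fun _ _ => rfl
      ext k
      simp only [Nat.mem_divisors, mem_filter, mem_Icc]
      constructor
      · rintro ⟨h1, _⟩
        exact ⟨⟨Nat.pos_of_dvd_of_pos h1 (by omega), (Nat.le_of_dvd (by omega) h1).trans h⟩, h1⟩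
      · rintro ⟨_, h1⟩
        exact ⟨h1, by omega⟩
    rw [e, ← sum_add_distrib]
    apply sum_congr rfl
    intro k _
    rw [Nat.succ_div]
    split_ifs <;> push_cast <;> ring

theorem stirling_up : ∀ n : ℕ, 1 ≤ n → Real.log (n.factorial) ≤ (n+1) * Real.log n - n + 1 := by
  intro n hn
  induction n, hn using Nat.le_induction with
  | base => simp
  | succ n hn ih =>
    rw [Nat.factorial_succ, Nat.cast_mul, Real.log_mul (by positivity) (by positivity)]
    have hn' : (0:ℝ) < n := by exact_mod_cast hn
    have h : 1 ≤ ((n:ℝ)+1) * (Real.log (n+1) - Real.log n) := by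
      have := Real.one_sub_inv_le_log_of_pos (show 0 < ((n:ℝ)+1)/n by positivity)
      rw [Real.log_div (by positivity) (by positivity)] at this
      have e : 1 - (((n:ℝ)+1)/n)⁻¹ = 1/(n+1) := by field_simp; ring
      rw [e, div_le_iff₀ (by positivity)] at this
      linarith
    push_cast
    linarith

theorem stirling_lo (n : ℕ) (hn : 1 ≤ n) : n * Real.log n - n ≤ Real.log (n.factorial) := by
  have hn' : (0:ℝ) < n := by exact_mod_cast hn
  have := Real.pow_div_factorial_le_exp (n:ℝ) hn'.le n
  have h2 := Real.log_le_log (by positivity) this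
  rw [Real.log_div (by positivity) (by positivity), Real.log_exp, Real.log_pow] at h2
  linarith

theorem xlogx_mono {u v : ℝ} (hu : 1 ≤ u) (huv : u ≤ v) : u * Real.log u - u ≤ v * Real.log v - v := by
  have hv : 0 < v := by linarith
  have h0 := Real.log_nonneg hu
  -- log(u/v) ≤ u/v - 1
  have := Real.one_sub_inv_le_log_of_pos (show 0 < v/u by positivity)
  rw [Real.log_div (by positivity) (by positivity)] at this
  have e : 1 - (v/u)⁻¹ = (v-u)/v := by field_simp
  rw [e, div_le_iff₀ hv] at this
  nlinarith

theorem stirling_abs (u : ℝ) (hu : 1 ≤ u) :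
    |Real.log ((⌊u⌋₊).factorial) - (u * Real.log u - u)| ≤ Real.log u + 1 := by
  have hn : 1 ≤ ⌊u⌋₊ := Nat.le_floor (by simpa using hu)
  have hn' : (1:ℝ) ≤ ⌊u⌋₊ := by exact_mod_cast hn
  have hle : (⌊u⌋₊:ℝ) ≤ u := Nat.floor_le (by linarith)
  have hlt : u < ⌊u⌋₊ + 1 := Nat.lt_floor_add_one u
  have h0 := Real.log_nonneg hu
  rw [abs_le]
  constructor
  · have h1 := stirling_lo (⌊u⌋₊+1) (by omega)
    rw [Nat.factorial_succ, Nat.cast_mul, Real.log_mul (by positivity) (by positivity)] at h1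
    have h2 := xlogx_mono hu hlt.le
    have h3 : Real.log ((⌊u⌋₊+1 : ℕ):ℝ) ≤ Real.log 2 + Real.log u := by
      rw [← Real.log_mul (by norm_num) (by positivity)]
      apply Real.log_le_log (by positivity)
      push_cast; linarith
    have := Real.log_two_lt_d9
    push_cast at *
    linarith
  · have h1 := stirling_up _ hn
    have h2 := xlogx_mono hn' hle
    have h3 := Real.log_le_log (by linarith) hle
    linarith

/-- majorant of `f` by a step function with the data needed for the recursion -/
def HL (L : List (ℕ × ℝ)) (m : ℕ) : ℝ := (L.map (fun p => if p.1 ≤ m then p.2 else 0)).sum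
noncomputable def PL (L : List (ℕ × ℝ)) : ℝ := (L.map (fun p => max p.2 0 / (p.1:ℝ))).sum
noncomputable def QL (L : List (ℕ × ℝ)) : ℝ := (L.map (fun p => max (-p.2) 0 / (p.1:ℝ))).sum

def Full (f : ℕ → ℝ) (K : ℕ) (P Q : ℝ) : Prop :=
  ∃ L : List (ℕ × ℝ), (∀ p ∈ L, 1 ≤ p.1 ∧ p.1 ≤ K) ∧ (∀ m, 1 ≤ m → f m ≤ HL L m) ∧ PL L ≤ P ∧ Q ≤ QL L

def Up (f : ℕ → ℝ) (m0 : ℕ) (h P Q : ℝ) : Prop :=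
  ∃ L : List (ℕ × ℝ), (∀ p ∈ L, 1 ≤ p.1 ∧ p.1 < m0) ∧ (L.map Prod.snd).sum = h ∧
    (∀ m, 1 ≤ m → m < m0 → f m ≤ HL L m) ∧ PL L ≤ P ∧ Q ≤ QL L

theorem HL_all (L : List (ℕ × ℝ)) (m : ℕ) (h : ∀ p ∈ L, p.1 ≤ m) : HL L m = (L.map Prod.snd).sum := by
  unfold HL
  congr 1
  apply List.map_congr_left
  intro p hp
  rw [if_pos (h p hp)]

theorem Up.extend {f : ℕ → ℝ} {m0 : ℕ} {h P Q : ℝ} (H : Up f m0 h P Q) (l : ℕ) (hl : 1 ≤ l) (hm0 : 1 ≤ m0) (h' P' Q' : ℝ)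
    (hf : ∀ m, m0 ≤ m → m < m0 + l → f m ≤ h') (hP : P + max (h'-h) 0 / m0 ≤ P') (hQ : Q' ≤ Q + max (h-h') 0 / m0) :
    Up f (m0+l) h' P' Q' := by
  obtain ⟨L, h1, h2, h3, h4, h5⟩ := H
  refine ⟨(m0, h'-h) :: L, ?_, ?_, ?_, ?_, ?_⟩
  · intro p hp
    rcases List.mem_cons.1 hp with rfl | hp
    · exact ⟨hm0, by simp; omega⟩
    · have := h1 p hp; omega
  · simp [h2]
  · intro m hm hml
    by_cases c : m < m0
    · have := h3 m hm c
      simp only [HL, List.map_cons, List.sum_cons]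
      rw [if_neg (by simpa using c)]
      simpa [HL] using this
    · have e := HL_all L m (fun p hp => by have := h1 p hp; omega)
      have := hf m (by omega) hml
      simp only [HL, List.map_cons, List.sum_cons] at e ⊢
      rw [if_pos (by omega), e, h2]
      linarith
  · simp only [PL, List.map_cons, List.sum_cons] at h4 ⊢
    linarith
  · simp only [QL, List.map_cons, List.sum_cons] at h5 ⊢
    rw [neg_sub]; linarith

theorem Up.finish {f : ℕ → ℝ} {m0 : ℕ} {h P Q : ℝ} (H : Up f m0 h P Q) (hm0 : 1 ≤ m0) (h' P' Q' : ℝ)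
    (hf : ∀ m, m0 ≤ m → f m ≤ h') (hP : P + max (h'-h) 0 / m0 ≤ P') (hQ : Q' ≤ Q + max (h-h') 0 / m0) :
    Full f m0 P' Q' := by
  obtain ⟨L, h1, h2, h3, h4, h5⟩ := H
  refine ⟨(m0, h'-h) :: L, ?_, ?_, ?_, ?_⟩
  · intro p hp
    rcases List.mem_cons.1 hp with rfl | hp
    · exact ⟨hm0, by simp⟩
    · have := h1 p hp; omega
  · intro m hm
    by_cases c : m < m0
    · have := h3 m hm c
      simp only [HL, List.map_cons, List.sum_cons]
      rw [if_neg (by simpa using c)]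
      simpa [HL] using this
    · have e := HL_all L m (fun p hp => by have := h1 p hp; omega)
      have := hf m (by omega)
      simp only [HL, List.map_cons, List.sum_cons] at e ⊢
      rw [if_pos (by omega), e, h2]
      linarith
  · simp only [PL, List.map_cons, List.sum_cons] at h4 ⊢
    linarith
  · simp only [QL, List.map_cons, List.sum_cons] at h5 ⊢
    rw [neg_sub]; linarith

def FB (a : ℕ → ℝ) (D : ℕ) (m : ℕ) : ℝ := 1 - ∑ d ∈ Icc 1 D, a d * ((m / d : ℕ) : ℝ)

theorem psi_floor (x : ℝ) : Chebyshev.psi x = ∑ k ∈ Icc 1 ⌊x⌋₊, vonMangoldt k := by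
  rw [Chebyshev.psi]; rfl

theorem psi_div (x : ℝ) (K : ℕ) (hK : 1 ≤ K) :
    Chebyshev.psi (x/K) = ∑ k ∈ Icc 1 ⌊x⌋₊, vonMangoldt k * (if K ≤ ⌊x⌋₊/k then 1 else 0) := by
  rw [psi_floor, Nat.floor_div_natCast]
  simp only [mul_ite, mul_one, mul_zero]
  rw [← sum_filter]
  apply sum_congr _ fun _ _ => rfl
  ext k
  simp only [mem_Icc, mem_filter]
  constructor
  · rintro ⟨h1, h2⟩
    rw [Nat.le_div_iff_mul_le (by omega)] at h2 ⊢
    refine ⟨⟨h1, ?_⟩, by rw [mul_comm]; exact h2⟩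
    nlinarith
  · rintro ⟨⟨h1, _⟩, h2⟩
    rw [Nat.le_div_iff_mul_le (by omega)] at h2 ⊢
    exact ⟨h1, by rw [mul_comm]; exact h2⟩

theorem sum_HL (x : ℝ) : ∀ (L : List (ℕ × ℝ)), (∀ p ∈ L, 1 ≤ p.1) →
    ∑ k ∈ Icc 1 ⌊x⌋₊, vonMangoldt k * HL L (⌊x⌋₊/k) = (L.map (fun p => p.2 * Chebyshev.psi (x/p.1))).sum := by
  intro L
  induction L with
  | nil => intro _; simp [HL]
  | cons p L ih =>
    intro h
    have := ih (fun q hq => h q (List.mem_cons_of_mem _ hq))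
    simp only [HL, List.map_cons, List.sum_cons, mul_add, sum_add_distrib] at this ⊢
    rw [this, psi_div x p.1 (h p List.mem_cons_self), mul_sum]
    congr 1
    apply sum_congr rfl
    intro k _
    split_ifs <;> ring

theorem list_bd (x cm cp : ℝ) : ∀ (L : List (ℕ × ℝ)), (∀ p ∈ L, 1 ≤ p.1) →
    (∀ p ∈ L, cm * (x/p.1) ≤ Chebyshev.psi (x/p.1) ∧ Chebyshev.psi (x/p.1) ≤ cp * (x/p.1)) →
    (L.map (fun p => p.2 * Chebyshev.psi (x/p.1))).sum ≤ (PL L * cp - QL L * cm) * x := by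
  intro L
  induction L with
  | nil => intros; simp [PL, QL]
  | cons p L ih =>
    intro h1 h2
    have := ih (fun q hq => h1 q (List.mem_cons_of_mem _ hq)) (fun q hq => h2 q (List.mem_cons_of_mem _ hq))
    simp only [PL, QL, List.map_cons, List.sum_cons] at this ⊢
    obtain ⟨a, b⟩ := h2 p List.mem_cons_self
    have e : p.2 * Chebyshev.psi (x/p.1) ≤ (max p.2 0 / p.1 * cp - max (-p.2) 0 / p.1 * cm) * x := by
      rcases le_total 0 p.2 with c | c
      · rw [max_eq_left c, max_eq_right (by linarith)]
        calc _ ≤ p.2 * (cp * (x/p.1)) := mul_le_mul_of_nonneg_left b c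
          _ = _ := by ring
      · rw [max_eq_right c, max_eq_left (by linarith)]
        calc _ ≤ p.2 * (cm * (x/p.1)) := mul_le_mul_of_nonpos_left a c
          _ = _ := by ring
    linarith

theorem psi_split (a : ℕ → ℝ) (D : ℕ) (x : ℝ) (hx1 : 1 ≤ x) (hx : (D:ℝ) ≤ x) (hs : ∑ d ∈ Icc 1 D, a d / d = 0) :
    |Chebyshev.psi x - (-∑ d ∈ Icc 1 D, a d / d * Real.log d) * x - ∑ k ∈ Icc 1 ⌊x⌋₊, vonMangoldt k * FB a D (⌊x⌋₊/k)|
      ≤ (∑ d ∈ Icc 1 D, |a d|) * (Real.log x + 1) := by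
  have e1 : Chebyshev.psi x - ∑ k ∈ Icc 1 ⌊x⌋₊, vonMangoldt k * FB a D (⌊x⌋₊/k) =
      ∑ d ∈ Icc 1 D, a d * Real.log ((⌊x/d⌋₊).factorial) := by
    have : ∀ d ∈ Icc 1 D, a d * Real.log ((⌊x/d⌋₊).factorial) =
        ∑ k ∈ Icc 1 ⌊x⌋₊, a d * (vonMangoldt k * ((⌊x⌋₊/k/d : ℕ):ℝ)) := by
      intro d _
      rw [Nat.floor_div_natCast, log_fact ⌊x⌋₊ _ (Nat.div_le_self _ _), mul_sum]
      apply sum_congr rfl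
      intro k _
      rw [Nat.div_div_eq_div_mul, Nat.div_div_eq_div_mul, mul_comm d k]
    rw [sum_congr rfl this, sum_comm, psi_floor, ← sum_sub_distrib]
    apply sum_congr rfl
    intro k _
    rw [FB, mul_sub, mul_one, sub_sub_cancel, mul_sum]
    apply sum_congr rfl
    intro d _
    ring
  have e2 : (-∑ d ∈ Icc 1 D, a d / d * Real.log d) * x = ∑ d ∈ Icc 1 D, a d * (x/d * Real.log (x/d) - x/d) := by
    have : ∀ d ∈ Icc 1 D, a d * (x/d * Real.log (x/d) - x/d) = a d / d * (x * (Real.log x - 1)) - (a d / d * Real.log d) * x := by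
      intro d hd
      have : (d:ℝ) ≠ 0 := by have := (mem_Icc.1 hd).1; positivity
      rw [Real.log_div (by linarith) this]; field_simp; ring
    rw [sum_congr rfl this, sum_sub_distrib, ← sum_mul, hs, ← sum_mul]; ring
  have e3 : Chebyshev.psi x - (-∑ d ∈ Icc 1 D, a d / d * Real.log d) * x - ∑ k ∈ Icc 1 ⌊x⌋₊, vonMangoldt k * FB a D (⌊x⌋₊/k)
      = ∑ d ∈ Icc 1 D, a d * (Real.log ((⌊x/d⌋₊).factorial) - (x/d * Real.log (x/d) - x/d)) := by
    simp_rw [mul_sub (a _) (Real.log _)]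
    rw [sum_sub_distrib, ← e1, ← e2]; ring
  rw [e3, sum_mul]
  refine (abs_sum_le_sum_abs _ _).trans (sum_le_sum fun d hd => ?_)
  rw [abs_mul]
  have hd := mem_Icc.1 hd
  have hd1 : (1:ℝ) ≤ d := by exact_mod_cast hd.1
  have hdx : (d:ℝ) ≤ x := le_trans (by exact_mod_cast hd.2) hx
  have h1 : 1 ≤ x/d := by rw [le_div_iff₀ (by linarith)]; linarith
  refine mul_le_mul_of_nonneg_left ((stirling_abs _ h1).trans ?_) (abs_nonneg _)
  have : Real.log (x/d) ≤ Real.log x := Real.log_le_log (by linarith) (div_le_self (by linarith) hd1)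
  linarith

/-- Two-sided bound beyond a threshold -/
def Bd (cm cp Y : ℝ) : Prop := ∀ x, Y ≤ x → cm * x ≤ Chebyshev.psi x ∧ Chebyshev.psi x ≤ cp * x

theorem Full.bound {f : ℕ → ℝ} {K : ℕ} {P Q cm cp Y : ℝ} (H : Full f K P Q) (hcm : 0 ≤ cm) (hcp : 0 ≤ cp) (hB : Bd cm cp Y)
    (hY : 0 ≤ Y) (x : ℝ) (hx0 : 0 ≤ x) (hx : Y * K ≤ x) :
    ∑ k ∈ Icc 1 ⌊x⌋₊, vonMangoldt k * f (⌊x⌋₊/k) ≤ (P * cp - Q * cm) * x := by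
  obtain ⟨L, h1, h2, h3, h4⟩ := H
  calc _ ≤ ∑ k ∈ Icc 1 ⌊x⌋₊, vonMangoldt k * HL L (⌊x⌋₊/k) := by
        apply sum_le_sum
        intro k hk
        have := mem_Icc.1 hk
        refine mul_le_mul_of_nonneg_left (h2 _ ?_) ArithmeticFunction.vonMangoldt_nonneg
        exact Nat.div_pos this.2 (by omega)
    _ = _ := sum_HL x L (fun p hp => (h1 p hp).1)
    _ ≤ (PL L * cp - QL L * cm) * x := by
        apply list_bd x cm cp L (fun p hp => (h1 p hp).1)
        intro p hp
        apply hB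
        have h := h1 p hp
        have hp1 : (1:ℝ) ≤ p.1 := by exact_mod_cast h.1
        have hp2 : (p.1:ℝ) ≤ K := by exact_mod_cast h.2
        rw [le_div_iff₀ (by linarith)]
        calc _ ≤ Y * K := by gcongr
          _ ≤ x := hx
    _ ≤ _ := by gcongr

theorem step (a : ℕ → ℝ) (D K : ℕ) (α E P Q P' Q' cm cp Y : ℝ) (hs : ∑ d ∈ Icc 1 D, a d / d = 0)
    (hα : α = -∑ d ∈ Icc 1 D, a d / d * Real.log d) (hE : ∑ d ∈ Icc 1 D, |a d| ≤ E)
    (HU : Full (FB a D) K P Q) (HD : Full (fun m => -FB a D m) K P' Q') (hcm : 0 ≤ cm) (hcp : 0 ≤ cp) (hB : Bd cm cp Y) (hY : 0 ≤ Y)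
    (x : ℝ) (hx1 : 1 ≤ x) (hxD : (D:ℝ) ≤ x) (hx : Y * K ≤ x) :
    (α - P' * cp + Q' * cm) * x - E * (Real.log x + 1) ≤ Chebyshev.psi x ∧
    Chebyshev.psi x ≤ (α + P * cp - Q * cm) * x + E * (Real.log x + 1) := by
  have h1 := psi_split a D x hx1 hxD hs
  rw [← hα] at h1
  have h2 := HU.bound hcm hcp hB hY x (by linarith) hx
  have h3 := HD.bound hcm hcp hB hY x (by linarith) hx
  have h0 := Real.log_nonneg hx1
  have h4 : (∑ d ∈ Icc 1 D, |a d|) * (Real.log x + 1) ≤ E * (Real.log x + 1) := by gcongr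
  simp only [mul_neg, sum_neg_distrib] at h3
  have := abs_le.1 h1
  constructor <;> linarith [this.1, this.2]
end CH
end

section
open Finset
namespace CH
def frc {α : Type} (n : ℕ) (f : ℕ → α) : α := match n with
  | 0 => f 0
  | k+1 => f (k+1)
theorem frc_eq {α : Type} (n : ℕ) (f : ℕ → α) : frc n f = f n := by cases n <;> rfl
def POS : ℕ := 2832986139646682245103166241808605494619473570006798855548997818259525924424871183671350235001896682504915496573245047278285866026373178800891724403714542393615630721035333499718793526484815128953582352927707358353183069093838054868068201320681902032933924714364241320066531724282719549979863597753074500674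
def NEG : ℕ := 163371697347662476125296559313925204076199356550894049002263822720489138493484851829529516826234957781858218873817432254743667275077838690676734608966002542655133479081987958213024292734963999088809408997156190596081618917135343040413971669528744465587139737633250914365356794556862465182408322543815618078892

/-- packed indicator of multiples of d in [b,b+N) -/
def rep (b N d : ℕ) : ℕ :=
  let s := (d - b % d) % d
  bif Nat.ble N s then 0 else 1024^s * (((1024^d)^((N-1-s)/d+1) - 1)/(1024^d-1))
/-- balanced sum of `f` over `[lo, lo+2^k)` -/
def sumB (f : ℕ → ℕ) : ℕ → ℕ → ℕ
  | 0, lo => frc lo f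
  | k+1, lo => sumB f k lo + sumB f k (lo + 2^k)
theorem sumB_eq (f : ℕ → ℕ) : ∀ k lo, sumB f k lo = ∑ i ∈ range (2^k), f (lo + i) := by
  intro k
  induction k with
  | zero => intro lo; simp [sumB, frc_eq]
  | succ k ih =>
    intro lo
    rw [sumB, ih, ih, pow_succ, mul_two, sum_range_add]
    simp only [add_assoc]
theorem sumB_zero (f : ℕ → ℕ) (k : ℕ) : sumB f k 0 = ∑ d ∈ range (2^k), f d := by
  rw [sumB_eq]; simp
def sumS (S b N : ℕ) : ℕ := sumB (fun d => bif Nat.testBit S d then rep b N d else 0) 10 0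
def XX (b N : ℕ) : ℕ := 512 * rep b N 1 + sumS POS b N - sumS NEG b N
def lanes (n : ℕ) : ℕ → ℕ → ℕ → ℕ → (ℕ → ℕ → ℕ → Bool) → Bool :=
  Nat.rec (fun _ cur mx mn k => k cur mx mn) (fun _ ih X cur mx mn k =>
    Nat.rec false (fun c _ =>
    cond (Nat.ble mx c)
      (cond (Nat.ble (Nat.succ c) mn) (ih (Nat.div X 1024) (Nat.succ c) (Nat.succ c) (Nat.succ c) k) (ih (Nat.div X 1024) (Nat.succ c) (Nat.succ c) mn k))
    (cond (Nat.ble (Nat.succ c) mn) (ih (Nat.div X 1024) (Nat.succ c) mx (Nat.succ c) k) (ih (Nat.div X 1024) (Nat.succ c) mx mn k))) (Nat.sub (Nat.add cur (Nat.mod X 1024)) 512)) n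
def lanesB (n : ℕ) : ℕ → ℕ → ℕ → ℕ → (ℕ → ℕ → ℕ → Bool) → Bool :=
  Nat.rec (fun _ cur mx mn k => k cur mx mn) (fun _ ih X cur mx mn k =>
    frc (Nat.mod X (1024^32)) fun Y => frc (Nat.div X (1024^32)) fun Z => lanes 32 Y cur mx mn fun cur mx mn => ih Z cur mx mn k) n
def upd (ph h m P Q : ℕ) (k : ℕ → ℕ → Bool) : Bool :=
  bif Nat.ble ph h then frc (P + (h-ph)*2^20/m + 1) fun P' => k P' Q
  else frc (Q + (ph-h)*2^20/m) fun Q' => k P Q'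
def OFF : ℕ := 2^30
def ZZ : ℕ := 2^60
def aLo : ℕ := 1605215
/-- number of 32-lane groups in the block starting at m -/
def bnum (m : ℕ) : ℕ := bif Nat.ble m 32767 then 2^(Nat.log2 m - 10) else 32
def blocks : ℕ → ℕ → ℕ → ℕ → ℕ → ℕ → ℕ → ℕ → ℕ → ℕ → ℕ → (ℕ → ℕ → ℕ → ℕ → ℕ → ℕ → ℕ → ℕ → Bool) → Bool
  | 0, _, _, m, cur, h, g, Pu, Qu, Pl, Ql, k => k m cur h g Pu Qu Pl Ql
  | n+1, e, X, m, cur, h, g, Pu, Qu, Pl, Ql, k =>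
    frc (bnum m) fun nb =>
    bif Nat.ble 1 nb && (Nat.ble (m + 32*nb) e && Nat.beq ((m + 32*nb - 1)/1024) (m/1024)) then
    frc (X % 1024^(32*nb)) fun Y =>
    lanesB nb Y cur 0 (2^40) fun cur' mx mn =>
    bif Nat.ble (2^20 * mn + aLo*(m/1024)) (ZZ + 2^20*(1+OFF)) then
      frc (ZZ + 2^20*(1+OFF) - (2^20 * mn + aLo*(m/1024))) fun h' =>
      frc (ZZ + 2^20 * mx + (aLo+1)*(m/1024) - 2^20*(1+OFF)) fun g' =>
      upd h h' m Pu Qu fun Pu' Qu' => upd g g' m Pl Ql fun Pl' Ql' =>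
      frc (X / 1024^(32*nb)) fun X' =>
      frc (m + 32*nb) fun m' =>
      blocks n e X' m' cur' h' g' Pu' Qu' Pl' Ql' k
    else false
    else false
def fin (m cur h g Pu Qu Pl Ql : ℕ) : ℕ → ℕ → ℕ → ℕ → ℕ → ℕ → ℕ → ℕ → Bool := fun m' cur' h' g' Pu' Qu' Pl' Ql' =>
  (Nat.beq m m' && Nat.beq cur cur') && ((Nat.beq h h' && Nat.beq g g') && ((Nat.beq Pu Pu' && Nat.beq Qu Qu') && (Nat.beq Pl Pl' && Nat.beq Ql Ql')))
end CH
end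

section
namespace CH
theorem seg0 : lanesB 32 (XX 1 1024) OFF 0 (2^40) (fun _ mx mn => Nat.beq mx (OFF+1) && Nat.beq mn (OFF+1)) = true := by decide +kernel
theorem seg1 : blocks 160 32768 (XX 1024 31744) 1024 1073741825 1152921504606846976 1152921504606846976 0 0 0 0 (fin 32768 1073741773 1152921504612659839 1152921504616762784 70812628388 66853738703 78238242008 73063377587) = true := by decide +kernel
theorem seg2 : blocks 32 65536 (XX 32768 32768) 32768 1073741773 1152921504612659839 1152921504616762784 70812628388 66853738703 78238242008 73063377587 (fin 65536 1073741724 1152921504618964639 1152921504617798048 71926929283 67775767186 79326563964 74092124473) = true := by decide +kernel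
theorem seg3 : blocks 32 98304 (XX 65536 32768) 65536 1073741724 1152921504618964639 1152921504617798048 71926929283 67775767186 79326563964 74092124473 (fin 98304 1073741668 1152921504621075135 1152921504618833312 72657182277 68485018051 79992119437 74739557903) = true := by decide +kernel
theorem seg4 : blocks 32 131072 (XX 98304 32768) 98304 1073741668 1152921504621075135 1152921504618833312 72657182277 68485018051 79992119437 74739557903 (fin 131072 1073741630 1152921504617942751 1152921504618820000 73140926676 68996742342 80393463647 75137745158) = true := by decide +kernel
theorem seg5 : blocks 32 163840 (XX 131072 32768) 131072 1073741630 1152921504617942751 1152921504618820000 73140926676 68996742342 80393463647 75137745158 (fin 163840 1073741579 1152921504613761791 1152921504614612384 73434609434 69316309986 80721191360 75492620573) = true := by decide +kernel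
theorem seg6 : blocks 32 196608 (XX 163840 32768) 163840 1073741579 1152921504613761791 1152921504614612384 73434609434 69316309986 80721191360 75492620573 (fin 196608 1073741534 1152921504615872287 1152921504621939104 73722844119 69587706261 81024996603 75752234988) = true := by decide +kernel
theorem seg7 : blocks 32 229376 (XX 196608 32768) 196608 1073741534 1152921504615872287 1152921504621939104 73722844119 69587706261 81024996603 75752234988 (fin 229376 1073741490 1152921504626371391 1152921504620877216 73967865787 69781814112 81237802959 75972309492) = true := by decide +kernel
theorem seg8 : blocks 32 262144 (XX 229376 32768) 229376 1073741490 1152921504626371391 1152921504620877216 73967865787 69781814112 81237802959 75972309492 (fin 262144 1073741434 1152921504624287583 1152921504621912480 74207904242 70034558768 81440550161 76172173574) = true := by decide +kernel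
end CH
end

section
open Finset
namespace CH

def dg (X i : ℕ) : ℕ := X / 1024^i % 1024

theorem dg_mod (X l i : ℕ) (h : i < l) : dg (X % 1024^l) i = dg X i := by
  unfold dg
  obtain ⟨j, rfl⟩ : ∃ j, l = i + (j+1) := ⟨l - i - 1, by omega⟩
  rw [pow_add, Nat.mod_mul_right_div_self, pow_succ, Nat.mod_mod_of_dvd _ (Dvd.intro_left _ rfl)]

theorem dg_div (X l i : ℕ) : dg (X / 1024^l) i = dg X (l+i) := by
  unfold dg
  rw [Nat.div_div_eq_div_mul, pow_add]

set_option maxRecDepth 20000 in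
theorem lanes_spec (k : ℕ → ℕ → ℕ → Bool) : ∀ (n : ℕ) (g : ℕ → ℤ) (X cur mx mn : ℕ), lanes n X cur mx mn k = true →
    g 0 = cur → (∀ i < n, g (i+1) = g i + dg X i - 512) →
    ∃ cur' mx' mn' : ℕ, k cur' mx' mn' = true ∧ g n = cur' ∧ mx ≤ mx' ∧ mn' ≤ mn ∧ ∀ i, 1 ≤ i → i ≤ n → (mn':ℤ) ≤ g i ∧ g i ≤ mx' := by
  intro n
  induction n with
  | zero =>
    intro g X cur mx mn h h0 _
    exact ⟨cur, mx, mn, h, h0, le_rfl, le_rfl, fun i h1 h2 => by omega⟩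
  | succ n ih =>
    intro g X cur mx mn h h0 hg
    have h' : Nat.rec (motive := fun _ => Bool) false (fun c _ =>
      cond (Nat.ble mx c)
      (cond (Nat.ble (Nat.succ c) mn) (lanes n (Nat.div X 1024) (Nat.succ c) (Nat.succ c) (Nat.succ c) k) (lanes n (Nat.div X 1024) (Nat.succ c) (Nat.succ c) mn k))
      (cond (Nat.ble (Nat.succ c) mn) (lanes n (Nat.div X 1024) (Nat.succ c) mx (Nat.succ c) k) (lanes n (Nat.div X 1024) (Nat.succ c) mx mn k))) (Nat.sub (Nat.add cur (Nat.mod X 1024)) 512) = true := h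
    have key : ∀ c mx1 mn1, Nat.sub (Nat.add cur (Nat.mod X 1024)) 512 = c + 1 → mx ≤ mx1 → c + 1 ≤ mx1 → mn1 ≤ mn → mn1 ≤ c + 1 →
        lanes n (Nat.div X 1024) (c+1) mx1 mn1 k = true → ∃ cur' mx' mn' : ℕ, k cur' mx' mn' = true ∧ g (n+1) = cur' ∧ mx ≤ mx' ∧ mn' ≤ mn ∧ ∀ i, 1 ≤ i → i ≤ n+1 → (mn':ℤ) ≤ g i ∧ g i ≤ mx' := by
      intro c mx1 mn1 hc a1 a2 a3 a4 hl
      have g1 : g 1 = ((c+1 : ℕ) : ℤ) := by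
        have e := hg 0 (by omega)
        have e2 : dg X 0 = X % 1024 := by simp [dg]
        rw [e2, h0] at e
        have hc' : (cur + X % 1024) - 512 = c + 1 := hc
        simp only [zero_add] at e
        omega
      obtain ⟨cur', mx', mn', b1, b2, b3, b4, b5⟩ := ih (fun i => g (i+1)) (Nat.div X 1024) (c+1) mx1 mn1 hl g1 (by
        intro i hi
        have := hg (i+1) (by omega)
        have e2 : dg (Nat.div X 1024) i = dg X (i+1) := by
          have := dg_div X 1 i
          rw [pow_one, add_comm] at this; exact this
        rw [e2]; exact this)
      refine ⟨cur', mx', mn', b1, b2, by omega, by omega, ?_⟩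
      intro i hi1 hi2
      rcases Nat.lt_or_ge i 2 with h2 | h2
      · obtain rfl : i = 1 := by omega
        rw [g1]; constructor <;> norm_cast <;> omega
      · have := b5 (i-1) (by omega) (by omega)
        rwa [Nat.sub_add_cancel hi1] at this
    rcases hs : Nat.sub (Nat.add cur (Nat.mod X 1024)) 512 with _ | c
    · rw [hs] at h'; exact absurd h' (by simp)
    · rw [hs] at h'
      simp only at h'
      rcases h1 : Nat.ble mx c with _ | _ <;> rcases h2 : Nat.ble (Nat.succ c) mn with _ | _ <;> rw [h1, h2] at h' <;> simp only [cond_true, cond_false] at h'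
      · have h1' : ¬ mx ≤ c := by rw [← Nat.ble_eq, h1]; simp
        have h2' : ¬ c+1 ≤ mn := by rw [← Nat.ble_eq, ← Nat.succ_eq_add_one, h2]; simp
        exact key c mx mn hs (by omega) (by omega) (by omega) (by omega) h'
      · have h1' : ¬ mx ≤ c := by rw [← Nat.ble_eq, h1]; simp
        have h2' : c+1 ≤ mn := Nat.le_of_ble_eq_true h2
        exact key c mx (c+1) hs (by omega) (by omega) (by omega) (by omega) h'
      · have h1' : mx ≤ c := Nat.le_of_ble_eq_true h1
        have h2' : ¬ c+1 ≤ mn := by rw [← Nat.ble_eq, ← Nat.succ_eq_add_one, h2]; simp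
        exact key c (c+1) mn hs (by omega) (by omega) (by omega) (by omega) h'
      · have h1' : mx ≤ c := Nat.le_of_ble_eq_true h1
        have h2' : c+1 ≤ mn := Nat.le_of_ble_eq_true h2
        exact key c (c+1) (c+1) hs (by omega) (by omega) (by omega) (by omega) h'

set_option maxRecDepth 20000 in
theorem lanesB_spec (k : ℕ → ℕ → ℕ → Bool) : ∀ (n : ℕ) (g : ℕ → ℤ) (X cur mx mn : ℕ), lanesB n X cur mx mn k = true →
    g 0 = cur → (∀ i < 32*n, g (i+1) = g i + dg X i - 512) →
    ∃ cur' mx' mn' : ℕ, k cur' mx' mn' = true ∧ g (32*n) = cur' ∧ mx ≤ mx' ∧ mn' ≤ mn ∧ ∀ i, 1 ≤ i → i ≤ 32*n → (mn':ℤ) ≤ g i ∧ g i ≤ mx' := by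
  intro n
  induction n with
  | zero =>
    intro g X cur mx mn h h0 _
    exact ⟨cur, mx, mn, h, h0, le_rfl, le_rfl, fun i h1 h2 => by omega⟩
  | succ n ih =>
    intro g X cur mx mn h h0 hg
    have h' : (frc (Nat.mod X (1024^32)) fun Y => frc (Nat.div X (1024^32)) fun Z => lanes 32 Y cur mx mn fun cur mx mn => lanesB n Z cur mx mn k) = true := h
    rw [frc_eq, frc_eq] at h'
    obtain ⟨c1, x1, n1, a1, a2, a3, a4, a5⟩ := lanes_spec _ 32 g _ cur mx mn h' h0 (by
      intro i hi
      have e : dg (Nat.mod X (1024^32)) i = dg X i := dg_mod X 32 i hi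
      rw [e]; exact hg i (by omega))
    obtain ⟨cur', mx', mn', b1, b2, b3, b4, b5⟩ := ih (fun i => g (32+i)) _ c1 x1 n1 a1 a2 (by
      intro i hi
      have e : dg (Nat.div X (1024^32)) i = dg X (32+i) := dg_div X 32 i
      rw [e]; exact hg (32+i) (by omega))
    refine ⟨cur', mx', mn', b1, by rw [← b2]; congr 1; ring, by omega, by omega, ?_⟩
    intro i h1 h2
    rcases Nat.lt_or_ge 32 i with h3 | h3
    · have := b5 (i-32) (by omega) (by omega)
      rwa [Nat.add_sub_cancel' h3.le] at this
    · have := a5 i h1 h3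
      constructor <;> omega

theorem upd_spec {ph h m P Q : ℕ} {k : ℕ → ℕ → Bool} (H : upd ph h m P Q k = true) (hm : 1 ≤ m) :
    ∃ P' Q' : ℕ, k P' Q' = true ∧ 
      (P:ℝ)/2^40 + max (((h:ℝ)-ZZ)/2^20 - ((ph:ℝ)-ZZ)/2^20) 0 / m ≤ (P':ℝ)/2^40 ∧
      (Q':ℝ)/2^40 ≤ (Q:ℝ)/2^40 + max (((ph:ℝ)-ZZ)/2^20 - ((h:ℝ)-ZZ)/2^20) 0 / m := by
  have hm' : (0:ℝ) < m := by exact_mod_cast hm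
  unfold upd at H
  rcases c : Nat.ble ph h with _ | _
  · rw [c, cond_false, frc_eq] at H
    have c' : ¬ ph ≤ h := by rw [← Nat.ble_eq, c]; simp
    have c2 : (h:ℝ) ≤ ph := by exact_mod_cast (by omega : h ≤ ph)
    refine ⟨_, _, H, ?_, ?_⟩
    · rw [max_eq_right (by rw [sub_nonpos]; gcongr)]; simp
    · have e : (((ph-h)*2^20/m : ℕ) : ℝ) ≤ ((ph:ℝ)-h)*2^20/m := by
        refine Nat.cast_div_le.trans ?_
        rw [Nat.cast_mul, Nat.cast_sub (by omega)]; norm_num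
      calc _ ≤ ((Q:ℝ) + ((ph:ℝ)-h)*2^20/m)/2^40 := by push_cast at e ⊢; gcongr
        _ = (Q:ℝ)/2^40 + (((ph:ℝ)-ZZ)/2^20 - ((h:ℝ)-ZZ)/2^20) / m := by ring
        _ ≤ _ := by gcongr; exact le_max_left _ _
  · rw [c, cond_true, frc_eq] at H
    have c' : ph ≤ h := Nat.le_of_ble_eq_true c
    have c2 : (ph:ℝ) ≤ h := by exact_mod_cast c'
    refine ⟨_, _, H, ?_, ?_⟩
    · rw [max_eq_left (by rw [sub_nonneg]; gcongr)]
      have e : ((h:ℝ)-ph)*2^20/m ≤ (((h-ph)*2^20/m : ℕ) : ℝ) + 1 := by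
        have := (Nat.lt_floor_add_one (((h-ph)*2^20 : ℕ) / (m:ℝ) : ℝ)).le
        rw [Nat.floor_div_eq_div] at this
        rw [Nat.cast_mul, Nat.cast_sub (by omega)] at this
        norm_num at this ⊢
        exact this
      calc _ = ((P:ℝ) + ((h:ℝ)-ph)*2^20/m)/2^40 := by ring
        _ ≤ _ := by
          apply div_le_div_of_nonneg_right _ (by positivity)
          rw [Nat.cast_add, Nat.cast_add, Nat.cast_one]; linarith
    · rw [max_eq_right (by rw [sub_nonpos]; gcongr)]; simp
end CH
end

section
open Finset
namespace CH

theorem dvd_iff_mod (b d i : ℕ) (hd : 1 ≤ d) : d ∣ b + i ↔ i % d = (d - b % d) % d := by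
  have h1 := Nat.mod_lt b hd
  constructor
  · intro h
    have : i ≡ d - b % d [MOD d] := by
      apply Nat.ModEq.add_left_cancel' (b % d)
      rw [Nat.add_sub_cancel' h1.le]
      have e : b % d + i ≡ b + i [MOD d] := (Nat.mod_modEq b d).add_right i
      exact e.trans ((Nat.modEq_zero_iff_dvd.2 h).trans (Nat.modEq_zero_iff_dvd.2 dvd_rfl).symm)
    exact this
  · intro h
    have : i ≡ d - b % d [MOD d] := h
    have h2 := this.add_left (b % d)
    rw [Nat.add_sub_cancel' h1.le] at h2
    have e : b % d + i ≡ b + i [MOD d] := (Nat.mod_modEq b d).add_right i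
    exact Nat.modEq_zero_iff_dvd.1 (e.symm.trans (h2.trans (Nat.modEq_zero_iff_dvd.2 dvd_rfl)))

theorem rep_eq (b N d : ℕ) (hd : 1 ≤ d) : rep b N d = ∑ i ∈ range N, (if d ∣ b + i then 1 else 0) * 1024^i := by
  simp only [ite_mul, one_mul, zero_mul]
  simp only [dvd_iff_mod b d _ hd]
  rw [← sum_filter]
  unfold rep
  simp only
  generalize hs : (d - b % d) % d = s
  have hsd : s < d := by rw [← hs]; exact Nat.mod_lt _ hd
  rcases c : Nat.ble N s with _ | _
  · have c' : ¬ N ≤ s := by rw [← Nat.ble_eq, c]; simp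
    rw [cond_false, ← Nat.geomSum_eq (by
      calc 2 ≤ 1024^1 := by norm_num
        _ ≤ 1024^d := Nat.pow_le_pow_right (by norm_num) hd), mul_sum]
    have e : (range N).filter (fun i => i % d = s) = (range ((N-1-s)/d+1)).image (fun j => s + d*j) := by
      ext i
      simp only [mem_filter, mem_range, mem_image]
      constructor
      · rintro ⟨h1, h2⟩
        have h3 := Nat.mod_add_div i d
        refine ⟨i/d, ?_, by rw [← h2]; exact h3⟩
        rw [Nat.lt_succ_iff, Nat.le_div_iff_mul_le hd, mul_comm]
        omega
      · rintro ⟨j, h1, rfl⟩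
        rw [Nat.lt_succ_iff, Nat.le_div_iff_mul_le hd, mul_comm] at h1
        exact ⟨by omega, by rw [Nat.add_mul_mod_self_left, Nat.mod_eq_of_lt hsd]⟩
    rw [e, sum_image]
    · apply sum_congr rfl
      intro j _
      rw [pow_add, pow_mul]
    · intro x _ y _ hxy
      have : d * x = d * y := by simpa using hxy
      exact Nat.eq_of_mul_eq_mul_left hd this
  · have c' : N ≤ s := Nat.le_of_ble_eq_true c
    rw [cond_true]
    symm
    apply sum_eq_zero
    intro i hi
    simp only [mem_filter, mem_range] at hi
    have := Nat.mod_le i d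
    omega

theorem dg_sum : ∀ (j N : ℕ) (v : ℕ → ℕ), (∀ i < N, v i < 1024) → j < N → dg (∑ i ∈ range N, v i * 1024^i) j = v j := by
  intro j
  induction j with
  | zero =>
    intro N v hv hj
    obtain ⟨M, rfl⟩ : ∃ M, N = M + 1 := ⟨N - 1, by omega⟩
    rw [sum_range_succ']
    simp only [pow_succ, ← mul_assoc, dg, pow_zero, Nat.div_one, mul_one]
    rw [← sum_mul, mul_comm, Nat.mul_add_mod, Nat.mod_eq_of_lt (hv 0 hj)]
  | succ j ih =>
    intro N v hv hj
    obtain ⟨M, rfl⟩ : ∃ M, N = M + 1 := ⟨N - 1, by omega⟩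
    have := ih M (fun i => v (i+1)) (fun i hi => hv (i+1) (by omega)) (by omega)
    rw [← this, add_comm j 1, ← dg_div]
    congr 1
    rw [sum_range_succ']
    simp only [pow_succ, ← mul_assoc, pow_zero, mul_one, one_mul]
    rw [← sum_mul, mul_comm, Nat.mul_add_div (by norm_num), Nat.div_eq_of_lt (hv 0 (by omega)), add_zero]

def ps (d : ℕ) : ℕ := bif Nat.testBit POS d then 1 else 0
def ng (d : ℕ) : ℕ := bif Nat.testBit NEG d then 1 else 0

theorem ps_sum : ∑ d ∈ range 1024, ps d = 310 := by
  have h := sumB_zero ps 10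
  rw [show (2:ℕ)^10 = 1024 by norm_num] at h
  rw [← h]; decide +kernel
theorem ng_sum : ∑ d ∈ range 1024, ng d = 314 := by
  have h := sumB_zero ng 10
  rw [show (2:ℕ)^10 = 1024 by norm_num] at h
  rw [← h]; decide +kernel
theorem ps_zero : ps 0 = 0 := by decide +kernel
theorem ng_zero : ng 0 = 0 := by decide +kernel

def dv (w : ℕ → ℕ) (m : ℕ) : ℕ := ∑ d ∈ range 1024, w d * (if d ∣ m then 1 else 0)

theorem dv_le (w : ℕ → ℕ) (m : ℕ) : dv w m ≤ ∑ d ∈ range 1024, w d := by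
  apply sum_le_sum
  intro d _
  split_ifs <;> simp

theorem sumS_eq (S : ℕ) (w : ℕ → ℕ) (hw : ∀ d, w d = bif Nat.testBit S d then 1 else 0) (h0 : w 0 = 0) (b N : ℕ) :
    sumS S b N = ∑ i ∈ range N, dv w (b+i) * 1024^i := by
  unfold sumS
  rw [sumB_zero]
  have : ∀ d ∈ range (2^10), (bif Nat.testBit S d then rep b N d else 0) = ∑ i ∈ range N, w d * (if d ∣ b+i then 1 else 0) * 1024^i := by
    intro d _
    rcases Nat.eq_zero_or_pos d with rfl | hd
    · rw [h0]
      have := hw 0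
      rw [h0] at this
      cases h : Nat.testBit S 0
      · simp
      · rw [h] at this; simp at this
    · rw [hw d]
      cases h : Nat.testBit S d
      · simp
      · simp only [cond_true, one_mul]
        exact rep_eq b N d hd
  rw [sum_congr rfl this, sum_comm]
  apply sum_congr rfl
  intro i _
  rw [dv, sum_mul]; rfl

theorem XX_dg (b N i : ℕ) (hi : i < N) : (dg (XX b N) i : ℤ) = 512 + dv ps (b+i) - dv ng (b+i) := by
  have e : XX b N = ∑ i ∈ range N, (512 + dv ps (b+i) - dv ng (b+i)) * 1024^i := by
    unfold XX
    rw [sumS_eq POS ps (fun _ => rfl) ps_zero, sumS_eq NEG ng (fun _ => rfl) ng_zero, rep_eq b N 1 le_rfl, mul_sum, ← sum_add_distrib, ← sum_tsub_distrib]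
    · apply sum_congr rfl
      intro i _
      simp only [one_dvd, if_true, one_mul]
      rw [← add_mul, ← Nat.sub_mul]
    · intro i _
      simp only [one_dvd, if_true, one_mul]
      rw [← add_mul]
      apply Nat.mul_le_mul_right
      have := dv_le ng (b+i)
      rw [ng_sum] at this; omega
  have h1 : ∀ i, dv ps (b+i) ≤ 310 := fun i => ps_sum ▸ dv_le ps (b+i)
  have h2 : ∀ i, dv ng (b+i) ≤ 314 := fun i => ng_sum ▸ dv_le ng (b+i)
  rw [e, dg_sum i N _ (fun i _ => by have := h1 i; omega) hi]
  have := h1 i; have := h2 i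
  omega

def gz (m : ℕ) : ℤ := OFF + ∑ d ∈ range 1024, ((ps d : ℤ) - ng d) * ((m / d : ℕ) : ℤ)

theorem gz_zero : gz 0 = OFF := by simp [gz]

theorem gz_succ (m : ℕ) : gz (m+1) = gz m + dv ps (m+1) - dv ng (m+1) := by
  unfold gz dv
  simp only [Nat.cast_sum, Nat.cast_mul]
  rw [add_assoc, add_sub_assoc, ← sum_add_distrib, ← sum_sub_distrib]
  refine congrArg _ (sum_congr rfl ?_)
  intro d _
  rw [Nat.succ_div]
  split_ifs <;> push_cast <;> ring

theorem gz_XX (b N i : ℕ) (hb : 1 ≤ b) (hi : i < N) : gz (b - 1 + (i+1)) = gz (b - 1 + i) + dg (XX b N) i - 512 := by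
  rw [XX_dg b N i hi, ← add_assoc, gz_succ]
  rw [show b - 1 + i + 1 = b + i by omega]; ring

noncomputable def aD : ℝ := -1024 * ∑ d ∈ range 1024, ((ps d : ℝ) - ng d) / d
noncomputable def ac (d : ℕ) : ℝ := if d < 1024 then (ps d : ℝ) - ng d else aD

theorem sum_Icc_1024 (f : ℕ → ℝ) (h0 : f 0 = 0) : ∑ d ∈ Icc 1 1024, f d = ∑ d ∈ range 1024, f d + f 1024 := by
  rw [← sum_range_succ, range_eq_Ico, sum_eq_sum_Ico_succ_bot (by norm_num), h0, zero_add]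
  rfl

theorem ac_lt {d : ℕ} (h : d ∈ range 1024) : ac d = (ps d : ℝ) - ng d := by
  rw [ac, if_pos (mem_range.1 h)]
theorem ac_D : ac 1024 = aD := by rw [ac, if_neg (by norm_num)]
theorem ac_0 : ac 0 = 0 := by rw [ac, if_pos (by norm_num), ps_zero, ng_zero]; simp

theorem ac_sum : ∑ d ∈ Icc 1 1024, ac d / d = 0 := by
  rw [sum_Icc_1024 _ (by simp), ac_D, sum_congr rfl (fun d h => by rw [ac_lt h]), aD]
  push_cast; ring

theorem FB_eq (m : ℕ) : FB ac 1024 m = 1 + OFF - (gz m : ℝ) - aD * ((m / 1024 : ℕ) : ℝ) := by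
  rw [FB, sum_Icc_1024 _ (by simp), ac_D, sum_congr rfl (fun d h => by rw [ac_lt h]), gz]
  simp only [Int.cast_add, Int.cast_sum, Int.cast_mul, Int.cast_sub, Int.cast_natCast]; ring

theorem sum_inv_bounds (w : ℕ → ℕ) (hw : ∀ d, w d ≤ 1) (R : ℕ) (hR : 0 < R) :
    ((∑ d ∈ range 1024, w d * (R/d) : ℕ) : ℝ) / (R:ℝ) ≤ ∑ d ∈ range 1024, (w d : ℝ) / d ∧
    ∑ d ∈ range 1024, (w d : ℝ) / d ≤ ((∑ d ∈ range 1024, w d * (R/d) + 1024 : ℕ) : ℝ) / (R:ℝ) := by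
  have hR' : (0:ℝ) < R := by exact_mod_cast hR
  constructor
  · rw [div_le_iff₀ hR', sum_mul]
    push_cast
    apply sum_le_sum
    intro d _
    calc (w d : ℝ) * ((R/d : ℕ) : ℝ) ≤ w d * ((R:ℝ) / d) := by gcongr; exact Nat.cast_div_le
      _ = _ := by push_cast; ring
  · rw [le_div_iff₀ hR', sum_mul]
    have : ((∑ d ∈ range 1024, w d * (R/d) + 1024 : ℕ) : ℝ) = ∑ d ∈ range 1024, ((w d : ℝ) * ((R/d : ℕ) : ℝ) + 1) := by
      rw [sum_add_distrib]; push_cast; simp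
    rw [this]
    apply sum_le_sum
    intro d _
    have h1 := (Nat.lt_floor_add_one ((R:ℝ) / (d:ℝ) : ℝ)).le
    rw [Nat.floor_div_eq_div] at h1
    have hw' : (w d : ℝ) ≤ 1 := by exact_mod_cast hw d
    have h0 : (0:ℝ) ≤ w d := Nat.cast_nonneg _
    calc (w d : ℝ) / d * (R:ℝ) = w d * ((R:ℝ) / d) := by push_cast; ring
      _ ≤ w d * (((R/d : ℕ) : ℝ) + 1) := mul_le_mul_of_nonneg_left h1 h0
      _ ≤ _ := by linarith

theorem ps_le (d : ℕ) : ps d ≤ 1 := by unfold ps; cases Nat.testBit POS d <;> simp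
theorem ng_le (d : ℕ) : ng d ≤ 1 := by unfold ng; cases Nat.testBit NEG d <;> simp
end CH
end

section
open Finset
namespace CH

theorem psS : ∑ d ∈ range 1024, ps d * (2^60/d) = 3030290495424542577 := by
  have h := sumB_zero (fun d => ps d * (2^60/d)) 10
  rw [show (2:ℕ)^10 = 1024 by norm_num] at h
  rw [← h]; decide +kernel
theorem ngS : ∑ d ∈ range 1024, ng d * (2^60/d) = 3032014082408640833 := by
  have h := sumB_zero (fun d => ng d * (2^60/d)) 10
  rw [show (2:ℕ)^10 = 1024 by norm_num] at h
  rw [← h]; decide +kernel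

theorem ps_inv : (3030290495424542577:ℝ)/2^60 ≤ ∑ d ∈ range 1024, (ps d : ℝ) / d ∧
    ∑ d ∈ range 1024, (ps d : ℝ) / d ≤ (3030290495424542577+1024)/2^60 := by
  have h1 := sum_inv_bounds ps ps_le (2^60) (by norm_num)
  rw [psS] at h1
  constructor
  · have := h1.1; norm_num at this ⊢; linarith
  · have := h1.2; norm_num at this ⊢; linarith
theorem ng_inv : (3032014082408640833:ℝ)/2^60 ≤ ∑ d ∈ range 1024, (ng d : ℝ) / d ∧
    ∑ d ∈ range 1024, (ng d : ℝ) / d ≤ (3032014082408640833+1024)/2^60 := by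
  have h1 := sum_inv_bounds ng ng_le (2^60) (by norm_num)
  rw [ngS] at h1
  constructor
  · have := h1.1; norm_num at this ⊢; linarith
  · have := h1.2; norm_num at this ⊢; linarith

theorem aD_eq : aD = 1024 * (∑ d ∈ range 1024, (ng d : ℝ) / d - ∑ d ∈ range 1024, (ps d : ℝ) / d) := by
  rw [aD, ← sum_sub_distrib, neg_mul, ← mul_neg, ← sum_neg_distrib]
  refine congrArg _ (sum_congr rfl ?_)
  intro d _
  ring

theorem aD_lo : (aLo:ℝ)/2^20 ≤ aD := by
  rw [aD_eq, aLo]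
  have := ps_inv.2; have := ng_inv.1
  norm_num at *
  linarith
theorem aD_hi : aD ≤ ((aLo:ℝ)+1)/2^20 := by
  rw [aD_eq, aLo]
  have := ps_inv.1; have := ng_inv.2
  norm_num at *
  linarith
theorem aD_pos : 0 ≤ aD := le_trans (by positivity) aD_lo

noncomputable abbrev BB : ℕ → ℝ := FB ac 1024

structure Inv (m cur h g Pu Qu Pl Ql : ℕ) : Prop where
  hm : 1 ≤ m
  hc : gz (m-1) = cur
  hu : Up BB m (((h:ℝ)-ZZ)/2^20) ((Pu:ℝ)/2^40) ((Qu:ℝ)/2^40)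
  hl : Up (fun j => -BB j) m (((g:ℝ)-ZZ)/2^20) ((Pl:ℝ)/2^40) ((Ql:ℝ)/2^40)

theorem blocks_spec (k : ℕ → ℕ → ℕ → ℕ → ℕ → ℕ → ℕ → ℕ → Bool) (e : ℕ) : ∀ (n X m cur h g Pu Qu Pl Ql : ℕ),
    blocks n e X m cur h g Pu Qu Pl Ql k = true → Inv m cur h g Pu Qu Pl Ql →
    (∀ i, m + i < e → gz (m-1+(i+1)) = gz (m-1+i) + dg X i - 512) →
    ∃ m' cur' h' g' Pu' Qu' Pl' Ql', k m' cur' h' g' Pu' Qu' Pl' Ql' = true ∧ Inv m' cur' h' g' Pu' Qu' Pl' Ql' := by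
  intro n
  induction n with
  | zero =>
    intro X m cur h g Pu Qu Pl Ql H I _
    rw [blocks] at H
    exact ⟨m, cur, h, g, Pu, Qu, Pl, Ql, H, I⟩
  | succ n ih =>
    intro X m cur h g Pu Qu Pl Ql H I hX
    rw [blocks, frc_eq] at H
    generalize bnum m = nb at H
    rcases c : (Nat.ble 1 nb && (Nat.ble (m + 32*nb) e && Nat.beq ((m + 32*nb - 1)/1024) (m/1024))) with _ | _
    · rw [c] at H; simp at H
    rw [c, cond_true, frc_eq] at H
    simp only [Bool.and_eq_true, Nat.ble_eq, Nat.beq_eq] at c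
    obtain ⟨c1, c2, c3⟩ := c
    obtain ⟨hm, hc, hu, hl⟩ := I
    obtain ⟨cur', mx, mn, a1, a2, -, -, a5⟩ := lanesB_spec _ nb (fun i => gz (m-1+i)) _ cur 0 (2^40) H hc (by
      intro i hi
      rw [dg_mod X _ i hi]
      exact hX i (by omega))
    rcases c4 : Nat.ble (2^20 * mn + aLo*(m/1024)) (ZZ + 2^20*(1+OFF)) with _ | _
    · rw [c4] at a1; simp at a1
    rw [c4, cond_true, frc_eq, frc_eq] at a1
    have c4 := Nat.le_of_ble_eq_true c4
    obtain ⟨Pu', Qu', b1, b2, b3⟩ := upd_spec a1 hm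
    obtain ⟨Pl', Ql', d1, d2, d3⟩ := upd_spec b1 hm
    rw [frc_eq, frc_eq] at d1
    have hdiv : ∀ j, m ≤ j → j < m + 32*nb → j/1024 = m/1024 := by
      intro j h1 h2
      apply le_antisymm
      · rw [← c3]; exact Nat.div_le_div_right (by omega)
      · exact Nat.div_le_div_right h1
    have hgz : ∀ j, m ≤ j → j < m + 32*nb → (mn:ℝ) ≤ gz j ∧ (gz j : ℝ) ≤ mx := by
      intro j h1 h2
      have := a5 (j - (m-1)) (by omega) (by omega)
      rw [show m - 1 + (j - (m-1)) = j by omega] at this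
      exact ⟨by exact_mod_cast this.1, by exact_mod_cast this.2⟩
    have hq : (0:ℝ) ≤ ((m/1024 : ℕ) : ℝ) := Nat.cast_nonneg _
    refine ih _ _ _ _ _ _ _ _ _ d1 ⟨by omega, ?_, ?_, ?_⟩ ?_
    · exact Eq.trans (congrArg gz (by omega)) a2
    · refine hu.extend (32*nb) (by omega) hm _ _ _ ?_ b2 b3
      intro j h1 h2
      rw [BB, FB_eq, hdiv j h1 h2, Nat.cast_sub c4]
      have h3 := (hgz j h1 h2).1
      have h4 := mul_le_mul_of_nonneg_right aD_lo hq
      rw [le_div_iff₀ (by positivity)]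
      simp only [Nat.cast_add, Nat.cast_mul, Nat.cast_pow, Nat.cast_ofNat, Nat.cast_one]
      have e1 : (aLo:ℝ) * ((m/1024 : ℕ) : ℝ) = (aLo:ℝ)/2^20 * ((m/1024 : ℕ) : ℝ) * 2^20 := by ring
      rw [e1]
      generalize (aLo:ℝ)/2^20 * ((m/1024 : ℕ) : ℝ) = u at *
      generalize aD * ((m/1024 : ℕ) : ℝ) = v at *
      linarith
    · refine hl.extend (32*nb) (by omega) hm _ _ _ ?_ d2 d3
      intro j h1 h2
      have hZ : 2^20*(1+OFF) ≤ ZZ + 2^20 * mx + (aLo+1)*(m/1024) := by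
        have : 2^20*(1+OFF) ≤ ZZ := by unfold OFF ZZ; norm_num
        omega
      simp only [BB]
      rw [FB_eq, hdiv j h1 h2, Nat.cast_sub hZ]
      have h3 := (hgz j h1 h2).2
      have h4 := mul_le_mul_of_nonneg_right aD_hi hq
      rw [le_div_iff₀ (by positivity)]
      simp only [Nat.cast_add, Nat.cast_mul, Nat.cast_pow, Nat.cast_ofNat, Nat.cast_one]
      have e1 : ((aLo:ℝ)+1) * ((m/1024 : ℕ) : ℝ) = ((aLo:ℝ)+1)/2^20 * ((m/1024 : ℕ) : ℝ) * 2^20 := by ring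
      rw [e1]
      generalize ((aLo:ℝ)+1)/2^20 * ((m/1024 : ℕ) : ℝ) = u at *
      generalize aD * ((m/1024 : ℕ) : ℝ) = v at *
      linarith
    · intro i hi
      have := hX (32*nb+i) (by omega)
      rw [dg_div]
      rw [show m + 32*nb - 1 + (i+1) = m - 1 + (32*nb + i + 1) by omega, show m + 32*nb - 1 + i = m - 1 + (32*nb + i) by omega]
      exact this

theorem seg_spec {n m l cur h g Pu Qu Pl Ql m' cur' h' g' Pu' Qu' Pl' Ql' e : ℕ}
    (H : blocks n e (XX m l) m cur h g Pu Qu Pl Ql (fin m' cur' h' g' Pu' Qu' Pl' Ql') = true)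
    (he : e = m + l) (I : Inv m cur h g Pu Qu Pl Ql) : Inv m' cur' h' g' Pu' Qu' Pl' Ql' := by
  obtain ⟨x1, x2, x3, x4, x5, x6, x7, x8, h1, h2⟩ := blocks_spec _ e n _ _ _ _ _ _ _ _ _ H I (by
    intro i hi
    exact gz_XX m l i I.hm (by omega))
  simp only [fin, Bool.and_eq_true, Nat.beq_eq] at h1
  obtain ⟨⟨rfl, rfl⟩, ⟨rfl, rfl⟩, ⟨rfl, rfl⟩, rfl, rfl⟩ := h1
  exact h2

theorem inv0 : Inv 1024 1073741825 1152921504606846976 1152921504606846976 0 0 0 0 := by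
  obtain ⟨cur', mx, mn, a1, a2, -, -, a5⟩ := lanesB_spec _ 32 gz _ OFF 0 (2^40) seg0 gz_zero (by
      intro i hi
      have := gz_XX 1 1024 i le_rfl hi
      rw [show 1-1+(i+1)=i+1 by omega, show 1-1+i = i by omega] at this
      exact this)
  simp only [Bool.and_eq_true, Nat.beq_eq] at a1
  obtain ⟨rfl, rfl⟩ := a1
  have hg : ∀ j, 1 ≤ j → j < 1024 → gz j = ((OFF+1 : ℕ) : ℤ) := by
    intro j h1 h2
    have := a5 j h1 (by omega)
    omega
  have hB : ∀ j, 1 ≤ j → j < 1024 → BB j = 0 := by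
    intro j h1 h2
    rw [BB, FB_eq, hg j h1 h2, Nat.div_eq_of_lt h2]; push_cast; ring
  refine ⟨by norm_num, ?_, ?_, ?_⟩
  · rw [hg _ (by norm_num) (by norm_num)]; simp [OFF]
  · refine ⟨[], by simp, ?_, ?_, by simp [PL], by simp [QL]⟩
    · simp [ZZ]
    · intro j h1 h2; rw [hB j h1 h2]; simp [HL]
  · refine ⟨[], by simp, ?_, ?_, by simp [PL], by simp [QL]⟩
    · simp [ZZ]
    · intro j h1 h2; beta_reduce; rw [hB j h1 h2]; simp [HL]

theorem inv8 : Inv 262144 1073741434 1152921504624287583 1152921504621912480 74207904242 70034558768 81440550161 76172173574 :=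
  seg_spec seg8 rfl (seg_spec seg7 rfl (seg_spec seg6 rfl (seg_spec seg5 rfl (seg_spec seg4 rfl (seg_spec seg3 rfl (seg_spec seg2 rfl (seg_spec seg1 rfl inv0)))))))

theorem ps_sumR : ∑ d ∈ range 1024, (ps d : ℝ) = 310 := by exact_mod_cast ps_sum
theorem ng_sumR : ∑ d ∈ range 1024, (ng d : ℝ) = 314 := by exact_mod_cast ng_sum

theorem BB_frac (m : ℕ) : BB m = 1 + ∑ d ∈ range 1024, ((ps d : ℝ) - ng d) * ((m:ℝ)/d - ((m/d : ℕ):ℝ)) + aD * ((m:ℝ)/1024 - ((m/1024 : ℕ):ℝ)) := by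
  have h : ∑ d ∈ range 1024, ((ps d : ℝ) - ng d) * ((m:ℝ)/d) = - aD/1024 * m := by
    rw [aD, neg_mul, neg_neg, mul_div_assoc, mul_comm (1024:ℝ), div_mul_cancel₀ _ (by norm_num), sum_mul]
    apply sum_congr rfl; intro d _; ring
  rw [BB, FB, sum_Icc_1024 _ (by simp), ac_D, sum_congr rfl (fun d h => by rw [ac_lt h])]
  simp only [mul_sub, sum_sub_distrib]
  rw [h]; push_cast; ring

theorem frac_bd (m d : ℕ) : 0 ≤ (m:ℝ)/d - ((m/d : ℕ):ℝ) ∧ (m:ℝ)/d - ((m/d : ℕ):ℝ) ≤ 1 := by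
  constructor
  · have : ((m/d : ℕ):ℝ) ≤ (m:ℝ)/d := Nat.cast_div_le
    linarith
  · have := (Nat.lt_floor_add_one ((m:ℝ) / (d:ℝ) : ℝ)).le
    rw [Nat.floor_div_eq_div] at this
    linarith

theorem aD_le2 : aD ≤ 2 := aD_hi.trans (by unfold aLo; norm_num)

theorem BB_le (m : ℕ) : BB m ≤ 313 := by
  rw [BB_frac]
  have h1 : ∑ d ∈ range 1024, ((ps d : ℝ) - ng d) * ((m:ℝ)/d - ((m/d : ℕ):ℝ)) ≤ ∑ d ∈ range 1024, (ps d : ℝ) := by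
    apply sum_le_sum
    intro d _
    obtain ⟨a, b⟩ := frac_bd m d
    have h1 : (0:ℝ) ≤ ps d := Nat.cast_nonneg _
    have h2 : (0:ℝ) ≤ ng d := Nat.cast_nonneg _
    nlinarith
  rw [ps_sumR] at h1
  have h3 : aD * ((m:ℝ)/1024 - ((m/1024 : ℕ):ℝ)) ≤ 2 * 1 := by
    obtain ⟨a, b⟩ := frac_bd m 1024
    exact mul_le_mul aD_le2 (by exact_mod_cast b) (by exact_mod_cast a) (by norm_num)
  linarith

theorem BB_ge (m : ℕ) : -BB m ≤ 313 := by
  rw [BB_frac]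
  have h1 : -∑ d ∈ range 1024, ((ps d : ℝ) - ng d) * ((m:ℝ)/d - ((m/d : ℕ):ℝ)) ≤ ∑ d ∈ range 1024, (ng d : ℝ) := by
    rw [← sum_neg_distrib]
    apply sum_le_sum
    intro d _
    obtain ⟨a, b⟩ := frac_bd m d
    have h1 : (0:ℝ) ≤ ps d := Nat.cast_nonneg _
    have h2 : (0:ℝ) ≤ ng d := Nat.cast_nonneg _
    nlinarith
  rw [ng_sumR] at h1
  have h3 : 0 ≤ aD * ((m:ℝ)/1024 - ((m/1024 : ℕ):ℝ)) := by
    obtain ⟨a, b⟩ := frac_bd m 1024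
    exact mul_nonneg aD_pos (by exact_mod_cast a)
  linarith

theorem fullU : Full BB 262144 0.068623 0.063696 := by
  refine inv8.hu.finish (by norm_num) 313 _ _ (fun m _ => BB_le m) ?_ ?_
  · rw [max_eq_left (by unfold ZZ; norm_num)]; unfold ZZ; norm_num
  · rw [max_eq_right (by unfold ZZ; norm_num)]; norm_num
theorem fullL : Full (fun m => -BB m) 262144 0.075210 0.069278 := by
  refine inv8.hl.finish (by norm_num) 313 _ _ (fun m _ => BB_ge m) ?_ ?_
  · rw [max_eq_left (by unfold ZZ; norm_num)]; unfold ZZ; norm_num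
  · rw [max_eq_right (by unfold ZZ; norm_num)]; norm_num

theorem ac_abs : ∑ d ∈ Icc 1 1024, |ac d| ≤ 626 := by
  rw [sum_Icc_1024 _ (by rw [ac_0, abs_zero]), ac_D, abs_of_nonneg aD_pos]
  have h1 : ∑ d ∈ range 1024, |ac d| ≤ ∑ d ∈ range 1024, ((ps d : ℝ) + ng d) := by
    apply sum_le_sum
    intro d hd
    rw [ac_lt hd]
    have h1 : (0:ℝ) ≤ ps d := Nat.cast_nonneg _
    have h2 : (0:ℝ) ≤ ng d := Nat.cast_nonneg _
    rw [abs_le]; constructor <;> linarith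
  rw [sum_add_distrib, ps_sumR, ng_sumR] at h1
  linarith [aD_le2]
end CH
end

section
open Finset
namespace CH

def RR : ℕ := 1152921504606846976
def L2 : ℕ := 799144290322616869
def lg (d : ℕ) : ℕ := frc (Nat.log2 d) fun k => frc (d - 2^k) fun u => frc (d + 2^k) fun v =>
  k * L2 + ∑ i ∈ range 12, 2*RR*u^(2*i+1)/((2*i+1)*v^(2*i+1))
def recS (f : ℕ → ℕ) (n : ℕ) : ℕ := Nat.rec 0 (fun i s => s + f i) n
def lgK (d : ℕ) : ℕ := frc (Nat.log2 d) fun k => frc (d - 2^k) fun u => frc (d + 2^k) fun v =>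
  k * L2 + recS (fun i => 2*RR*u^(2*i+1)/((2*i+1)*v^(2*i+1))) 12

theorem rec_sum (f : ℕ → ℕ) (n : ℕ) : recS f n = ∑ i ∈ range n, f i := by
  induction n with
  | zero => rfl
  | succ n ih => rw [sum_range_succ, ← ih]; rfl
theorem lgK_eq (d : ℕ) : lgK d = lg d := by
  unfold lgK lg
  simp only [frc_eq, rec_sum]

theorem floor_pair (x y : ℕ) : ((x/y : ℕ):ℝ) ≤ (x:ℝ)/y ∧ (x:ℝ)/y ≤ ((x/y : ℕ):ℝ) + 1 := by
  constructor
  · exact Nat.cast_div_le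
  · have := (Nat.lt_floor_add_one ((x:ℝ) / (y:ℝ) : ℝ)).le
    rwa [Nat.floor_div_eq_div] at this

theorem log_series (u v : ℕ) (hv : 0 < v) (hu : 3 * u ≤ v) :
    |Real.log (((v:ℝ)+u)/(v-u)) - ((∑ i ∈ range 12, 2*RR*u^(2*i+1)/((2*i+1)*v^(2*i+1)) : ℕ) : ℝ)/RR| ≤ 1/10^11 := by
  have hv' : (0:ℝ) < v := by exact_mod_cast hv
  have hu' : 3 * (u:ℝ) ≤ v := by exact_mod_cast hu
  have hu0 : (0:ℝ) ≤ u := Nat.cast_nonneg _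
  have hR : (0:ℝ) < RR := by unfold RR; norm_num
  set x : ℝ := u/v with hx
  have x0 : 0 ≤ x := by positivity
  have x1 : x ≤ 1/3 := by rw [hx, div_le_iff₀ hv']; linarith
  have e : (1+x)/(1-x) = ((v:ℝ)+u)/(v-u) := by
    have h2 : (v:ℝ) - u ≠ 0 := by linarith
    have h3 : 1 - (u:ℝ)/v ≠ 0 := by rw [hx] at x1; linarith
    rw [hx, div_eq_div_iff h3 h2]; field_simp
  have h1 := Real.sum_range_le_log_div x0 (by linarith) 12
  have h2 := Real.log_div_le_sum_range_add x0 (by linarith) 12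
  rw [e] at h1 h2
  have h3 : x^(2*12+1)/(1-x^2) ≤ 1/10^11/3 := by
    calc x^(2*12+1)/(1-x^2) ≤ (1/3)^(2*12+1)/(1-(1/3)^2) := by
          gcongr
      _ ≤ _ := by norm_num
  have h4 : ∀ i, ((2*RR*u^(2*i+1)/((2*i+1)*v^(2*i+1)) : ℕ) : ℝ) ≤ 2 * RR * (x^(2*i+1)/(2*i+1)) ∧
      2 * RR * (x^(2*i+1)/(2*i+1)) ≤ ((2*RR*u^(2*i+1)/((2*i+1)*v^(2*i+1)) : ℕ) : ℝ) + 1 := by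
    intro i
    have := floor_pair (2*RR*u^(2*i+1)) ((2*i+1)*v^(2*i+1))
    have e : ((2*RR*u^(2*i+1) : ℕ):ℝ) / (((2*i+1)*v^(2*i+1) : ℕ):ℝ) = 2 * RR * (x^(2*i+1)/(2*i+1)) := by
      rw [hx, div_pow]; push_cast; field_simp
    rwa [e] at this
  have h5 : ((∑ i ∈ range 12, 2*RR*u^(2*i+1)/((2*i+1)*v^(2*i+1)) : ℕ) : ℝ) ≤ 2 * RR * ∑ i ∈ range 12, x^(2*i+1)/(2*i+1) := by
    rw [Nat.cast_sum, mul_sum]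
    exact sum_le_sum fun i _ => (h4 i).1
  have h6 : 2 * RR * ∑ i ∈ range 12, x^(2*i+1)/(2*i+1) ≤ ((∑ i ∈ range 12, 2*RR*u^(2*i+1)/((2*i+1)*v^(2*i+1)) : ℕ) : ℝ) + 12 := by
    have : ((∑ i ∈ range 12, 2*RR*u^(2*i+1)/((2*i+1)*v^(2*i+1)) : ℕ) : ℝ) + 12 = ∑ i ∈ range 12, (((2*RR*u^(2*i+1)/((2*i+1)*v^(2*i+1)) : ℕ) : ℝ) + 1) := by
      rw [sum_add_distrib, Nat.cast_sum]; simp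
    rw [this, mul_sum]
    exact sum_le_sum fun i _ => (h4 i).2
  generalize ((∑ i ∈ range 12, 2*RR*u^(2*i+1)/((2*i+1)*v^(2*i+1)) : ℕ) : ℝ) = T at *
  generalize ∑ i ∈ range 12, x^(2*i+1)/(2*i+1) = S at *
  have h7 : T/RR ≤ 2*S := by rw [div_le_iff₀ hR]; linarith
  have h8 : 2*S ≤ T/RR + 12/RR := by rw [← add_div, le_div_iff₀ hR]; linarith
  have h9 : (12:ℝ)/RR ≤ 1/10^11/10 := by unfold RR; norm_num
  rw [abs_le]
  constructor <;> linarith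

theorem lg_bd (d : ℕ) (h1 : 1 ≤ d) (h2 : d < 1024) : |Real.log d - (lg d : ℝ)/RR| ≤ 1/10^9 := by
  unfold lg
  simp only [frc_eq]
  generalize hk : Nat.log2 d = k
  have k1 : 2^k ≤ d := by rw [← hk]; exact Nat.log2_self_le (by omega)
  have k2 : d < 2^(k+1) := by rw [← hk]; exact Nat.lt_log2_self
  have k3 : k ≤ 9 := by
    by_contra c
    have : 2^10 ≤ 2^k := Nat.pow_le_pow_right (by norm_num) (by omega)
    omega
  have kp : 0 < 2^k := by positivity
  have hs := log_series (d - 2^k) (d + 2^k) (by omega) (by rw [pow_succ] at k2; omega)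
  generalize (∑ i ∈ range 12, 2*RR*(d - 2^k)^(2*i+1)/((2*i+1)*(d + 2^k)^(2*i+1)) : ℕ) = T at *
  have hd : (0:ℝ) < d := by exact_mod_cast h1
  have e : (((d + 2^k : ℕ):ℝ)+((d - 2^k : ℕ):ℝ))/(((d + 2^k : ℕ):ℝ)-((d - 2^k : ℕ):ℝ)) = d / 2^k := by
    rw [Nat.cast_sub k1]; push_cast
    have : (0:ℝ) < 2^k := by positivity
    field_simp; ring
  rw [e, Real.log_div (by positivity) (by positivity), Real.log_pow] at hs
  have hl := Real.log_two_near_10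
  rw [abs_le] at hl hs
  have hL : (L2:ℝ)/RR ≤ 287209/414355 ∧ (287209:ℝ)/414355 ≤ (L2:ℝ)/RR + 1/10^11 := by
    unfold L2 RR; norm_num
  have e2 : ((k * L2 + T : ℕ):ℝ)/RR = k * ((L2:ℝ)/RR) + T/RR := by push_cast; ring
  rw [e2]
  have hk' : (k:ℝ) ≤ 9 := by exact_mod_cast k3
  have hk0 : (0:ℝ) ≤ k := Nat.cast_nonneg _
  generalize (L2:ℝ)/RR = L at *
  have m1 : (k:ℝ) * (Real.log 2 - L) ≤ 9 * (2/10^10) := by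
    apply (mul_le_mul_of_nonneg_left (show Real.log 2 - L ≤ 2/10^10 by linarith [hl.2, hL.2]) hk0).trans
    gcongr
  have m2 : (k:ℝ) * (L - Real.log 2) ≤ 9 * (1/10^10) := by
    apply (mul_le_mul_of_nonneg_left (show L - Real.log 2 ≤ 1/10^10 by linarith [hl.1, hL.1]) hk0).trans
    gcongr
  have m3 : (k:ℝ) * (Real.log 2 - L) ≤ 9 * (1/10^10 + 1/10^11/10^0) := by
    apply (mul_le_mul_of_nonneg_left (show Real.log 2 - L ≤ 1/10^10 + 1/10^11/10^0 by linarith [hl.2, hL.2]) hk0).trans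
    gcongr
  rw [abs_le]
  constructor
  · norm_num at *; linarith [hs.1]
  · norm_num at *; linarith [hs.2]

theorem psT : ∑ d ∈ range 1024, ps d * (lg d/d) = 7973999889907031147 := by
  have h := sumB_zero (fun d => ps d * (lgK d/d)) 10
  rw [show (2:ℕ)^10 = 1024 by norm_num] at h
  simp only [← lgK_eq]
  rw [← h]; decide +kernel
theorem ngT : ∑ d ∈ range 1024, ng d * (lg d/d) = 9139403017433728416 := by
  have h := sumB_zero (fun d => ng d * (lgK d/d)) 10
  rw [show (2:ℕ)^10 = 1024 by norm_num] at h
  simp only [← lgK_eq]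
  rw [← h]; decide +kernel

theorem log_sum_bd (w : ℕ → ℕ) (hw : ∀ d, w d ≤ 1) (T : ℕ) (hT : ∑ d ∈ range 1024, w d * (lg d/d) = T) (A : ℝ)
    (hA : ∑ d ∈ range 1024, (w d : ℝ)/d ≤ A) :
    |∑ d ∈ range 1024, (w d : ℝ)/d * Real.log d - (T:ℝ)/RR| ≤ A/10^9 + 1024/RR := by
  have hR : (0:ℝ) < RR := by unfold RR; norm_num
  have hT' : (T:ℝ)/RR = ∑ d ∈ range 1024, (w d : ℝ) * ((lg d/d : ℕ):ℝ)/RR := by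
    rw [← hT, Nat.cast_sum, sum_div]
    apply sum_congr rfl; intro d _; rw [Nat.cast_mul]
  rw [hT', ← sum_sub_distrib]
  refine (abs_sum_le_sum_abs _ _).trans ?_
  have : A/10^9 + 1024/RR ≥ ∑ d ∈ range 1024, ((w d : ℝ)/d * (1/10^9) + 1/RR) := by
    rw [sum_add_distrib, ← sum_mul, sum_const, card_range, nsmul_eq_mul]
    push_cast
    have : (∑ d ∈ range 1024, (w d : ℝ)/d) * (1/10^9) ≤ A * (1/10^9) := by gcongr
    rw [ge_iff_le, div_eq_mul_one_div A, div_eq_mul_one_div (1024:ℝ)]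
    linarith
  refine le_trans (sum_le_sum ?_) this
  intro d hd
  have hd := mem_range.1 hd
  rcases Nat.eq_zero_or_pos d with rfl | hp
  · simp
  have h1 := abs_le.1 (lg_bd d hp hd)
  obtain ⟨f1, f2⟩ := floor_pair (lg d) d
  have hw1 : (w d : ℝ) ≤ 1 := by exact_mod_cast hw d
  have hw0 : (0:ℝ) ≤ w d := Nat.cast_nonneg _
  have hd' : (0:ℝ) < d := by exact_mod_cast hp
  have e1 : (w d : ℝ)/d * Real.log d - (w d : ℝ) * ((lg d/d : ℕ):ℝ)/RR = (w d : ℝ)/d * (Real.log d - (lg d:ℝ)/RR) + (w d:ℝ) * ((lg d:ℝ)/d - ((lg d/d : ℕ):ℝ))/RR := by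
    field_simp; ring
  rw [e1]
  have hq : (0:ℝ) ≤ (w d:ℝ)/d := div_nonneg hw0 hd'.le
  refine (abs_add_le _ _).trans (add_le_add ?_ ?_)
  · rw [abs_mul, abs_of_nonneg hq]
    exact mul_le_mul_of_nonneg_left (abs_le.2 h1) hq
  · rw [abs_div, abs_of_pos hR]
    apply div_le_div_of_nonneg_right _ hR.le
    rw [abs_mul, abs_of_nonneg hw0]
    have : |(lg d:ℝ)/d - ((lg d/d : ℕ):ℝ)| ≤ 1 := by rw [abs_le]; constructor <;> linarith
    exact mul_le_one₀ hw1 (abs_nonneg _) this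

theorem alpha_bd : 1.000463 ≤ -∑ d ∈ Icc 1 1024, ac d / d * Real.log d ∧ -∑ d ∈ Icc 1 1024, ac d / d * Real.log d ≤ 1.000465 := by
  have hp := abs_le.1 (log_sum_bd ps ps_le _ psT 3 (ps_inv.2.trans (by norm_num)))
  have hn := abs_le.1 (log_sum_bd ng ng_le _ ngT 3 (ng_inv.2.trans (by norm_num)))
  have e : -∑ d ∈ Icc 1 1024, ac d / d * Real.log d = ∑ d ∈ range 1024, (ng d : ℝ)/d * Real.log d - ∑ d ∈ range 1024, (ps d : ℝ)/d * Real.log d - aD/1024 * (10 * Real.log 2) := by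
    rw [sum_Icc_1024 _ (by simp), ac_D, ← sum_sub_distrib]
    have : Real.log ((1024:ℕ):ℝ) = 10 * Real.log 2 := by
      rw [show ((1024:ℕ):ℝ) = 2^10 by norm_num, Real.log_pow]; norm_num
    rw [this, neg_add, ← sum_neg_distrib, ← sub_eq_add_neg]
    refine congrArg₂ _ (sum_congr rfl ?_) (by push_cast; ring)
    intro d hd
    rw [ac_lt hd]; ring
  rw [e, aD_eq]
  have p1 := ps_inv; have n1 := ng_inv
  have l1 := Real.log_two_gt_d9; have l2 := Real.log_two_lt_d9
  generalize ∑ d ∈ range 1024, (ng d : ℝ)/d * Real.log d = X at *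
  generalize ∑ d ∈ range 1024, (ps d : ℝ)/d * Real.log d = Y at *
  have e2 : 1024 * (∑ d ∈ range 1024, (ng d : ℝ) / d - ∑ d ∈ range 1024, (ps d : ℝ) / d) / 1024 * (10 * Real.log 2) = 
     (∑ d ∈ range 1024, (ng d : ℝ) / d - ∑ d ∈ range 1024, (ps d : ℝ) / d) * (10 * Real.log 2) := by ring
  rw [e2]
  have d1 : 0.00149497 ≤ ∑ d ∈ range 1024, (ng d : ℝ) / d - ∑ d ∈ range 1024, (ps d : ℝ) / d := by
    have := n1.1; have := p1.2; norm_num at *; linarith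
  have d2 : ∑ d ∈ range 1024, (ng d : ℝ) / d - ∑ d ∈ range 1024, (ps d : ℝ) / d ≤ 0.00149498 := by
    have := n1.2; have := p1.1; norm_num at *; linarith
  generalize ∑ d ∈ range 1024, (ng d : ℝ) / d - ∑ d ∈ range 1024, (ps d : ℝ) / d = δ at *
  have u1 : δ * (10 * Real.log 2) ≤ 0.00149498 * (10 * 0.6931471808) := by gcongr
  have u2 : 0.00149497 * (10 * 0.6931471803) ≤ δ * (10 * Real.log 2) := by gcongr
  have := hp.1; have := hp.2; have := hn.1; have := hn.2
  unfold RR at *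
  norm_num at *
  constructor <;> linarith
end CH
end

section
open Finset
namespace CH

noncomputable def ch (d : ℕ) : ℝ := if d = 1 then 1 else if d = 2 then -1 else if d = 3 then -1 else if d = 5 then -1 else if d = 30 then 1 else 0

theorem ch_sum (f : ℕ → ℝ) : ∑ d ∈ Icc 1 30, ch d * f d = f 1 - f 2 - f 3 - f 5 + f 30 := by
  rw [show Icc 1 30 = Ico 1 31 from rfl, sum_Ico_eq_sum_range]
  simp only [ch, sum_range_succ, sum_range_zero]
  norm_num
  ring

theorem ch_s : ∑ d ∈ Icc 1 30, ch d / d = 0 := by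
  simp only [div_eq_mul_inv]
  rw [ch_sum (fun d => ((d:ℝ))⁻¹)]; norm_num

theorem ch_E : ∑ d ∈ Icc 1 30, |ch d| ≤ 5 := by
  rw [show Icc 1 30 = Ico 1 31 from rfl, sum_Ico_eq_sum_range]
  simp only [ch, sum_range_succ, sum_range_zero]
  norm_num

theorem ch_FB (m : ℕ) : FB ch 30 m = 1 - (m - ((m/2 : ℕ):ℝ) - ((m/3 : ℕ):ℝ) - ((m/5 : ℕ):ℝ) + ((m/30 : ℕ):ℝ)) := by
  rw [FB, ch_sum (fun d => ((m/d : ℕ):ℝ))]; simp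

theorem ch_FB_ge (m : ℕ) : 0 ≤ FB ch 30 m := by
  rw [ch_FB]
  have : m + m/30 ≤ 1 + m/2 + m/3 + m/5 := by omega
  have : (m:ℝ) + ((m/30 : ℕ):ℝ) ≤ 1 + ((m/2 : ℕ):ℝ) + ((m/3 : ℕ):ℝ) + ((m/5 : ℕ):ℝ) := by exact_mod_cast this
  linarith
theorem ch_FB_le (m : ℕ) : FB ch 30 m ≤ 1 := by
  rw [ch_FB]
  have : m/2 + m/3 + m/5 ≤ m + m/30 := by omega
  have : ((m/2 : ℕ):ℝ) + ((m/3 : ℕ):ℝ) + ((m/5 : ℕ):ℝ) ≤ (m:ℝ) + ((m/30 : ℕ):ℝ) := by exact_mod_cast this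
  linarith
theorem ch_FB_small (m : ℕ) (h1 : 1 ≤ m) (h2 : m < 6) : FB ch 30 m ≤ 0 := by
  rw [ch_FB]
  have : 1 + m/2 + m/3 + m/5 ≤ m + m/30 := by omega
  have : 1 + ((m/2 : ℕ):ℝ) + ((m/3 : ℕ):ℝ) + ((m/5 : ℕ):ℝ) ≤ (m:ℝ) + ((m/30 : ℕ):ℝ) := by exact_mod_cast this
  linarith

theorem ch_fullU : Full (FB ch 30) 6 (1/6) 0 := by
  refine ⟨[(6, 1)], by simp, ?_, by norm_num [PL], by norm_num [QL]⟩
  intro m hm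
  by_cases c : m < 6
  · have := ch_FB_small m hm c
    have c' : ¬ 6 ≤ m := by omega
    simp only [HL, List.map, List.sum_cons, List.sum_nil]
    rw [if_neg c']; linarith
  · have := ch_FB_le m
    have c' : 6 ≤ m := by omega
    simp [HL, c']; linarith

theorem ch_fullL : Full (fun m => -FB ch 30 m) 6 0 0 := by
  refine ⟨[], by simp, ?_, by simp [PL], by simp [QL]⟩
  intro m hm
  have := ch_FB_ge m
  simp [HL]; linarith

theorem lg3 : |Real.log 3 - 1.0986122887| ≤ 2/10^9 := by
  have h := abs_le.1 (lg_bd 3 (by norm_num) (by norm_num))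
  have e : lg 3 = 1266613732828259612 := by rw [← lgK_eq]; decide +kernel
  rw [e] at h
  unfold RR at h
  rw [abs_le]
  norm_num at h ⊢
  constructor <;> linarith [h.1, h.2]
theorem lg5 : |Real.log 5 - 1.6094379124| ≤ 2/10^9 := by
  have h := abs_le.1 (lg_bd 5 (by norm_num) (by norm_num))
  have e : lg 5 = 1855555579569727611 := by rw [← lgK_eq]; decide +kernel
  rw [e] at h
  unfold RR at h
  rw [abs_le]
  norm_num at h ⊢
  constructor <;> linarith [h.1, h.2]
theorem lg11 : |Real.log 11 - 2.3978952727| ≤ 2/10^9 := by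
  have h := abs_le.1 (lg_bd 11 (by norm_num) (by norm_num))
  have e : lg 11 = 2764585025796695817 := by rw [← lgK_eq]; decide +kernel
  rw [e] at h
  unfold RR at h
  rw [abs_le]
  norm_num at h ⊢
  constructor <;> linarith [h.1, h.2]

theorem ch_alpha : 0.92129 ≤ -∑ d ∈ Icc 1 30, ch d / d * Real.log d ∧ -∑ d ∈ Icc 1 30, ch d / d * Real.log d ≤ 0.921293 := by
  have e : -∑ d ∈ Icc 1 30, ch d / d * Real.log d = Real.log 2 * (1/2-1/30) + Real.log 3 * (1/3-1/30) + Real.log 5 * (1/5-1/30) := by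
    have : ∀ d ∈ Icc 1 30, ch d / (d:ℝ) * Real.log d = ch d * (Real.log d / d) := by intro d _; ring
    rw [sum_congr rfl this, ch_sum (fun d => Real.log d / d)]
    push_cast
    rw [show (30:ℝ) = 2 * 3 * 5 by norm_num, Real.log_mul (by norm_num) (by norm_num), Real.log_mul (by norm_num) (by norm_num)]
    norm_num; ring
  rw [e]
  have h3 := abs_le.1 lg3; have h5 := abs_le.1 lg5
  have l1 := Real.log_two_gt_d9; have l2 := Real.log_two_lt_d9
  norm_num at *
  constructor <;> linarith [h3.1, h3.2, h5.1, h5.2]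

theorem logx_div (X x l : ℝ) (hX : Real.exp 1 ≤ X) (hl : Real.log X ≤ l) (hx : X ≤ x) : Real.log x + 1 ≤ (l+1)/X * x := by
  have h1 : Real.log x / x ≤ Real.log X / X := Real.log_div_self_antitoneOn hX (hX.trans hx) hx
  have hX0 : 0 < X := (Real.exp_pos 1).trans_le hX
  have hx0 : 0 < x := hX0.trans_le hx
  have h2 : Real.log X / X ≤ l / X := by gcongr
  have h3 := h1.trans h2
  rw [div_le_iff₀ hx0] at h3
  have h4 : 1 ≤ 1/X * x := by rw [div_mul_eq_mul_div, one_mul, le_div_iff₀ hX0]; linarith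
  calc _ ≤ l/X * x + 1/X*x := by linarith
    _ = _ := by ring

theorem log_220 : Real.log 220 ≤ 5.39364 := by
  rw [show (220:ℝ) = 2^2*5*11 by norm_num, Real.log_mul (by norm_num) (by norm_num), Real.log_mul (by norm_num) (by norm_num), Real.log_pow]
  have h3 := abs_le.1 lg11; have h5 := abs_le.1 lg5
  have l2 := Real.log_two_lt_d9
  norm_num at *
  linarith [h3.2, h5.2]
theorem log_6 : Real.log 6 ≤ 1.79177 := by
  rw [show (6:ℝ) = 2*3 by norm_num, Real.log_mul (by norm_num) (by norm_num)]
  have h3 := abs_le.1 lg3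
  have l2 := Real.log_two_lt_d9
  norm_num at *
  linarith [h3.2]

theorem exp1_le : Real.exp 1 ≤ 3 := by linarith [Real.exp_one_lt_d9]

theorem bd0 : Bd 0 2.1137 220 := by
  intro x hx
  refine ⟨by rw [zero_mul]; exact Chebyshev.psi_nonneg x, ?_⟩
  refine (Chebyshev.psi_le (by linarith)).trans ?_
  have hx0 : 0 < x := by linarith
  have he : Real.exp 2 ≤ 220 := by
    rw [show (2:ℝ) = 1 + 1 by norm_num, Real.exp_add]; nlinarith [exp1_le, Real.exp_pos 1]
  have h1 : Real.log x / √x ≤ Real.log 220 / √220 := Real.log_div_sqrt_antitoneOn he (he.trans hx) hx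
  have h2 : (14.83:ℝ) ≤ √220 := Real.le_sqrt_of_sq_le (by norm_num)
  have h3 : Real.log 220 / √220 ≤ 5.39364/14.83 := by
    gcongr; exact log_220
  have h4 := h1.trans h3
  have hs : 0 < √x := Real.sqrt_pos.2 hx0
  rw [div_le_iff₀ hs] at h4
  have e : √x * √x = x := Real.mul_self_sqrt hx0.le
  have h5 : √x * Real.log x ≤ 5.39364/14.83 * x := by
    calc _ ≤ √x * (5.39364/14.83 * √x) := by gcongr
      _ = 5.39364/14.83 * (√x * √x) := by ring
      _ = _ := by rw [e]
  have l4 : Real.log 4 ≤ 2 * 0.6931471808 := by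
    rw [show (4:ℝ) = 2^2 by norm_num, Real.log_pow]; push_cast; linarith [Real.log_two_lt_d9]
  have h6 : Real.log 4 * x ≤ 2 * 0.6931471808 * x := by gcongr
  linarith

theorem seed_step {cp Y l cm' cp' Y' : ℝ} (hB : Bd 0 cp Y) (hcp : 0 ≤ cp) (hY : 0 ≤ Y) (h30 : 30 ≤ Y') (hY' : Y * 6 ≤ Y') (hl : Real.log Y' ≤ l)
    (h1 : 0.921293 + cp/6 + 5 * ((l+1)/Y') ≤ cp') (h2 : cm' ≤ 0.92129 - 5 * ((l+1)/Y')) : Bd cm' cp' Y' := by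
  intro x hx
  have h := step ch 30 6 _ 5 (1/6) 0 0 0 0 cp Y ch_s rfl ch_E ch_fullU ch_fullL le_rfl hcp hB hY x (by linarith) (by norm_num; linarith) (by norm_num; linarith)
  have hl := logx_div Y' x l (by linarith [exp1_le]) hl hx
  obtain ⟨a1, a2⟩ := ch_alpha
  generalize -∑ d ∈ Icc 1 30, ch d / d * Real.log d = α at *
  have hx0 : 0 < x := by linarith
  constructor
  · refine le_trans ?_ h.1
    have : cm' * x ≤ (0.92129 - 5 * ((l+1)/Y')) * x := by gcongr
    have : 0.92129 * x ≤ α * x := by gcongr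
    nlinarith
  · refine h.2.trans ?_
    have : (0.921293 + cp/6 + 5 * ((l+1)/Y')) * x ≤ cp' * x := by gcongr
    have : α * x ≤ 0.921293 * x := by gcongr
    nlinarith

theorem Bd.zero {cm cp Y : ℝ} (h : Bd cm cp Y) : Bd 0 cp Y := fun x hx => ⟨by rw [zero_mul]; exact Chebyshev.psi_nonneg x, (h x hx).2⟩

theorem bd3 : Bd 0.92 1.11338 47520 := by
  have e1 : Real.log 1320 ≤ 7.18541 := by
    rw [show (1320:ℝ) = 220*6 by norm_num, Real.log_mul (by norm_num) (by norm_num)]; linarith [log_220, log_6]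
  have e2 : Real.log 7920 ≤ 8.97718 := by
    rw [show (7920:ℝ) = 1320*6 by norm_num, Real.log_mul (by norm_num) (by norm_num)]; linarith [e1, log_6]
  have e3 : Real.log 47520 ≤ 10.76895 := by
    rw [show (47520:ℝ) = 7920*6 by norm_num, Real.log_mul (by norm_num) (by norm_num)]; linarith [e2, log_6]
  have b1 : Bd 0 1.3046 1320 := seed_step bd0 (by norm_num) (by norm_num) (by norm_num) (by norm_num) e1 (by norm_num) (by norm_num)
  have b2 : Bd 0 1.14504 7920 := seed_step b1 (by norm_num) (by norm_num) (by norm_num) (by norm_num) e2 (by norm_num) (by norm_num)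
  exact seed_step b2 (by norm_num) (by norm_num) (by norm_num) (by norm_num) e3 (by norm_num) (by norm_num)

theorem big_step {cm cp Y cm' cp' Y' : ℝ} (hB : Bd cm cp Y) (hcm : 0 ≤ cm) (hcp : 0 ≤ cp) (hY : 47520 ≤ Y) (hY' : Y * 262144 = Y')
    (h1 : 1.000465 + 0.068623 * cp - 0.063696 * cm + 2/10^6 ≤ cp') (h2 : cm' ≤ 1.000463 - 0.075210 * cp + 0.069278 * cm - 2/10^6) : Bd cm' cp' Y' := by
  intro x hx
  have hY2 : 10^10 ≤ Y' := by norm_num; linarith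
  have h := step ac 1024 262144 _ 626 _ _ _ _ cm cp Y ac_sum rfl ac_abs fullU fullL hcm hcp hB (by linarith) x (by linarith) (by norm_num; linarith) (by norm_num; linarith)
  have hx10 : 10^10 ≤ x := by linarith
  have hl := logx_div (10^10) x 24 (by linarith [exp1_le]) (by
    rw [Real.log_pow, show (10:ℝ) = 2*5 by norm_num, Real.log_mul (by norm_num) (by norm_num)]
    have h5 := abs_le.1 lg5
    have l2 := Real.log_two_lt_d9
    norm_num at *
    linarith [h5.2]) hx10
  obtain ⟨a1, a2⟩ := alpha_bd
  generalize -∑ d ∈ Icc 1 1024, ac d / d * Real.log d = α at *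
  have hx0 : 0 < x := by linarith
  constructor
  · refine le_trans ?_ h.1
    have : cm' * x ≤ (1.000463 - 0.075210 * cp + 0.069278 * cm - 2/10^6) * x := by gcongr
    have : 1.000463 * x ≤ α * x := by gcongr
    norm_num at *
    nlinarith
  · refine h.2.trans ?_
    have : (1.000465 + 0.068623 * cp - 0.063696 * cm + 2/10^6) * x ≤ cp' * x := by gcongr
    have : α * x ≤ 1.000465 * x := by gcongr
    norm_num at *
    nlinarith

theorem bdA : Bd 0.98045 1.01828 (47520*262144) := big_step bd3 (by norm_num) (by norm_num) (by norm_num) rfl (by norm_num) (by norm_num)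
theorem bdB : Bd 0.99179 1.0079 (47520*262144*262144) := big_step bdA (by norm_num) (by norm_num) (by norm_num) rfl (by norm_num) (by norm_num)
theorem bdC : Bd 0.9933 1.0065 (47520*262144*262144*262144) := big_step bdB (by norm_num) (by norm_num) (by norm_num) rfl (by norm_num) (by norm_num)
end CH
end

section
open Finset
namespace CH

theorem J_tail (x : ℝ) (hx : 512 ≤ x) : ∫ t in (512:ℝ)..x, 1 / Real.log t ^ 2 ≤ x / Real.log x ^ 2 + 4 * x / Real.log x ^ 3 := by
  have hlog : ∀ t : ℝ, 512 ≤ t → 6 ≤ Real.log t := by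
    intro t ht
    have h1 : Real.log 512 ≤ Real.log t := Real.log_le_log (by norm_num) ht
    rw [show (512:ℝ) = 2^9 by norm_num, Real.log_pow] at h1
    have := Real.log_two_gt_d9
    push_cast at h1
    linarith
  have hd : ∀ t ∈ Set.uIcc (512:ℝ) x, HasDerivAt (fun t : ℝ => t / Real.log t ^ 2 + 4 * t / Real.log t ^ 3)
      (1 / Real.log t ^ 2 + 2 / Real.log t ^ 3 - 12 / Real.log t ^ 4) t := by
    intro t ht
    rw [Set.uIcc_of_le hx] at ht
    have h6 := hlog t ht.1
    have h0 : Real.log t ≠ 0 := by linarith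
    have ht0 : t ≠ 0 := by linarith [ht.1]
    have hl := Real.hasDerivAt_log ht0
    have a := (hasDerivAt_id t).div (hl.pow 2) (pow_ne_zero 2 h0)
    have b := ((hasDerivAt_id t).const_mul 4).div (hl.pow 3) (pow_ne_zero 3 h0)
    refine (a.add b).congr_deriv ?_
    simp only [id, Pi.pow_apply]
    field_simp
    ring
  have hc : ContinuousOn (fun t : ℝ => 1 / Real.log t ^ 2 + 2 / Real.log t ^ 3 - 12 / Real.log t ^ 4) (Set.uIcc (512:ℝ) x) := by
    rw [Set.uIcc_of_le hx]
    intro t ht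
    have h6 := hlog t ht.1
    have h0 : Real.log t ≠ 0 := by linarith
    have ht0 : t ≠ 0 := by linarith [ht.1]
    have := pow_ne_zero 2 h0
    have := pow_ne_zero 3 h0
    have := pow_ne_zero 4 h0
    refine ContinuousAt.continuousWithinAt ?_
    fun_prop (disch := assumption)
  have hI := hc.intervalIntegrable (μ := MeasureTheory.volume)
  have e := intervalIntegral.integral_eq_sub_of_hasDerivAt hd hI
  have m : ∫ t in (512:ℝ)..x, 1 / Real.log t ^ 2 ≤ ∫ t in (512:ℝ)..x, (1 / Real.log t ^ 2 + 2 / Real.log t ^ 3 - 12 / Real.log t ^ 4) := by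
    refine intervalIntegral.integral_mono_on hx (Chebyshev.intervalIntegrable_one_div_log_sq (by norm_num) (by linarith)) hI ?_
    intro t ht
    have h6 := hlog t ht.1
    have : 0 ≤ 2 / Real.log t ^ 3 - 12 / Real.log t ^ 4 := by
      have : 2 / Real.log t ^ 3 - 12 / Real.log t ^ 4 = 2 * (Real.log t - 6) / Real.log t ^ 4 := by field_simp; ring
      rw [this]
      exact div_nonneg (by linarith) (by positivity)
    linarith
  have h5 := hlog 512 le_rfl
  have p : 0 ≤ (512:ℝ) / Real.log 512 ^ 2 + 4 * 512 / Real.log 512 ^ 3 := by positivity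
  linarith

theorem J_piece (a b : ℝ) (k : ℕ) (c : ℝ) (ha : a = 2^k) (hk : 1 ≤ k) (hab : a ≤ b) (hc : (b - a) / ((k * 0.6931) ^ 2) ≤ c) :
    ∫ t in a..b, 1 / Real.log t ^ 2 ≤ c := by
  have ha1 : 1 < a := by
    rw [ha]
    exact one_lt_pow₀ (by norm_num) (by omega)
  have h := intervalIntegral.integral_mono_on hab (Chebyshev.intervalIntegrable_one_div_log_sq ha1 (by linarith))
    (intervalIntegrable_const (c := 1 / ((k:ℝ) * 0.6931) ^ 2) (μ := MeasureTheory.volume)) (by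
    intro t ht
    have h1 : Real.log a ≤ Real.log t := Real.log_le_log (by linarith) ht.1
    rw [ha, Real.log_pow] at h1
    have := Real.log_two_gt_d9
    have hk0 : (1:ℝ) ≤ k := by exact_mod_cast hk
    have h2 : (k:ℝ) * 0.6931 ≤ k * Real.log 2 := by gcongr; linarith
    have h3 : (k:ℝ) * 0.6931 ≤ Real.log t := h2.trans h1
    gcongr)
  refine h.trans ?_
  rw [intervalIntegral.integral_const, smul_eq_mul, mul_one_div]
  exact hc

theorem J_all (x : ℝ) (hx : 512 ≤ x) : ∫ t in (2:ℝ)..x, 1 / Real.log t ^ 2 ≤ x / Real.log x ^ 2 + 4 * x / Real.log x ^ 3 + 60 := by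
  have i : ∀ a b : ℝ, 1 < a → 1 < b → IntervalIntegrable (fun x ↦ 1 / Real.log x ^ 2) MeasureTheory.volume a b := fun a b => Chebyshev.intervalIntegrable_one_div_log_sq
  have e1 := intervalIntegral.integral_add_adjacent_intervals (i 2 4 (by norm_num) (by norm_num)) (i 4 32 (by norm_num) (by norm_num))
  have e2 := intervalIntegral.integral_add_adjacent_intervals (i 2 32 (by norm_num) (by norm_num)) (i 32 512 (by norm_num) (by norm_num))
  have e3 := intervalIntegral.integral_add_adjacent_intervals (i 2 512 (by norm_num) (by norm_num)) (i 512 x (by norm_num) (by linarith))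
  have p1 := J_piece 2 4 1 5 (by norm_num) (by norm_num) (by norm_num) (by norm_num)
  have p2 := J_piece 4 32 2 15 (by norm_num) (by norm_num) (by norm_num) (by norm_num)
  have p3 := J_piece 32 512 5 40 (by norm_num) (by norm_num) (by norm_num) (by norm_num)
  have p4 := J_tail x hx
  push_cast at *
  linarith

theorem log4_le : Real.log 4 ≤ 1.3863 := by
  rw [show (4:ℝ) = 2^2 by norm_num, Real.log_pow]
  have := Real.log_two_lt_d9
  push_cast; linarith

theorem pi_bound (x ε : ℝ) (hx : 512 ≤ x) (hψ : Chebyshev.psi x ≤ (1 + ε) * x) :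
    (Nat.primeCounting ⌊x⌋₊ : ℝ) ≤ (1 + ε) * x / Real.log x + 1.3863 * (x / Real.log x ^ 2 + 4 * x / Real.log x ^ 3 + 60) := by
  rw [Chebyshev.primeCounting_eq_theta_div_log_add_integral (by linarith)]
  have hL : 0 < Real.log x := Real.log_pos (by linarith)
  have h1 : Chebyshev.theta x / Real.log x ≤ (1 + ε) * x / Real.log x := by
    gcongr
    exact (Chebyshev.theta_le_psi x).trans hψ
  have h2 : ∫ t in (2:ℝ)..x, Chebyshev.theta t / (t * Real.log t ^ 2) ≤ ∫ t in (2:ℝ)..x, 1.3863 * (1 / Real.log t ^ 2) := by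
    refine intervalIntegral.integral_mono_on (by linarith) ?_ ((Chebyshev.intervalIntegrable_one_div_log_sq (by norm_num) (by linarith)).const_mul _) ?_
    · rw [intervalIntegrable_iff_integrableOn_Icc_of_le (by linarith)]
      exact Chebyshev.integrableOn_theta_div_id_mul_log_sq x
    · intro t ht
      have ht2 : 2 ≤ t := ht.1
      have hl : 0 < Real.log t := Real.log_pos (by linarith)
      have h3 : Chebyshev.theta t ≤ 1.3863 * t := (Chebyshev.theta_le_log4_mul_x (by linarith)).trans (by gcongr; exact log4_le)
      have : Chebyshev.theta t / (t * Real.log t ^ 2) ≤ 1.3863 * t / (t * Real.log t ^ 2) := by gcongr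
      refine this.trans (le_of_eq ?_)
      have : t ≠ 0 := by linarith
      field_simp
  rw [intervalIntegral.integral_const_mul] at h2
  have h4 := J_all x hx
  linarith

end CH
end

section
open Finset
namespace CH

theorem log_lower (c y : ℝ) (hc : 0 < c) (hy : 0 < y) : Real.log c + 1 - c / y ≤ Real.log y := by
  have h := Real.log_le_sub_one_of_pos (show 0 < c / y by positivity)
  rw [Real.log_div (by linarith) (by linarith)] at h
  linarith

theorem low_chord (c l a b q v : ℝ) (hc : 0 < c) (ha : 0 < a) (h1 : a ≤ l) (h2 : l ≤ b) (hq : v ≤ Real.log c)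
    (s t : ℝ) (hs : s + t * a ≤ v + 1 - c / (2 * a)) (ht : s + t * b ≤ v + 1 - c / (2 * b)) (hlt : q < s + t * l) : q < Real.log (2 * l) := by
  have hl : 0 < l := by linarith
  have hb : 0 < b := by linarith
  have h := log_lower c (2 * l) hc (by linarith)
  refine hlt.trans_le (le_trans ?_ h)
  have h3 : (s + t * a) * (2 * a) ≤ (v + 1) * (2 * a) - c := by
    have := mul_le_mul_of_nonneg_right hs (by linarith : 0 ≤ 2 * a)
    rwa [sub_mul, div_mul_cancel₀ _ (by linarith)] at this
  have h4 : (s + t * b) * (2 * b) ≤ (v + 1) * (2 * b) - c := by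
    have := mul_le_mul_of_nonneg_right ht (by linarith : 0 ≤ 2 * b)
    rwa [sub_mul, div_mul_cancel₀ _ (by linarith)] at this
  have h5 : c / (2 * l) ≤ c / (2 * a) + c / (2 * b) - c * l / (2 * a * b) := by
    have e : c / (2 * a) + c / (2 * b) - c * l / (2 * a * b) - c / (2 * l) = c * ((l - a) * (b - l)) / (2 * a * b * l) := by
      field_simp; ring
    have : 0 ≤ c * ((l - a) * (b - l)) / (2 * a * b * l) :=
      div_nonneg (mul_nonneg hc.le (mul_nonneg (by linarith) (by linarith))) (by positivity)
    linarith
  have h6 : c * l / (2 * a * b) * (b - a) = (c / (2 * a) - c / (2 * b)) * l := by field_simp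
  by_cases hab : a = b
  · have : l = a := by linarith
    subst this
    linarith
  have hab' : 0 < b - a := by
    rcases lt_or_eq_of_le (h1.trans h2) with h | h
    · linarith
    · exact absurd h hab
  have h7 : s + t * l ≤ v + 1 - (c / (2 * a) + c / (2 * b) - c * l / (2 * a * b)) := by
    refine le_of_mul_le_mul_right ?_ hab'
    have h8 : (s + t * a) * (b - l) ≤ (v + 1 - c / (2 * a)) * (b - l) := mul_le_mul_of_nonneg_right hs (by linarith)
    have h9 : (s + t * b) * (l - a) ≤ (v + 1 - c / (2 * b)) * (l - a) := mul_le_mul_of_nonneg_right ht (by linarith)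
    have e1 : c / (2 * a) * a = c / 2 := by field_simp
    have e2 : c / (2 * b) * b = c / 2 := by field_simp
    nlinarith
  linarith

theorem glue (l L x N ε : ℝ) (hl : 8 ≤ l) (hx : 512 ≤ x) (hL : L = Real.log x) (hN : x = 2 * N * l + 2)
    (hψ : Chebyshev.psi x ≤ (1 + ε) * x) (A T : ℝ) (hA : l * (L + 4) ≤ A * L ^ 2)
    (hT : (83.178 * l + 2) * L ≤ T * x) (hlow : l + Real.log (2 * l) ≤ L)
    (h : ε * l + 1.3863 * A + T < Real.log (2 * l)) : (Nat.primeCounting ⌊x⌋₊ : ℝ) < 2 * N := by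
  have hp := pi_bound x ε hx hψ
  rw [← hL] at hp
  have hL0 : 0 < L := by rw [hL]; exact Real.log_pos (by linarith)
  have hx0 : 0 < x := by linarith
  refine hp.trans_lt ?_
  have e : 2 * N = (x - 2) / l := by rw [hN]; field_simp; ring
  rw [e, lt_div_iff₀ (by linarith)]
  have e2 : ((1 + ε) * x / L + 1.3863 * (x / L ^ 2 + 4 * x / L ^ 3 + 60)) * l
      = x / L * ((1 + ε) * l + 1.3863 * (l * (L + 4) / L ^ 2) + 83.178 * l * L / x) := by
    field_simp; ring
  have e3 : x - 2 = x / L * (L - 2 * L / x) := by field_simp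
  rw [e2, e3]
  refine mul_lt_mul_of_pos_left ?_ (by positivity)
  have h1 : l * (L + 4) / L ^ 2 ≤ A := by rw [div_le_iff₀ (by positivity)]; exact hA
  have h2 : 83.178 * l * L / x + 2 * L / x ≤ T := by
    rw [← add_div, div_le_iff₀ hx0]; linarith
  linarith

theorem T_aux (l L x N l0 T : ℝ) (hl0 : 8 ≤ l0) (hl : l0 ≤ l) (hN : N = Real.exp l) (hL : L = Real.log x)
    (hx : x = 2 * N * l + 2) (E : ℝ) (hE : 0 < E) (hE' : E ≤ Real.exp l0) (hT : 62.6 * l0 ≤ T * E) :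
    (83.178 * l + 2) * L ≤ T * x ∧ l + Real.log (2 * l) ≤ L ∧ E * 2 * l0 ≤ x := by
  have hl8 : 8 ≤ l := by linarith
  have hex : Real.exp l0 * (l - l0 + 1) ≤ Real.exp l := by
    have h := Real.add_one_le_exp (l - l0)
    have : Real.exp l = Real.exp l0 * Real.exp (l - l0) := by rw [← Real.exp_add]; congr 1; ring
    rw [this]
    gcongr
  have hN1 : E * (l - l0 + 1) ≤ N := by
    rw [hN]
    refine le_trans ?_ hex
    gcongr
  have hNE : E ≤ N := by
    refine le_trans ?_ hN1
    nlinarith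
  have hN0 : 0 < N := by linarith
  have hlx : Real.log (2 * N * l) = l + Real.log (2 * l) := by
    rw [show 2 * N * l = N * (2 * l) by ring, Real.log_mul (by linarith) (by linarith), hN, Real.log_exp]
  have hx0 : 0 < 2 * N * l := by positivity
  have hlog : l + Real.log (2 * l) ≤ L := by
    rw [hL, ← hlx]
    exact Real.log_le_log hx0 (by linarith)
  refine ⟨?_, hlog, ?_⟩
  · have hexp : Real.exp 1 ≤ 2 * N * l := by
      have : 1 + 1 ≤ N := by
        rw [hN]
        have := Real.add_one_le_exp l
        linarith
      have := Real.exp_one_lt_d9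
      nlinarith
    have ha := Real.log_div_self_antitoneOn (show (2 * N * l) ∈ {x | Real.exp 1 ≤ x} from hexp)
      (show x ∈ {x | Real.exp 1 ≤ x} from by show Real.exp 1 ≤ x; linarith) (by linarith : 2 * N * l ≤ x)
    simp only at ha
    rw [hlx, ← hL] at ha
    have hl2 : Real.log (2 * l) ≤ l / 2 := by
      have h := log_lower (2 * l) 8 (by linarith) (by norm_num)
      have h8 : Real.log 8 ≤ 2.08 := by
        rw [show (8:ℝ) = 2^3 by norm_num, Real.log_pow]
        have := Real.log_two_lt_d9
        push_cast; linarith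
      linarith
    have hb : L / x ≤ 0.75 / N := by
      refine ha.trans ?_
      rw [div_le_div_iff₀ hx0 hN0]
      nlinarith
    have hxp : 0 < x := by linarith
    have hTE : 0 < T := by
      by_contra hh
      push Not at hh
      nlinarith
    have hlE : 62.6 * l ≤ T * N := by
      have : T * (E * (l - l0 + 1)) ≤ T * N := by gcongr
      have h3 : 62.6 * l0 * (l - l0 + 1) ≤ T * E * (l - l0 + 1) := by
        gcongr
      nlinarith
    have : (83.178 * l + 2) * L = (83.178 * l + 2) * (L / x) * x := by field_simp
    rw [this]
    gcongr
    have h5 : (83.178 * l + 2) * (L / x) ≤ (83.178 * l + 2) * (0.75 / N) := by gcongr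
    refine h5.trans ?_
    rw [mul_div_assoc', div_le_iff₀ hN0]
    linarith
  · rw [hx]
    have : E * l0 ≤ N * l := by gcongr
    linarith

theorem large (n : ℕ) (hn : 1 ≤ n) (h8 : 8 ≤ Real.log n) : (Nat.primeCounting ⌊2 * (n:ℝ) * Real.log n + 2⌋₊ : ℝ) < 2 * (n:ℝ) := by
  have hn0 : (0:ℝ) < n := by exact_mod_cast hn
  obtain ⟨l, hl⟩ : ∃ l, l = Real.log n := ⟨_, rfl⟩
  obtain ⟨x, hx⟩ : ∃ x, x = 2 * (n:ℝ) * l + 2 := ⟨_, rfl⟩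
  obtain ⟨L, hL⟩ : ∃ L, L = Real.log x := ⟨_, rfl⟩
  have hN : (n:ℝ) = Real.exp l := by rw [hl, Real.exp_log hn0]
  rw [← hl] at h8 ⊢
  rw [← hx]
  have l2a := Real.log_two_gt_d9
  have l2b := Real.log_two_lt_d9
  have l3 := abs_le.1 lg3
  have l5 := abs_le.1 lg5
  have e1 := Real.exp_one_gt_d9
  have E8 : (2980:ℝ) ≤ Real.exp 8 := by
    have : (2.718281828:ℝ)^8 ≤ Real.exp 1 ^ 8 := by gcongr; linarith
    rw [← Real.exp_nat_mul] at this
    norm_num at this ⊢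
    linarith
  have E13 : (442000:ℝ) ≤ Real.exp 13 := by
    have : (2.718281828:ℝ)^13 ≤ Real.exp 1 ^ 13 := by gcongr; linarith
    rw [← Real.exp_nat_mul] at this
    norm_num at this ⊢
    linarith
  by_cases c13 : l < 13
  · obtain ⟨hT, hlow, hE⟩ := T_aux l L x n 8 0.1681 le_rfl h8 hN hL hx 2980 (by norm_num) E8 (by norm_num)
    have hx' : 47520 ≤ x := by linarith
    have h16 : Real.log 16 ≤ Real.log (2 * l) := Real.log_le_log (by norm_num) (by linarith)
    rw [show (16:ℝ) = 2^4 by norm_num, Real.log_pow] at h16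
    push_cast at h16
    have hc : 2.9957 ≤ Real.log 20 := by
      rw [show (20:ℝ) = 2^2 * 5 by norm_num, Real.log_mul (by norm_num) (by norm_num), Real.log_pow]
      try push_cast
      linarith
    refine glue l L x n 0.11338 h8 (by linarith) hL hx (by have := (bd3 x hx').2; linarith) 1.04 0.1681 (by nlinarith [sq_nonneg (L - 15)]) hT hlow (low_chord 20 l 8 13 _ 2.9957 (by norm_num) (by norm_num) (by linarith) (by linarith) hc 1.97646 0.096153 (by norm_num) (by norm_num) (by linarith))
  push Not at c13
  obtain ⟨hT, hlow, hE⟩ := T_aux l L x n 13 0.002 (by norm_num) c13 hN hL hx 442000 (by norm_num) E13 (by norm_num)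
  have hx1 : 47520 ≤ x := by linarith
  have h25 : Real.log 25 ≤ Real.log (2 * l) := Real.log_le_log (by norm_num) (by linarith)
  rw [show (25:ℝ) = 5^2 by norm_num, Real.log_pow] at h25
  push_cast at h25
  have hA : l * (L + 4) ≤ 1.02 * L ^ 2 := by nlinarith [sq_nonneg (L - 19)]
  by_cases c19 : l < 19.6
  · have hc : 3.6243 ≤ Real.log 37.5 := by
      rw [show (37.5:ℝ) = 5^2 * 3 / 2 by norm_num, Real.log_div (by norm_num) (by norm_num), Real.log_mul (by norm_num) (by norm_num), Real.log_pow]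
      try push_cast
      linarith
    refine glue l L x n 0.11338 h8 (by linarith) hL hx (by have := (bd3 x hx1).2; linarith) 1.02 0.002 hA hT hlow (low_chord 37.5 l 13 19.6 _ 3.6243 (by norm_num) (by norm_num) (by linarith) (by linarith) hc 2.22535 0.073587 (by norm_num) (by norm_num) (by linarith))
  push Not at c19
  have E19 : (3.2*10^8:ℝ) ≤ Real.exp 19.6 := by
    rw [← Real.log_le_iff_le_exp (by norm_num), show (3.2*10^8:ℝ) = 2^12 * 5^7 by norm_num, Real.log_mul (by norm_num) (by norm_num), Real.log_pow, Real.log_pow]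
    push_cast
    linarith
  by_cases c150 : l < 150
  · obtain ⟨-, -, hE⟩ := T_aux l L x n 19.6 0.002 (by norm_num) c19 hN hL hx (3.2*10^8) (by norm_num) E19 (by norm_num)
    have hx2 : 47520*262144 ≤ x := by norm_num at hE ⊢; linarith
    have hc : 4.0943 ≤ Real.log 60 := by
      rw [show (60:ℝ) = 2^2 * 3 * 5 by norm_num, Real.log_mul (by norm_num) (by norm_num), Real.log_mul (by norm_num) (by norm_num), Real.log_pow]
      try push_cast
      linarith
    refine glue l L x n 0.01828 h8 (by linarith) hL hx (by have := (bdA x hx2).2; linarith) 1.02 0.002 hA hT hlow (low_chord 60 l 19.6 150 _ 4.0943 (by norm_num) (by norm_num) (by linarith) (by linarith) hc 3.36367 0.010204 (by norm_num) (by norm_num) (by linarith))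
  push Not at c150
  have h1500 : Real.log 1500 = 2 * Real.log 2 + Real.log 3 + 3 * Real.log 5 := by
    rw [show (1500:ℝ) = 2^2 * 3 * 5^3 by norm_num, Real.log_mul (by norm_num) (by norm_num), Real.log_mul (by norm_num) (by norm_num), Real.log_pow, Real.log_pow]
    push_cast; ring
  by_cases c900 : l < 900
  · have E150 : (2^150:ℝ) ≤ Real.exp 150 := by
      have : (2:ℝ)^150 ≤ Real.exp 1 ^ 150 := by gcongr; linarith
      rwa [← Real.exp_nat_mul, mul_one] at this
    obtain ⟨-, -, hE⟩ := T_aux l L x n 150 0.002 (by norm_num) c150 hN hL hx (2^150) (by norm_num) E150 (by norm_num)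
    have hx2 : 47520*262144*262144*262144 ≤ x := by refine le_trans ?_ hE; norm_num
    have hc : 7.3132 ≤ Real.log 1500 := by
      rw [h1500]
      try push_cast
      linarith
    refine glue l L x n 0.0065 h8 (by linarith) hL hx (by have := (bdC x hx2).2; linarith) 1.02 0.002 hA hT hlow (low_chord 1500 l 150 900 _ 7.3132 (by norm_num) (by norm_num) (by linarith) (by linarith) hc 2.47994 0.005555 (by norm_num) (by norm_num) (by linarith))
  push Not at c900
  have hlL : l ≤ L := by linarith
  have hψ := psi_analytic L (by linarith)
  rw [hL, Real.exp_log (by linarith), ← hL] at hψ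
  have hlog : Real.log 1500 ≤ Real.log (2 * l) := Real.log_le_log (by norm_num) (by linarith)
  rw [h1500] at hlog
  refine glue l L x n (5.8/L) h8 (by linarith) hL hx (by linarith) 1.02 0.002 hA hT hlow (lt_of_lt_of_le ?_ hlog)
  have : 5.8 / L * l ≤ 5.8 := by
    rw [div_mul_eq_mul_div, div_le_iff₀ (by linarith)]
    linarith
  linarith

end CH
end

section
open Finset
namespace CH

def smallPrimes : List ℕ := [2, 3, 5, 7, 11, 13, 17, 19, 23, 29, 31, 37, 41, 43, 47, 53, 59, 61, 67, 71, 73, 79, 83, 89, 97, 101, 103, 107, 109, 113, 127, 131, 137, 139, 149, 151, 157, 163, 167, 173, 179, 181, 191, 193, 197, 199, 211]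

def svA (m : ℕ) : Bool := smallPrimes.all fun p => !(Nat.beq (m % p) 0) || Nat.beq m p

theorem svA_prime (m : ℕ) (h : m.Prime) : svA m = true := by
  unfold svA
  rw [List.all_eq_true]
  intro p hp
  have hp1 : p ≠ 1 := by
    rintro rfl
    simp [smallPrimes] at hp
  by_cases c : m % p = 0
  · have := (Nat.dvd_prime h).1 (Nat.dvd_of_mod_eq_zero c)
    rcases this with h1 | h1
    · exact absurd h1 hp1
    · subst h1; simp
  · have : Nat.beq (m % p) 0 = false := by
      rw [← Bool.not_eq_true, Nat.beq_eq]; exact c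
    simp [this]

def PP : ℕ := 1645783550795210387735581011435590727981167322669649249414629852197255934130751870910
theorem PP_eq : PP = smallPrimes.prod := by decide +kernel
def sv (m : ℕ) : Bool := bif Nat.ble m 255 then svA m else Nat.beq (Nat.gcd m PP) 1

theorem sv_prime (m : ℕ) (h : m.Prime) : sv m = true := by
  unfold sv
  by_cases c : m ≤ 255
  · have : Nat.ble m 255 = true := by simpa using c
    rw [this, cond_true]; exact svA_prime m h
  · have : Nat.ble m 255 = false := by rw [← Bool.not_eq_true, Nat.ble_eq]; exact c
    rw [this, cond_false, Nat.beq_eq]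
    refine (Nat.Prime.coprime_iff_not_dvd h).2 ?_
    rw [PP_eq, Prime.dvd_prod_iff h.prime]
    rintro ⟨p, hp, hd⟩
    have hp2 : 0 < p ∧ p ≤ 211 := by
      have : ∀ q ∈ smallPrimes, 0 < q ∧ q ≤ 211 := by decide
      exact this p hp
    have := Nat.le_of_dvd hp2.1 hd
    omega

def bc : ℕ → ℕ → ℕ → ℕ → ℕ
  | 0, a, lo, X => frc a fun a => bif Nat.ble 2 a && (Nat.blt lo a && (Nat.ble a X && sv a)) then 1 else 0
  | k+1, a, lo, X => frc a fun a => bif Nat.ble a X && Nat.ble lo (a + 2^(k+1)) then Nat.add (bc k a lo X) (bc k (a + 2^k) lo X) else 0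

theorem bc_bound (k : ℕ) : ∀ a lo X, ((Ico a (a + 2^k)).filter (fun m => lo < m ∧ m ≤ X ∧ m.Prime)).card ≤ bc k a lo X := by
  induction k with
  | zero =>
    intro a lo X
    unfold bc
    rw [frc_eq]
    simp only [pow_zero, Nat.Ico_succ_singleton, Finset.filter_singleton]
    split_ifs with h
    · have h2 := h.2.2.two_le
      have h3 : Nat.ble 2 a = true := by simpa using h2
      have h4 : Nat.ble a X = true := by simpa using h.2.1
      have h5 : Nat.blt lo a = true := by simpa using h.1
      rw [h3, h4, h5, sv_prime a h.2.2]; simp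
    · simp
  | succ k ih =>
    intro a lo X
    unfold bc
    rw [frc_eq]
    by_cases c : a ≤ X ∧ lo ≤ a + 2^(k+1)
    · have h1 : Nat.ble a X = true := by simpa using c.1
      have h2 : Nat.ble lo (a + 2^(k+1)) = true := by simpa using c.2
      rw [h1, h2, Bool.and_true, cond_true]
      have e : Ico a (a + 2^(k+1)) = Ico a (a + 2^k) ∪ Ico (a + 2^k) (a + 2^k + 2^k) := by
        rw [Ico_union_Ico_eq_Ico (Nat.le_add_right _ _) (Nat.le_add_right _ _)]
        congr 1; ring
      rw [e, filter_union]
      exact (card_union_le _ _).trans (Nat.add_le_add (ih a lo X) (ih (a + 2^k) lo X))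
    · have : (Ico a (a + 2^(k+1))).filter (fun m => lo < m ∧ m ≤ X ∧ m.Prime) = ∅ := by
        rw [filter_eq_empty_iff]
        intro m hm
        rw [mem_Ico] at hm
        rintro ⟨h', h, -⟩
        exact c ⟨by omega, by omega⟩
      rw [this]; simp

theorem pi_bc (lo X : ℕ) (hX : X < 2^16) : Nat.primeCounting X ≤ Nat.primeCounting lo + bc 16 0 lo X := by
  refine le_trans ?_ (Nat.add_le_add_left (bc_bound 16 0 lo X) _)
  unfold Nat.primeCounting Nat.primeCounting'
  rw [Nat.count_eq_card_filter_range, Nat.count_eq_card_filter_range]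
  refine le_trans (card_le_card ?_) (card_union_le _ _)
  intro m
  simp only [mem_filter, mem_range, mem_Ico, mem_union]
  rintro ⟨h1, h2⟩
  by_cases c : m < lo + 1
  · exact Or.inl ⟨c, h2⟩
  · exact Or.inr ⟨⟨by omega, by omega⟩, by omega, by omega, h2⟩

def VV (m d : ℕ) : ℕ := lgK m * 10^9 / RR + 3 + d * 693147181
def XE (m d : ℕ) : ℕ := 2 * (m * 2^d) * VV m d / 10^9 + 2

theorem VV_bd (m d : ℕ) (h1 : 1 ≤ m) (h2 : m < 1024) : Real.log ((m * 2^d : ℕ) : ℝ) ≤ (VV m d : ℝ) / 10^9 := by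
  have h := (abs_le.1 (lg_bd m h1 h2)).2
  have hm : (0:ℝ) < m := by exact_mod_cast h1
  push_cast
  rw [Real.log_mul hm.ne' (by positivity), Real.log_pow]
  have hl := Real.log_two_lt_d9
  have hd : (d:ℝ) * Real.log 2 ≤ d * 0.693147181 := by gcongr; linarith
  have hf := (floor_pair (lg m * 10^9) RR).2
  unfold VV
  rw [lgK_eq]
  push_cast at hf ⊢
  have e : (lg m : ℝ) * 1000000000 / (RR:ℝ) = 10^9 * ((lg m : ℝ) / RR) := by ring
  rw [e] at hf
  linarith

theorem seg (n0 m d : ℕ) (h1 : 1 ≤ m) (h2 : m < 1024) (hb : Nat.primeCounting (XE m d) < 2 * n0) (n : ℕ) (hn1 : 1 ≤ n) (hn : n0 ≤ n) (hn' : n ≤ m * 2^d) :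
    Nat.primeCounting ⌊2 * (n:ℝ) * Real.log n + 2⌋₊ < 2 * n := by
  have hx : ⌊2 * (n:ℝ) * Real.log n + 2⌋₊ ≤ XE m d := by
    have hn0 : (1:ℝ) ≤ n := by exact_mod_cast hn1
    have hN : (n:ℝ) ≤ ((m * 2^d : ℕ) : ℝ) := by exact_mod_cast hn'
    have hlog : Real.log n ≤ (VV m d : ℝ) / 10^9 := (Real.log_le_log (by linarith) hN).trans (VV_bd m d h1 h2)
    have hlog0 : 0 ≤ Real.log n := Real.log_nonneg hn0
    have : 2 * (n:ℝ) * Real.log n ≤ ((2 * (m * 2^d) * VV m d : ℕ) : ℝ) / ((10^9 : ℕ) : ℝ) := by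
      calc 2 * (n:ℝ) * Real.log n ≤ 2 * ((m * 2^d : ℕ) : ℝ) * ((VV m d : ℝ) / 10^9) := by gcongr
        _ = _ := by push_cast; ring
    have h3 : ⌊2 * (n:ℝ) * Real.log n + 2⌋₊ ≤ ⌊((2 * (m * 2^d) * VV m d : ℕ) : ℝ) / ((10^9 : ℕ) : ℝ) + 2⌋₊ := Nat.floor_le_floor (by linarith)
    refine h3.trans (le_of_eq ?_)
    rw [Nat.floor_add_ofNat (by positivity), Nat.floor_div_natCast, Nat.floor_natCast]
    rfl
  have := Nat.monotone_primeCounting hx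
  omega

def chain : List (ℕ × ℕ) → ℕ → ℕ → ℕ → Bool
  | [], _, _, _ => true
  | (m, d) :: t, n0, lo, c => (Nat.ble 1 m && Nat.blt m 1024) && (frc (XE m d) fun X => frc (c + bc 16 0 lo X) fun c' =>
      (Nat.blt X (2^16) && Nat.blt c' (2 * n0)) && frc (m * 2^d + 1) fun n1 => chain t n1 X c')
def lastN : List (ℕ × ℕ) → ℕ → ℕ
  | [], n0 => n0
  | (m, d) :: t, _ => lastN t (m * 2^d + 1)

theorem chain_ok (L : List (ℕ × ℕ)) : ∀ n0 lo c, chain L n0 lo c = true → Nat.primeCounting lo ≤ c → ∀ n, 1 ≤ n → n0 ≤ n → n < lastN L n0 →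
    Nat.primeCounting ⌊2 * (n:ℝ) * Real.log n + 2⌋₊ < 2 * n := by
  induction L with
  | nil => intro n0 _ _ _ _ n _ h1 h2; simp [lastN] at h2; omega
  | cons p t ih =>
    obtain ⟨m, d⟩ := p
    intro n0 lo c h hc n hn h1 h2
    simp only [chain, frc_eq, Bool.and_eq_true, Nat.ble_eq, Nat.blt_eq] at h
    obtain ⟨⟨a1, a2⟩, ⟨a3, a4⟩, a5⟩ := h
    have hp : Nat.primeCounting (XE m d) ≤ c + bc 16 0 lo (XE m d) := (pi_bc lo _ a3).trans (by omega)
    by_cases c : n ≤ m * 2^d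
    · exact seg n0 m d a1 a2 (by omega) n hn h1 c
    · exact ih _ _ _ a5 hp n hn (by omega) h2

def segs : List (ℕ × ℕ) := [(1, 0), (2, 0), (3, 0), (5, 0), (8, 0), (11, 0), (15, 0), (21, 0), (28, 0), (37, 0), (48, 0), (62, 0), (79, 0), (101, 0), (128, 0), (160, 0), (201, 0), (251, 0), (313, 0), (389, 0), (480, 0), (593, 0), (729, 0), (897, 0), (548, 1), (672, 1), (816, 1), (993, 1), (602, 2), (730, 2), (748, 2)]

theorem segs_ok : chain segs 1 0 0 = true := by decide +kernel

theorem small (n : ℕ) (hn : 1 ≤ n) (h : n < 2993) : Nat.primeCounting ⌊2 * (n:ℝ) * Real.log n + 2⌋₊ < 2 * n :=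
  chain_ok segs 1 0 0 segs_ok (by simp) n hn hn (by simpa [segs, lastN] using h)

end CH
end

theorem floor_lt_nth_prime_two_n (n : ℕ) (hn : 1 ≤ n) :
    ⌊2 * (n : ℝ) * Real.log n + 2⌋ < (Nat.nth Nat.Prime (2 * n - 1) : ℤ) := by
  have hn1 : (1:ℝ) ≤ n := by exact_mod_cast hn
  have hl0 : 0 ≤ Real.log n := Real.log_nonneg hn1
  have key : Nat.primeCounting ⌊2 * (n:ℝ) * Real.log n + 2⌋₊ < 2 * n := by
    by_cases h : n < 2993
    · exact CH.small n hn h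
    · have h8 : 8 ≤ Real.log n := by
        rw [Real.le_log_iff_exp_le (by linarith)]
        have hn' : (2993:ℝ) ≤ n := by exact_mod_cast (not_lt.1 h)
        have e1 := Real.exp_one_lt_d9
        have : Real.exp 1 ^ 8 ≤ (2.7182818286:ℝ)^8 := by gcongr
        rw [← Real.exp_nat_mul] at this
        norm_num at this ⊢
        linarith
      exact_mod_cast CH.large n hn h8
  have hpos : 0 ≤ 2 * (n:ℝ) * Real.log n + 2 := by positivity
  rw [← Int.natCast_floor_eq_floor hpos]
  have h2 : Nat.count Nat.Prime (⌊2 * (n:ℝ) * Real.log n + 2⌋₊ + 1) ≤ 2 * n - 1 := by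
    have : Nat.primeCounting ⌊2 * (n:ℝ) * Real.log n + 2⌋₊ = Nat.count Nat.Prime (⌊2 * (n:ℝ) * Real.log n + 2⌋₊ + 1) := rfl
    omega
  have := (Nat.count_le_iff_le_nth Nat.infinite_setOfPred_prime).1 h2
  exact_mod_cast this
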